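/- Let v be a real-valued Schwartz-class function on ℝ. Let iκ₁, …, iκ_N (κ_j > 0) be the zeros of a(k) in the half-plane Im k > 0, which are finitely many, simple, and lie on the imaginary axis. Define functions σ_l on ℝ recursively by σ₀ = 0, σ₁ = v, and σ_l = −σ'_{l−1} − ∑_{j=1}^{l−1} σ_{l−j−1} σ_j for l ≥ 2. Then for every integer l ≥ 0 the Zakharov–Faddeev trace identity holds: (1/(πi)) ∫_{−∞}^{∞} k^{2l} log|a(k)| dk + (2/(2l+1)) ∑_{j=1}^{N} (iκ_j)^{2l+1} = (1/(2i))^{2l+1} ∫_{−∞}^{∞} σ_{2l+1}(x) dx. -/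

import Mathlib

open Real Set MeasureTheory Filter Complex

/-- `f` (with derivative `f'` and second derivative `f''`) is a twice continuously
differentiable solution of the one-dimensional Schrödinger equation `-f'' + v·f = k²·f` on `ℝ`. -/
def IsSchrodingerSolution (v : ℝ → ℝ) (k : ℂ) (f f' f'' : ℝ → ℂ) : Prop :=
  (∀ x : ℝ, HasDerivAt f (f' x) x) ∧ (∀ x : ℝ, HasDerivAt f' (f'' x) x) ∧
    Continuous f'' ∧ (∀ x : ℝ, -(f'' x) + (v x : ℂ) * f x = k ^ 2 * f x)

/-- The Jost asymptotics at `+∞`: `e^{-ikx} f(x) → 1` and `e^{-ikx} f'(x) → ik` as `x → +∞`. -/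
def IsJostAtPlusInfinity (k : ℂ) (f f' : ℝ → ℂ) : Prop :=
  Tendsto (fun x : ℝ => Complex.exp (-Complex.I * k * x) * f x) atTop (nhds 1) ∧
    Tendsto (fun x : ℝ => Complex.exp (-Complex.I * k * x) * f' x) atTop (nhds (Complex.I * k))

/-- The Jost asymptotics at `-∞`: `e^{ikx} f(x) → 1` and `e^{ikx} f'(x) → -ik` as `x → -∞`. -/
def IsJostAtMinusInfinity (k : ℂ) (f f' : ℝ → ℂ) : Prop :=
  Tendsto (fun x : ℝ => Complex.exp (Complex.I * k * x) * f x) atBot (nhds 1) ∧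
    Tendsto (fun x : ℝ => Complex.exp (Complex.I * k * x) * f' x) atBot (nhds (-Complex.I * k))

/-- The polynomials `σ_l` of the Zakharov–Faddeev trace identities: `σ₀ = 0`, `σ₁ = v`,
and `σ_l = -σ'_{l-1} - ∑_{j=1}^{l-1} σ_{l-j-1} σ_j` for `l ≥ 2`. -/
noncomputable def sigmaZF (v : ℝ → ℝ) : ℕ → ℝ → ℝ
  | 0 => fun _ => 0
  | 1 => v
  | (m + 2) => fun x => -deriv (sigmaZF v (m + 1)) x -
      ∑ j ∈ (Finset.Icc 1 (m + 1)).attach, sigmaZF v (m + 1 - j.1) x * sigmaZF v j.1 x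
  termination_by l => l
  decreasing_by
  · omega
  · omega
  · have := j.2; simp only [Finset.mem_Icc] at this; omega


lemma hasDerivAt_normSq_zf {f : ℝ → ℂ} {f' : ℂ} {x : ℝ} (h : HasDerivAt f f' x) :
    HasDerivAt (fun y => normSq (f y)) (2 * ((starRingEnd ℂ) (f x) * f').re) x := by
  have := h.norm_sq
  simp only [Complex.inner] at this
  refine (this.congr_deriv ?_).congr_of_eventuallyEq ?_
  · ring_nf
  · exact Eventually.of_forall fun y => Complex.normSq_eq_norm_sq _

lemma halfline_decay {k : ℂ} (hk : 0 ≤ k.im) {m m' m'' : ℝ → ℂ} {v : ℝ → ℝ} {s : ℝ → ℂ}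
    {n : ℕ} {A B : ℝ}
    (hm' : ∀ x, HasDerivAt m' (m'' x) x)
    (heq : ∀ x, m'' x = -2 * I * k * m' x + v x * m x + s x)
    (hv : ∀ x, 0 ≤ x → |v x| * (1 + x) ^ (n + 2) ≤ A)
    (hs : ∀ x, 0 ≤ x → ‖s x‖ * (1 + x) ^ (n + 2) ≤ B)
    {μ : ℂ} (hμ : Tendsto m atTop (nhds μ)) (h0 : Tendsto m' atTop (nhds 0)) :
    Tendsto (fun x : ℝ => (1 + x) ^ n * ‖m' x‖) atTop (nhds 0) := by
  have hA : 0 ≤ A := le_trans (by positivity) (hv 0 le_rfl)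
  have hB : 0 ≤ B := le_trans (by positivity) (hs 0 le_rfl)
  set M0 := ‖μ‖ + 1 with hM0
  have hev : ∀ᶠ x in atTop, ‖m x‖ ≤ M0 :=
    (hμ.norm.eventually (eventually_le_nhds (show ‖μ‖ < M0 by linarith)))
  obtain ⟨X0, hX0⟩ := (hev.and (eventually_ge_atTop 0)).exists_forall_of_atTop
  set C := A * M0 + B with hC
  have hCn : 0 ≤ C := by positivity
  have key : ∀ x, X0 ≤ x → ‖m' x‖ ≤ C / (1 + x) ^ (n + 1) := by
    intro x hx
    have hx0 : 0 ≤ x := (hX0 x hx).2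
    have hbd : ∀ X, x ≤ X → ‖m' x‖ ≤ C / (1 + x) ^ (n + 1) + ‖m' X‖ := by
      intro X hX
      set z : ℝ → ℂ := fun y => Complex.exp (2 * I * k * (y - x)) * m' y with hz
      have hexp : ∀ y, x ≤ y → ‖Complex.exp (2 * I * k * (y - x))‖ ≤ 1 := by
        intro y hy
        rw [Complex.norm_exp, Real.exp_le_one_iff]
        have : (2 * I * k * (y - x) : ℂ).re = -(2 * k.im * (y - x)) := by
          simp [Complex.mul_re, Complex.mul_im]
        rw [this]
        have : 0 ≤ 2 * k.im * (y - x) := by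
          have := sub_nonneg.2 hy
          positivity
        linarith
      have hzd : ∀ y : ℝ, HasDerivAt z (Complex.exp (2 * I * k * (y - x)) * (v y * m y + s y)) y := by
        intro y
        have h1 : HasDerivAt (fun y : ℝ => Complex.exp (2 * I * k * (y - x)))
            (Complex.exp (2 * I * k * (y - x)) * (2 * I * k)) y := by
          have := (((hasDerivAt_id (y : ℂ)).sub_const (x : ℂ)).const_mul (2 * I * k)).cexp.comp_ofReal
          simpa using this
        have h2 := h1.fun_mul (hm' y)
        refine h2.congr_deriv ?_
        rw [heq]; ring
      have hzn : ∀ y : ℝ, x ≤ y → ‖Complex.exp (2 * I * k * (y - x)) * (v y * m y + s y)‖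
          ≤ C * (n + 1) / (1 + y) ^ (n + 2) := by
        intro y hy
        have hy0 : 0 ≤ y := hx0.trans hy
        have hp : 0 < (1 + y) ^ (n + 2) := by positivity
        rw [norm_mul, le_div_iff₀ hp]
        have e1 := hexp y hy
        have e2 : ‖(v y * m y + s y : ℂ)‖ ≤ |v y| * M0 + ‖s y‖ := by
          refine (norm_add_le _ _).trans ?_
          rw [norm_mul, Complex.norm_real, Real.norm_eq_abs]
          gcongr
          exact (hX0 y (hx.trans hy)).1
        have e3 : (|v y| * M0 + ‖s y‖) * (1 + y) ^ (n + 2) ≤ C := by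
          have := hv y hy0
          have := hs y hy0
          have h3 : |v y| * (1 + y) ^ (n + 2) * M0 ≤ A * M0 := by gcongr
          rw [hC]; linarith
        calc ‖Complex.exp (2 * I * k * (y - x))‖ * ‖(v y * m y + s y : ℂ)‖ * (1 + y) ^ (n + 2)
            ≤ 1 * (|v y| * M0 + ‖s y‖) * (1 + y) ^ (n + 2) := by gcongr
          _ ≤ C := by linarith
          _ ≤ C * (n + 1) := by nlinarith [(Nat.cast_nonneg n : (0:ℝ) ≤ n)]
      have hBd : ∀ y ∈ Ico x X, HasDerivAt (fun y : ℝ => C * (1 / (1 + x) ^ (n + 1) - ((1 + y) ^ (n + 1))⁻¹))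
          (C * (n + 1) / (1 + y) ^ (n + 2)) y := by
        intro y hy
        have hy1 : (1 + y) ≠ 0 := by have := hy.1; linarith
        have h1 : HasDerivAt (fun y : ℝ => (1 + y) ^ (n + 1)) ((n + 1) * (1 + y) ^ n) y := by
          have := ((hasDerivAt_id y).const_add 1).fun_pow (n + 1)
          simpa using this
        have h2 := ((h1.fun_inv (pow_ne_zero _ hy1)).const_sub (1 / (1 + x) ^ (n + 1))).const_mul C
        refine h2.congr_deriv ?_
        field_simp
        ring
      have hcz : ContinuousOn z (Icc x X) := fun y _ => (hzd y).continuousAt.continuousWithinAt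
      have := image_norm_le_of_norm_deriv_right_le_deriv_boundary'
        (f := fun y => z y - z x) (f' := fun y => Complex.exp (2 * I * k * (y - x)) * (v y * m y + s y))
        (a := x) (b := X) (hcz.sub continuousOn_const)
        (fun y hy => ((hzd y).sub_const _).hasDerivWithinAt)
        (B := fun y : ℝ => C * (1 / (1 + x) ^ (n + 1) - ((1 + y) ^ (n + 1))⁻¹))
        (B' := fun y => C * (n + 1) / (1 + y) ^ (n + 2))
        (by simp)
        (by
          have : ∀ y ∈ Icc x X, (1 + y) ^ (n+1) ≠ 0 := fun y hy => by
            have h1 := hy.1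
            have h2 : 0 < 1 + y := by linarith
            positivity
          fun_prop (disch := assumption))
        (fun y hy => (hBd y hy).hasDerivWithinAt)
        (fun y hy => hzn y hy.1) (right_mem_Icc.2 hX)
      have hzx : z x = m' x := by simp [hz]
      have hzX : ‖z X‖ ≤ ‖m' X‖ := by
        rw [hz]; simp only [norm_mul]
        exact mul_le_of_le_one_left (norm_nonneg _) (hexp X hX)
      have h5 : C * (1 / (1 + x) ^ (n + 1) - ((1 + X) ^ (n + 1))⁻¹) ≤ C / (1 + x) ^ (n + 1) := by
        have : 0 ≤ C * ((1 + X) ^ (n + 1))⁻¹ := by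
          have : 0 ≤ X := hx0.trans hX
          positivity
        rw [mul_sub, mul_one_div]; linarith
      have h6 : ‖m' x‖ ≤ ‖z X - z x‖ + ‖z X‖ := by
        rw [← hzx]
        have := norm_sub_norm_le (z x) (z X)
        rw [norm_sub_rev] at this
        linarith
      linarith
    have hl : Tendsto (fun X => C / (1 + x) ^ (n + 1) + ‖m' X‖) atTop (nhds (C / (1 + x) ^ (n + 1) + 0)) :=
      (by simpa using h0.norm : Tendsto (fun X => ‖m' X‖) atTop (nhds 0)).const_add _
    rw [add_zero] at hl
    exact ge_of_tendsto hl ((eventually_ge_atTop x).mono hbd)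
  have hl : Tendsto (fun x : ℝ => C / (1 + x)) atTop (nhds 0) :=
    tendsto_const_nhds.div_atTop (tendsto_atTop_add_const_left _ _ tendsto_id)
  refine squeeze_zero' ?_ ?_ hl
  · filter_upwards [eventually_ge_atTop 0] with x hx
    positivity
  · filter_upwards [eventually_ge_atTop X0] with x hx
    have hx0 := (hX0 x hx).2
    calc (1 + x) ^ n * ‖m' x‖ ≤ (1 + x) ^ n * (C / (1 + x) ^ (n + 1)) := by gcongr; exact key x hx
      _ = C / (1 + x) := by field_simp; ring

/-- Uniform half-line estimate. -/
lemma halfline_bound {k : ℂ} (hk : 0 ≤ k.im) {m m' m'' : ℝ → ℂ} {v : ℝ → ℝ} {s : ℝ → ℂ}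
    {n : ℕ} (hn : 2 ≤ n) {A B : ℝ}
    (hm : ∀ x, HasDerivAt m (m' x) x)
    (hm' : ∀ x, HasDerivAt m' (m'' x) x)
    (heq : ∀ x, m'' x = -2 * I * k * m' x + v x * m x + s x)
    (hv : ∀ x, 0 ≤ x → |v x| * (1 + x) ^ (n + 2) ≤ A)
    (hs : ∀ x, 0 ≤ x → ‖s x‖ * (1 + x) ^ (n + 2) ≤ B)
    {μ : ℂ} (hμ : Tendsto m atTop (nhds μ)) (h0 : Tendsto m' atTop (nhds 0)) :
    ∀ x, 0 ≤ x → ‖m x‖ ^ 2 + ((1 + x) ^ n * ‖m' x‖) ^ 2 ≤ Real.exp (A + 2) * (‖μ‖ ^ 2 + B ^ 2) := by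
  have hA : 0 ≤ A := le_trans (by positivity) (hv 0 le_rfl)
  have hB : 0 ≤ B := le_trans (by positivity) (hs 0 le_rfl)
  have hdec := halfline_decay hk hm' heq hv hs hμ h0
  set E : ℝ → ℝ := fun x => normSq (m x) + ((1 + x) ^ n) ^ 2 * normSq (m' x) with hE
  have hEeq : ∀ x, E x = ‖m x‖ ^ 2 + ((1 + x) ^ n * ‖m' x‖) ^ 2 := by
    intro x; simp only [hE, Complex.normSq_eq_norm_sq, mul_pow]
  have hEl : Tendsto E atTop (nhds (‖μ‖ ^ 2)) := by
    have : Tendsto (fun x => ‖m x‖ ^ 2 + ((1 + x) ^ n * ‖m' x‖) ^ 2) atTop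
      (nhds (‖μ‖ ^ 2 + 0 ^ 2)) := (hμ.norm.pow 2).add (hdec.pow 2)
    simpa [← hEeq] using this
  set E' : ℝ → ℝ := fun x => 2 * ((starRingEnd ℂ) (m x) * m' x).re +
    (2 * (1 + x) ^ n * (n * (1 + x) ^ (n - 1)) * normSq (m' x) +
      ((1 + x) ^ n) ^ 2 * (2 * ((starRingEnd ℂ) (m' x) * m'' x).re)) with hE'
  have hEd : ∀ x, HasDerivAt E (E' x) x := by
    intro x
    have h1 : HasDerivAt (fun y : ℝ => (1 + y) ^ n) (n * (1 + x) ^ (n - 1)) x := by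
      have := ((hasDerivAt_id x).const_add 1).fun_pow n
      simpa using this
    have h2 := (hasDerivAt_normSq_zf (hm x)).fun_add
      ((h1.fun_pow 2).fun_mul (hasDerivAt_normSq_zf (hm' x)))
    refine h2.congr_deriv ?_
    simp only [hE']
    push_cast; ring
  have hlow : ∀ x, 0 ≤ x → -((A + 2) / (1 + x) ^ 2 * (E x + B ^ 2)) ≤ E' x := by
    intro x hx
    have ht : 0 < 1 + x := by linarith
    set t := 1 + x with htd
    set Y := t ^ n * ‖m' x‖ with hY
    have hY0 : 0 ≤ Y := by positivity
    have hm0 := norm_nonneg (m x)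
    have b1 : -(‖m x‖ * Y / t ^ 2) ≤ ((starRingEnd ℂ) (m x) * m' x).re := by
      have h1 := Complex.abs_re_le_norm ((starRingEnd ℂ) (m x) * m' x)
      rw [norm_mul, RCLike.norm_conj] at h1
      have h2 : ‖m' x‖ ≤ Y / t ^ 2 := by
        rw [le_div_iff₀ (by positivity), hY, mul_comm]
        gcongr
        linarith
      have h3 := neg_le_of_abs_le h1
      have h4 : ‖m x‖ * ‖m' x‖ ≤ ‖m x‖ * (Y / t ^ 2) := by gcongr
      rw [mul_div_assoc]; linarith
    have b2 : 0 ≤ 2 * t ^ n * (n * t ^ (n - 1)) * normSq (m' x) := by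
      have := normSq_nonneg (m' x)
      positivity
    have b3 : -(Y * ‖m x‖ * A / t ^ 2) - (Y * B / t ^ 2) ≤
        (t ^ n) ^ 2 * ((starRingEnd ℂ) (m' x) * m'' x).re := by
      have e1 : ((starRingEnd ℂ) (m' x) * m'' x).re = 2 * k.im * normSq (m' x) +
          ((starRingEnd ℂ) (m' x) * (v x * m x + s x)).re := by
        rw [heq]
        simp [Complex.mul_re, Complex.mul_im, normSq_apply]
        ring
      have h1 := Complex.abs_re_le_norm ((starRingEnd ℂ) (m' x) * (v x * m x + s x))
      rw [norm_mul, RCLike.norm_conj] at h1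
      have h2 : ‖(v x * m x + s x : ℂ)‖ ≤ |v x| * ‖m x‖ + ‖s x‖ := by
        refine (norm_add_le _ _).trans ?_
        rw [norm_mul, Complex.norm_real, Real.norm_eq_abs]
      have h3 := neg_le_of_abs_le h1
      have h4 : ‖m' x‖ * ‖(v x * m x + s x : ℂ)‖ ≤ ‖m' x‖ * (|v x| * ‖m x‖ + ‖s x‖) := by gcongr
      have h5 : t ^ n * |v x| ≤ A / t ^ 2 := by
        rw [le_div_iff₀ (by positivity)]
        have := hv x hx
        rw [pow_add] at this; linarith
      have h6 : t ^ n * ‖s x‖ ≤ B / t ^ 2 := by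
        rw [le_div_iff₀ (by positivity)]
        have := hs x hx
        rw [pow_add] at this; linarith
      have h7 : 0 ≤ 2 * k.im * normSq (m' x) := by
        have := normSq_nonneg (m' x)
        positivity
      calc -(Y * ‖m x‖ * A / t ^ 2) - (Y * B / t ^ 2)
          = -(Y * (‖m x‖ * (A / t ^ 2) + B / t ^ 2)) := by ring
        _ ≤ -(Y * (‖m x‖ * (t ^ n * |v x|) + t ^ n * ‖s x‖)) := by gcongr
        _ = (t ^ n) ^ 2 * (-(‖m' x‖ * (|v x| * ‖m x‖ + ‖s x‖))) := by rw [hY]; ring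
        _ ≤ _ := by
          gcongr
          rw [e1]; linarith
    have hEx : E x = ‖m x‖ ^ 2 + Y ^ 2 := hEeq x
    have hfin : -((A + 2) * (E x + B ^ 2)) ≤ -(2 * (‖m x‖ * Y)) - 2 * (Y * ‖m x‖ * A) - 2 * (Y * B) := by
      rw [hEx]
      have q1 : 2 * (‖m x‖ * Y) ≤ ‖m x‖ ^ 2 + Y ^ 2 := by nlinarith [sq_nonneg (‖m x‖ - Y)]
      have q2 : 2 * (Y * ‖m x‖ * A) ≤ A * (‖m x‖ ^ 2 + Y ^ 2) := by
        calc 2 * (Y * ‖m x‖ * A) = A * (2 * (‖m x‖ * Y)) := by ring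
          _ ≤ _ := by gcongr
      have q3 : 2 * (Y * B) ≤ Y ^ 2 + B ^ 2 := by nlinarith [sq_nonneg (Y - B)]
      nlinarith [sq_nonneg (‖m x‖), sq_nonneg B, mul_nonneg hA (sq_nonneg B)]
    have hfin2 : -((A + 2) / t ^ 2 * (E x + B ^ 2)) ≤
      (-(2 * (‖m x‖ * Y)) - 2 * (Y * ‖m x‖ * A) - 2 * (Y * B)) / t ^ 2 := by
      rw [le_div_iff₀ (by positivity)]
      refine le_trans (le_of_eq ?_) hfin
      field_simp
    refine hfin2.trans ?_
    have : (-(2 * (‖m x‖ * Y)) - 2 * (Y * ‖m x‖ * A) - 2 * (Y * B)) / t ^ 2 =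
      2 * (-(‖m x‖ * Y / t ^ 2)) + 2 * (-(Y * ‖m x‖ * A / t ^ 2) - (Y * B / t ^ 2)) := by ring
    rw [this]
    simp only [hE']
    linarith
  set Φ : ℝ → ℝ := fun x => (E x + B ^ 2) * Real.exp (-(A + 2) * (1 + x)⁻¹) with hΦ
  have hΦd : ∀ x, 0 ≤ x → HasDerivAt Φ ((E' x + (A + 2) / (1 + x) ^ 2 * (E x + B ^ 2)) *
      Real.exp (-(A + 2) * (1 + x)⁻¹)) x := by
    intro x hx
    have ht : 1 + x ≠ 0 := by linarith
    have h1 : HasDerivAt (fun x : ℝ => Real.exp (-(A + 2) * (1 + x)⁻¹))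
        (Real.exp (-(A + 2) * (1 + x)⁻¹) * (-(A + 2) * (-1 / (1 + x) ^ 2))) x :=
      ((((hasDerivAt_id x).const_add 1).fun_inv ht).const_mul _).exp
    refine (((hEd x).add_const (B ^ 2)).fun_mul h1).congr_deriv ?_
    ring
  have hmono : MonotoneOn Φ (Ici 0) := by
    refine monotoneOn_of_deriv_nonneg (convex_Ici 0)
      (fun x hx => (hΦd x hx).continuousAt.continuousWithinAt)
      (fun x hx => (hΦd x (interior_subset hx)).differentiableAt.differentiableWithinAt) ?_
    intro x hx
    rw [(hΦd x (interior_subset hx)).deriv]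
    have := hlow x (interior_subset hx)
    refine mul_nonneg (by linarith) (Real.exp_pos _).le
  have hΦl : Tendsto Φ atTop (nhds (‖μ‖ ^ 2 + B ^ 2)) := by
    have h1 : Tendsto (fun x : ℝ => Real.exp (-(A + 2) * (1 + x)⁻¹)) atTop (nhds (Real.exp (-(A + 2) * 0))) :=
      (Real.continuous_exp.tendsto _).comp
        ((tendsto_inv_atTop_zero.comp (tendsto_atTop_add_const_left _ _ tendsto_id)).const_mul _)
    have h2 := (hEl.add_const (B ^ 2)).mul h1
    rw [mul_zero, Real.exp_zero, mul_one] at h2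
    exact h2
  intro x hx
  have hle : Φ x ≤ ‖μ‖ ^ 2 + B ^ 2 :=
    ge_of_tendsto hΦl ((eventually_ge_atTop x).mono fun y hy => hmono hx (hx.trans hy : (0:ℝ) ≤ y) hy)
  rw [← hEeq]
  have h1 : Real.exp (-(A + 2)) ≤ Real.exp (-(A + 2) * (1 + x)⁻¹) := by
    apply Real.exp_le_exp.2
    have : (1 + x)⁻¹ ≤ 1 := inv_le_one_of_one_le₀ (by linarith)
    nlinarith
  have hE0 : 0 ≤ E x := by rw [hEeq]; positivity
  have h2 : (E x + B ^ 2) * Real.exp (-(A + 2)) ≤ ‖μ‖ ^ 2 + B ^ 2 :=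
    le_trans (mul_le_mul_of_nonneg_left h1 (by positivity)) hle
  have h3 : E x + B ^ 2 ≤ Real.exp (A + 2) * (‖μ‖ ^ 2 + B ^ 2) := by
    have := mul_le_mul_of_nonneg_left h2 (Real.exp_pos (A + 2)).le
    rw [Real.exp_neg] at this
    have h4 := (Real.exp_pos (A + 2)).ne'
    calc E x + B ^ 2 = Real.exp (A + 2) * ((E x + B ^ 2) * (Real.exp (A + 2))⁻¹) := by field_simp
      _ ≤ _ := this
  nlinarith [sq_nonneg B]


/-- A function with Lipschitz first differences on the punctured closed upper half plane. -/
lemma exists_differentiableOn_update {F : ℂ → ℂ} {C : ℝ}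
    (hL : ∀ k k' : ℂ, 0 ≤ k.im → k ≠ 0 → 0 ≤ k'.im → k' ≠ 0 → ‖F k - F k'‖ ≤ C * ‖k - k'‖)
    (hS : ∀ k₀ k k' : ℂ, 0 ≤ k₀.im → k₀ ≠ 0 → 0 ≤ k.im → k ≠ 0 → 0 ≤ k'.im → k' ≠ 0 →
      k ≠ k₀ → k' ≠ k₀ →
      ‖(F k - F k₀) / (k - k₀) - (F k' - F k₀) / (k' - k₀)‖ ≤ C * ‖k - k'‖) :
    ∃ c, DifferentiableOn ℂ (Function.update F 0 c) {z : ℂ | 0 ≤ z.im} := by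
  have gen : ∀ (G : ℂ → ℂ) (k₀ : ℂ) (S : Set ℂ), (nhdsWithin k₀ S).NeBot →
      (∀ k ∈ S, ∀ k' ∈ S, ‖G k - G k'‖ ≤ C * ‖k - k'‖) → ∃ c, Tendsto G (nhdsWithin k₀ S) (nhds c) := by
    intro G k₀ S hne hG
    apply cauchy_map_iff_exists_tendsto.1
    rw [Metric.cauchy_iff]
    refine ⟨hne.map _, fun ε hε => ?_⟩
    set δ := ε / (2 * (|C| + 1)) with hδ
    have hδ0 : 0 < δ := by positivity
    refine ⟨G '' (S ∩ Metric.ball k₀ δ), image_mem_map (inter_mem self_mem_nhdsWithin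
      (mem_nhdsWithin_of_mem_nhds (Metric.ball_mem_nhds _ hδ0))), ?_⟩
    rintro _ ⟨x, hx, rfl⟩ _ ⟨y, hy, rfl⟩
    rw [dist_eq_norm]
    have h1 : ‖x - y‖ < 2 * δ := by
      rw [← dist_eq_norm]
      calc dist x y ≤ dist x k₀ + dist y k₀ := dist_triangle_right _ _ _
        _ < δ + δ := add_lt_add hx.2 hy.2
        _ = _ := by ring
    calc ‖G x - G y‖ ≤ C * ‖x - y‖ := hG x hx.1 y hy.1
      _ ≤ (|C| + 1) * ‖x - y‖ := by gcongr; linarith [le_abs_self C]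
      _ < (|C| + 1) * (2 * δ) := by gcongr
      _ = ε := by rw [hδ]; field_simp
  have hne : ∀ k₀ : ℂ, 0 ≤ k₀.im → (nhdsWithin k₀ {z : ℂ | 0 ≤ z.im ∧ z ≠ 0 ∧ z ≠ k₀}).NeBot := by
    intro k₀ hk₀
    have ht : Tendsto (fun n : ℕ => k₀ + ((1 : ℂ) / ((n : ℂ) + 1)) * I) atTop
        (nhdsWithin k₀ {z : ℂ | 0 ≤ z.im ∧ z ≠ 0 ∧ z ≠ k₀}) := by
      refine tendsto_nhdsWithin_iff.2 ⟨?_, Eventually.of_forall fun n => ?_⟩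
      · have := (tendsto_one_div_add_atTop_nhds_zero_nat (𝕜 := ℂ)).mul_const I
        simpa using this.const_add k₀
      · have him : (k₀ + ((1 : ℂ) / ((n : ℂ) + 1)) * I).im = k₀.im + 1 / ((n : ℝ) + 1) := by
          have : ((1 : ℂ) / ((n : ℂ) + 1)) = ((1 / ((n : ℝ) + 1) : ℝ) : ℂ) := by push_cast; rfl
          rw [this, Complex.add_im, Complex.im_ofReal_mul, I_im, mul_one]
        have hp : 0 < 1 / ((n : ℝ) + 1) := by positivity
        refine ⟨by rw [him]; linarith, fun h => ?_, fun h => ?_⟩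
        · rw [h, Complex.zero_im] at him; linarith
        · rw [h] at him; linarith
    exact ht.neBot
  obtain ⟨c, hc⟩ := gen F 0 {z : ℂ | 0 ≤ z.im ∧ z ≠ 0 ∧ z ≠ 0} (hne 0 le_rfl)
    (fun k hk k' hk' => hL k k' hk.1 hk.2.1 hk'.1 hk'.2.1)
  refine ⟨c, ?_⟩
  set G := Function.update F 0 c with hG
  have hGF : ∀ k, k ≠ 0 → G k = F k := fun k hk => Function.update_of_ne hk _ _
  have hG0 : G 0 = c := Function.update_self _ _ _
  have hS' : ∀ k₀ k k' : ℂ, 0 ≤ k₀.im → 0 ≤ k.im → k ≠ 0 → 0 ≤ k'.im → k' ≠ 0 →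
      k ≠ k₀ → k' ≠ k₀ →
      ‖(G k - G k₀) / (k - k₀) - (G k' - G k₀) / (k' - k₀)‖ ≤ C * ‖k - k'‖ := by
    intro k₀ k k' h0 hk hk0 hk' hk'0 hkk hkk'
    by_cases h00 : k₀ = 0
    · subst h00
      rw [hG0, hGF k hk0, hGF k' hk'0]
      have := hne 0 le_rfl
      have hid : Tendsto (fun z : ℂ => z) (nhdsWithin 0 {z : ℂ | 0 ≤ z.im ∧ z ≠ 0 ∧ z ≠ 0}) (nhds 0) :=
        tendsto_nhdsWithin_of_tendsto_nhds tendsto_id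
      have ht : Tendsto (fun z : ℂ => ‖(F k - F z) / (k - z) - (F k' - F z) / (k' - z)‖)
          (nhdsWithin 0 {z : ℂ | 0 ≤ z.im ∧ z ≠ 0 ∧ z ≠ 0})
          (nhds ‖(F k - c) / (k - 0) - (F k' - c) / (k' - 0)‖) :=
        (((hc.const_sub _).div (hid.const_sub _) (by simpa)).sub
          ((hc.const_sub _).div (hid.const_sub _) (by simpa))).norm
      refine le_of_tendsto ht ?_
      have e1 : ∀ᶠ z in nhdsWithin 0 {z : ℂ | 0 ≤ z.im ∧ z ≠ 0 ∧ z ≠ 0}, z ≠ k :=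
        hid.eventually (isOpen_ne.mem_nhds hk0.symm)
      have e2 : ∀ᶠ z in nhdsWithin 0 {z : ℂ | 0 ≤ z.im ∧ z ≠ 0 ∧ z ≠ 0}, z ≠ k' :=
        hid.eventually (isOpen_ne.mem_nhds hk'0.symm)
      filter_upwards [e1, e2, self_mem_nhdsWithin] with z h1 h2 h3
      exact hS z k k' h3.1 h3.2.1 hk hk0 hk' hk'0 h1.symm h2.symm
    · rw [hGF k hk0, hGF k' hk'0, hGF k₀ h00]
      exact hS k₀ k k' h0 h00 hk hk0 hk' hk'0 hkk hkk'
  intro k₀ hk₀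
  obtain ⟨d, hd⟩ := gen (fun k => (G k - G k₀) / (k - k₀)) k₀ {z : ℂ | 0 ≤ z.im ∧ z ≠ 0 ∧ z ≠ k₀}
    (hne k₀ hk₀) (fun k hk k' hk' => hS' k₀ k k' hk₀ hk.1 hk.2.1 hk'.1 hk'.2.1 hk.2.2 hk'.2.2)
  have h1 : HasDerivWithinAt G d ({z : ℂ | 0 ≤ z.im} \ {0}) k₀ := by
    rw [hasDerivWithinAt_iff_tendsto_slope]
    have hset : ({z : ℂ | 0 ≤ z.im} \ {0}) \ {k₀} = {z : ℂ | 0 ≤ z.im ∧ z ≠ 0 ∧ z ≠ k₀} := by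
      ext z; simp [and_assoc]
    rw [hset]
    refine hd.congr fun k => ?_
    rw [slope_def_field]
  by_cases h00 : k₀ = 0
  · subst h00
    exact ((hasDerivWithinAt_sdiff_singleton).1 h1).differentiableWithinAt
  · refine (h1.mono_of_mem_nhdsWithin ?_).differentiableWithinAt
    exact inter_mem self_mem_nhdsWithin (mem_nhdsWithin_of_mem_nhds (isOpen_ne.mem_nhds h00))

/-- the Faddeev function -/
noncomputable def mJ (f : ℂ → ℝ → ℂ) (k : ℂ) (x : ℝ) : ℂ := Complex.exp (-I * k * x) * f k x
noncomputable def mJ' (f f' : ℂ → ℝ → ℂ) (k : ℂ) (x : ℝ) : ℂ :=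
  Complex.exp (-I * k * x) * (f' k x - I * k * f k x)

lemma hasDerivAt_cexp_lin (c : ℂ) (x : ℝ) :
    HasDerivAt (fun x : ℝ => Complex.exp (c * (x : ℂ))) (c * Complex.exp (c * x)) x := by
  have := ((hasDerivAt_id (x : ℂ)).const_mul c).cexp.comp_ofReal
  simpa [mul_comm] using this

lemma mJ_deriv {v : ℝ → ℝ} {f f' f'' : ℂ → ℝ → ℂ}
    (h1 : ∀ κ : ℂ, 0 ≤ κ.im → κ ≠ 0 → IsSchrodingerSolution v κ (f κ) (f' κ) (f'' κ))
    {k : ℂ} (hk : 0 ≤ k.im) (hk0 : k ≠ 0) (x : ℝ) :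
    HasDerivAt (mJ f k) (mJ' f f' k x) x := by
  have := (hasDerivAt_cexp_lin (-I * k) x).fun_mul ((h1 k hk hk0).1 x)
  refine this.congr_deriv ?_
  rw [mJ']; ring

lemma mJ'_deriv {v : ℝ → ℝ} {f f' f'' : ℂ → ℝ → ℂ}
    (h1 : ∀ κ : ℂ, 0 ≤ κ.im → κ ≠ 0 → IsSchrodingerSolution v κ (f κ) (f' κ) (f'' κ))
    {k : ℂ} (hk : 0 ≤ k.im) (hk0 : k ≠ 0) (x : ℝ) :
    HasDerivAt (mJ' f f' k) (-2 * I * k * mJ' f f' k x + v x * mJ f k x) x := by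
  have := (hasDerivAt_cexp_lin (-I * k) x).fun_mul
    (((h1 k hk hk0).2.1 x).fun_sub (((h1 k hk hk0).1 x).const_mul (I * k)))
  refine this.congr_deriv ?_
  have h2 := (h1 k hk hk0).2.2.2 x
  have h3 : f'' k x = v x * f k x - k ^ 2 * f k x := by linear_combination -h2
  rw [mJ', mJ, h3]
  linear_combination (-k ^ 2 * f k x * Complex.exp (-I * k * x)) * I_sq

lemma mJ_tendsto {f f' : ℂ → ℝ → ℂ}
    (hj1 : ∀ κ : ℂ, 0 ≤ κ.im → κ ≠ 0 → IsJostAtPlusInfinity κ (f κ) (f' κ))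
    {k : ℂ} (hk : 0 ≤ k.im) (hk0 : k ≠ 0) :
    Tendsto (mJ f k) atTop (nhds 1) := (hj1 k hk hk0).1

lemma mJ'_tendsto {f f' : ℂ → ℝ → ℂ}
    (hj1 : ∀ κ : ℂ, 0 ≤ κ.im → κ ≠ 0 → IsJostAtPlusInfinity κ (f κ) (f' κ))
    {k : ℂ} (hk : 0 ≤ k.im) (hk0 : k ≠ 0) :
    Tendsto (mJ' f f' k) atTop (nhds 0) := by
  have := (hj1 k hk hk0).2.sub ((hj1 k hk hk0).1.const_mul (I * k))
  have h2 : I * k - I * k * 1 = 0 := by ring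
  rw [h2] at this
  refine this.congr fun x => ?_
  rw [mJ']; ring

lemma norm_le_sqrt_of_sum {a b C : ℝ} (h : a ^ 2 + b ^ 2 ≤ C) : a ≤ √C ∧ b ≤ √C :=
  ⟨Real.le_sqrt_of_sq_le (by nlinarith [sq_nonneg b]), Real.le_sqrt_of_sq_le (by nlinarith [sq_nonneg a])⟩

lemma pow_mono_bound {v : ℝ → ℝ} {A : ℝ} (hv : ∀ x, 0 ≤ x → |v x| * (1 + x) ^ 8 ≤ A) {n : ℕ}
    (hn : n ≤ 8) : ∀ x, 0 ≤ x → |v x| * (1 + x) ^ n ≤ A := by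
  intro x hx
  refine le_trans ?_ (hv x hx)
  gcongr
  linarith

/-- Uniform bounds on the Jost solution on a half line. -/
lemma jost_half {v : ℝ → ℝ} {f f' f'' : ℂ → ℝ → ℂ}
    (h1 : ∀ κ : ℂ, 0 ≤ κ.im → κ ≠ 0 → IsSchrodingerSolution v κ (f κ) (f' κ) (f'' κ))
    (hj1 : ∀ κ : ℂ, 0 ≤ κ.im → κ ≠ 0 → IsJostAtPlusInfinity κ (f κ) (f' κ))
    {A : ℝ} (hv : ∀ x, 0 ≤ x → |v x| * (1 + x) ^ 8 ≤ A) :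
    ∃ C : ℝ, 0 ≤ C ∧
      (∀ k k' : ℂ, 0 ≤ k.im → k ≠ 0 → 0 ≤ k'.im → k' ≠ 0 → ∀ x, 0 ≤ x →
        ‖mJ f k x - mJ f k' x‖ ≤ C * ‖k - k'‖) ∧
      (∃ c, DifferentiableOn ℂ (Function.update (fun k => mJ f k 0) 0 c) {z : ℂ | 0 ≤ z.im}) ∧
      (∃ c, DifferentiableOn ℂ (Function.update (fun k => mJ' f f' k 0) 0 c) {z : ℂ | 0 ≤ z.im}) := by
  have hA : 0 ≤ A := le_trans (by positivity) (hv 0 le_rfl)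
  -- first bound
  obtain ⟨C1, hC10, hC1⟩ : ∃ C1 : ℝ, 0 ≤ C1 ∧ ∀ k : ℂ, 0 ≤ k.im → k ≠ 0 → ∀ x : ℝ, 0 ≤ x →
      (1 + x) ^ 6 * ‖mJ' f f' k x‖ ≤ C1 := by
    refine ⟨_, Real.sqrt_nonneg _, fun k hk hk0 x hx =>
      (norm_le_sqrt_of_sum (halfline_bound hk (n := 6) (by norm_num) (s := fun _ => 0) (B := 0)
      (mJ_deriv h1 hk hk0) (mJ'_deriv h1 hk hk0) (fun x => by simp) hv (by simp)
      (mJ_tendsto hj1 hk hk0) (mJ'_tendsto hj1 hk hk0) x hx)).2⟩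
  obtain ⟨C2, hC20, hC2⟩ : ∃ C2 : ℝ, 0 ≤ C2 ∧ ∀ k k' : ℂ, 0 ≤ k.im → k ≠ 0 → 0 ≤ k'.im → k' ≠ 0 →
      ∀ x : ℝ, 0 ≤ x → ‖mJ f k x - mJ f k' x‖ ≤ C2 * ‖k - k'‖ ∧
        (1 + x) ^ 4 * ‖mJ' f f' k x - mJ' f f' k' x‖ ≤ C2 * ‖k - k'‖ := by
    refine ⟨√(Real.exp (A + 2)) * (2 * C1), by positivity, fun k k' hk hk0 hk' hk'0 x hx => ?_⟩
    have := norm_le_sqrt_of_sum (halfline_bound hk' (n := 4) (by norm_num)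
      (s := fun x => -2 * I * (k - k') * mJ' f f' k x) (B := 2 * C1 * ‖k - k'‖)
      (fun x => (mJ_deriv h1 hk hk0 x).fun_sub (mJ_deriv h1 hk' hk'0 x))
      (fun x => (mJ'_deriv h1 hk hk0 x).fun_sub (mJ'_deriv h1 hk' hk'0 x))
      (fun x => by ring) (pow_mono_bound hv (by norm_num)) (fun x hx => ?_)
      ((mJ_tendsto hj1 hk hk0).sub (mJ_tendsto hj1 hk' hk'0))
      (by simpa using (mJ'_tendsto hj1 hk hk0).sub (mJ'_tendsto hj1 hk' hk'0)) x hx)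
    · have e : √(Real.exp (A + 2) * (‖(1:ℂ) - 1‖ ^ 2 + (2 * C1 * ‖k - k'‖) ^ 2)) =
        √(Real.exp (A + 2)) * (2 * C1) * ‖k - k'‖ := by
        rw [sub_self, norm_zero, zero_pow two_ne_zero, zero_add, Real.sqrt_mul (Real.exp_pos _).le,
          Real.sqrt_sq (by positivity)]
        ring
      rw [e] at this
      exact this
    · have h3 := hC1 k hk hk0 x hx
      have e : ‖-2 * I * (k - k') * mJ' f f' k x‖ = 2 * ‖k - k'‖ * ‖mJ' f f' k x‖ := by
        simp [norm_mul]
      rw [e]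
      calc 2 * ‖k - k'‖ * ‖mJ' f f' k x‖ * (1 + x) ^ (4 + 2)
          = 2 * ‖k - k'‖ * ((1 + x) ^ 6 * ‖mJ' f f' k x‖) := by ring
        _ ≤ 2 * ‖k - k'‖ * C1 := by gcongr
        _ = _ := by ring
  obtain ⟨C3, hC30, hC3⟩ : ∃ C3 : ℝ, 0 ≤ C3 ∧ ∀ k₀ k k' : ℂ, 0 ≤ k₀.im → k₀ ≠ 0 → 0 ≤ k.im → k ≠ 0 →
      0 ≤ k'.im → k' ≠ 0 → k ≠ k₀ → k' ≠ k₀ →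
      ‖(mJ f k 0 - mJ f k₀ 0) / (k - k₀) - (mJ f k' 0 - mJ f k₀ 0) / (k' - k₀)‖ ≤ C3 * ‖k - k'‖ ∧
      ‖(mJ' f f' k 0 - mJ' f f' k₀ 0) / (k - k₀) - (mJ' f f' k' 0 - mJ' f f' k₀ 0) / (k' - k₀)‖
        ≤ C3 * ‖k - k'‖ := by
    refine ⟨√(Real.exp (A + 2)) * (2 * C2), by positivity,
      fun k₀ k k' hz hz0 hk hk0 hk' hk'0 hkk hkk' => ?_⟩
    have hs1 : k - k₀ ≠ 0 := sub_ne_zero.2 hkk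
    have hs2 : k' - k₀ ≠ 0 := sub_ne_zero.2 hkk'
    have := norm_le_sqrt_of_sum (halfline_bound hz (n := 2) (by norm_num)
      (s := fun x => -2 * I * (mJ' f f' k x - mJ' f f' k' x)) (B := 2 * C2 * ‖k - k'‖)
      (fun x => (((mJ_deriv h1 hk hk0 x).fun_sub (mJ_deriv h1 hz hz0 x)).div_const (k - k₀)).fun_sub
        (((mJ_deriv h1 hk' hk'0 x).fun_sub (mJ_deriv h1 hz hz0 x)).div_const (k' - k₀)))
      (fun x => (((mJ'_deriv h1 hk hk0 x).fun_sub (mJ'_deriv h1 hz hz0 x)).div_const (k - k₀)).fun_sub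
        (((mJ'_deriv h1 hk' hk'0 x).fun_sub (mJ'_deriv h1 hz hz0 x)).div_const (k' - k₀)))
      (fun x => ?_) (pow_mono_bound hv (by norm_num)) (fun x hx => ?_)
      ((((mJ_tendsto hj1 hk hk0).sub (mJ_tendsto hj1 hz hz0)).div_const (k - k₀)).sub
        (((mJ_tendsto hj1 hk' hk'0).sub (mJ_tendsto hj1 hz hz0)).div_const (k' - k₀)))
      (by simpa using ((((mJ'_tendsto hj1 hk hk0).sub (mJ'_tendsto hj1 hz hz0)).div_const (k - k₀)).sub
        (((mJ'_tendsto hj1 hk' hk'0).sub (mJ'_tendsto hj1 hz hz0)).div_const (k' - k₀)))) 0 le_rfl)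
    · have e : √(Real.exp (A + 2) * (‖((1:ℂ) - 1) / (k - k₀) - (1 - 1) / (k' - k₀)‖ ^ 2 +
        (2 * C2 * ‖k - k'‖) ^ 2)) = √(Real.exp (A + 2)) * (2 * C2) * ‖k - k'‖ := by
        rw [sub_self, zero_div, zero_div, sub_self, norm_zero, zero_pow two_ne_zero, zero_add,
          Real.sqrt_mul (Real.exp_pos _).le, Real.sqrt_sq (by positivity)]
        ring
      rw [e] at this
      simpa using this
    · field_simp
      ring
    · have h3 := (hC2 k k' hk hk0 hk' hk'0 x hx).2
      have e : ‖-2 * I * (mJ' f f' k x - mJ' f f' k' x)‖ = 2 * ‖mJ' f f' k x - mJ' f f' k' x‖ := by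
        simp [norm_mul]
      rw [e]
      calc 2 * ‖mJ' f f' k x - mJ' f f' k' x‖ * (1 + x) ^ (2 + 2)
          = 2 * ((1 + x) ^ 4 * ‖mJ' f f' k x - mJ' f f' k' x‖) := by ring
        _ ≤ 2 * C2 * ‖k - k'‖ := by linarith
  refine ⟨C2, hC20, fun k k' a b c d x hx => (hC2 k k' a b c d x hx).1, ?_, ?_⟩
  · refine exists_differentiableOn_update (C := max C2 C3) (fun k k' a b c d => ?_)
      (fun k₀ k k' a b c d e f g h => ?_)
    · refine (hC2 k k' a b c d 0 le_rfl).1.trans ?_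
      gcongr; exact le_max_left _ _
    · refine (hC3 k₀ k k' a b c d e f g h).1.trans ?_
      gcongr; exact le_max_right _ _
  · refine exists_differentiableOn_update (C := max C2 C3) (fun k k' a b c d => ?_)
      (fun k₀ k k' a b c d e f g h => ?_)
    · have := (hC2 k k' a b c d 0 le_rfl).2
      simp only [add_zero, one_pow, one_mul] at this
      refine this.trans ?_
      gcongr; exact le_max_left _ _
    · refine (hC3 k₀ k k' a b c d e f g h).2.trans ?_
      gcongr; exact le_max_right _ _


lemma schwartz_decay_zf (v : SchwartzMap ℝ ℝ) (n : ℕ) : ∃ A : ℝ, 0 ≤ A ∧ ∀ x, |v x| * (1 + |x|) ^ n ≤ A := by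
  have := SchwartzMap.one_add_le_sup_seminorm_apply (𝕜 := ℝ) (m := (n, 0)) (k := n) (n := 0) le_rfl le_rfl v
  simp only [norm_iteratedFDeriv_zero, Real.norm_eq_abs] at this
  exact ⟨_, le_trans (by positivity) (this 0), fun x => by rw [mul_comm]; exact this x⟩

lemma refl_sol {v : ℝ → ℝ} {k : ℂ} {f f' f'' : ℝ → ℂ} (h : IsSchrodingerSolution v k f f' f'') :
    IsSchrodingerSolution (fun x => v (-x)) k (fun x => f (-x)) (fun x => -f' (-x)) (fun x => f'' (-x)) := by
  obtain ⟨a, b, c, d⟩ := h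
  refine ⟨fun x => ?_, fun x => ?_, c.comp continuous_neg, fun x => d (-x)⟩
  · have := (a (-x)).scomp x (hasDerivAt_neg x)
    simpa [Function.comp_def] using this
  · have := ((b (-x)).scomp x (hasDerivAt_neg x)).fun_neg
    simpa [Function.comp_def] using this

lemma refl_jost {k : ℂ} {f f' : ℝ → ℂ} (h : IsJostAtMinusInfinity k f f') :
    IsJostAtPlusInfinity k (fun x => f (-x)) (fun x => -f' (-x)) := by
  obtain ⟨a, b⟩ := h
  refine ⟨?_, ?_⟩
  · have := a.comp tendsto_neg_atTop_atBot
    refine this.congr fun x => ?_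
    simp
  · have := (b.comp tendsto_neg_atTop_atBot).neg
    simp only [neg_mul, neg_neg] at this
    refine this.congr fun x => ?_
    simp

/-- Regularity of the Wronskian on the closed half plane. -/
lemma exists_wronskian (v : SchwartzMap ℝ ℝ)
    (f₁ f₁' f₁'' f₂ f₂' f₂'' : ℂ → ℝ → ℂ)
    (h1 : ∀ κ : ℂ, 0 ≤ κ.im → κ ≠ 0 → IsSchrodingerSolution (⇑v) κ (f₁ κ) (f₁' κ) (f₁'' κ))
    (hj1 : ∀ κ : ℂ, 0 ≤ κ.im → κ ≠ 0 → IsJostAtPlusInfinity κ (f₁ κ) (f₁' κ))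
    (h2 : ∀ κ : ℂ, 0 ≤ κ.im → κ ≠ 0 → IsSchrodingerSolution (⇑v) κ (f₂ κ) (f₂' κ) (f₂'' κ))
    (hj2 : ∀ κ : ℂ, 0 ≤ κ.im → κ ≠ 0 → IsJostAtMinusInfinity κ (f₂ κ) (f₂' κ)) :
    ∃ W : ℂ → ℂ, DifferentiableOn ℂ W {z : ℂ | 0 ≤ z.im} ∧
      ∀ k : ℂ, 0 ≤ k.im → k ≠ 0 → W k = f₁' k 0 * f₂ k 0 - f₁ k 0 * f₂' k 0 := by
  obtain ⟨A, hA, hv⟩ := schwartz_decay_zf v 8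
  obtain ⟨_, _, _, ⟨c1, hc1⟩, ⟨c2, hc2⟩⟩ := jost_half h1 hj1 (A := A)
    (fun x hx => by simpa [abs_of_nonneg hx] using hv x)
  obtain ⟨_, _, _, ⟨c3, hc3⟩, ⟨c4, hc4⟩⟩ := jost_half (v := fun x => v (-x))
    (f := fun k x => f₂ k (-x)) (f' := fun k x => -f₂' k (-x)) (f'' := fun k x => f₂'' k (-x))
    (fun k hk hk0 => refl_sol (h2 k hk hk0)) (fun k hk hk0 => refl_jost (hj2 k hk hk0)) (A := A)
    (fun x hx => by simpa [abs_of_nonneg hx] using hv (-x))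
  refine ⟨fun k => (Function.update (fun k => mJ' f₁ f₁' k 0) 0 c2 k +
      I * k * Function.update (fun k => mJ f₁ k 0) 0 c1 k) *
      Function.update (fun k => mJ (fun k x => f₂ k (-x)) k 0) 0 c3 k +
      Function.update (fun k => mJ f₁ k 0) 0 c1 k *
      (Function.update (fun k => mJ' (fun k x => f₂ k (-x)) (fun k x => -f₂' k (-x)) k 0) 0 c4 k +
      I * k * Function.update (fun k => mJ (fun k x => f₂ k (-x)) k 0) 0 c3 k), ?_, fun k hk hk0 => ?_⟩
  · have hid : DifferentiableOn ℂ (fun k : ℂ => I * k) {z : ℂ | 0 ≤ z.im} := by fun_prop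
    exact ((hc2.add (hid.mul hc1)).mul hc3).add (hc1.mul (hc4.add (hid.mul hc3)))
  · simp only [Function.update_of_ne hk0, mJ, mJ']
    simp
    ring


lemma wronskian_const {v : ℝ → ℝ} {k : ℂ} {g g' g'' h h' h'' : ℝ → ℂ}
    (hg : IsSchrodingerSolution v k g g' g'') (hh : IsSchrodingerSolution v k h h' h'') (x : ℝ) :
    g' x * h x - g x * h' x = g' 0 * h 0 - g 0 * h' 0 := by
  have hd : ∀ y, HasDerivAt (fun y => g' y * h y - g y * h' y) 0 y := by
    intro y
    have := ((hg.2.1 y).fun_mul (hh.1 y)).fun_sub ((hg.1 y).fun_mul (hh.2.1 y))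
    refine this.congr_deriv ?_
    linear_combination (-h y) * hg.2.2.2 y + g y * hh.2.2.2 y
  exact is_const_of_deriv_eq_zero (fun y => (hd y).differentiableAt) (fun y => (hd y).deriv) x 0

lemma hasDerivAt_conj_zf {f : ℝ → ℂ} {f' : ℂ} {x : ℝ} (h : HasDerivAt f f' x) :
    HasDerivAt (fun y => (starRingEnd ℂ) (f y)) ((starRingEnd ℂ) f') x := by
  simpa using h.star

lemma conj_sol {v : ℝ → ℝ} {k : ℝ} {f f' f'' : ℝ → ℂ} (h : IsSchrodingerSolution v k f f' f'') :
    IsSchrodingerSolution v k (fun x => (starRingEnd ℂ) (f x)) (fun x => (starRingEnd ℂ) (f' x))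
      (fun x => (starRingEnd ℂ) (f'' x)) := by
  refine ⟨fun x => hasDerivAt_conj_zf (h.1 x), fun x => hasDerivAt_conj_zf (h.2.1 x),
    Complex.continuous_conj.comp h.2.2.1, fun x => ?_⟩
  have := congrArg (starRingEnd ℂ) (h.2.2.2 x)
  simpa using this

lemma wronskian_self {v : ℝ → ℝ} {k : ℝ} {f f' f'' : ℝ → ℂ} (h : IsSchrodingerSolution v k f f' f'')
    (hj : IsJostAtPlusInfinity k f f') :
    f' 0 * (starRingEnd ℂ) (f 0) - f 0 * (starRingEnd ℂ) (f' 0) = 2 * I * k := by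
  have hc := wronskian_const h (conj_sol h)
  have hlim := (hj.2.mul ((Complex.continuous_conj.tendsto _).comp hj.1)).sub
    (hj.1.mul ((Complex.continuous_conj.tendsto _).comp hj.2))
  have h2 : Tendsto (fun _ : ℝ => f' 0 * (starRingEnd ℂ) (f 0) - f 0 * (starRingEnd ℂ) (f' 0)) atTop
      (nhds (I * k * (starRingEnd ℂ) 1 - 1 * (starRingEnd ℂ) (I * k))) := by
    refine hlim.congr fun x => ?_
    rw [← hc x]
    have he : Complex.exp (-I * k * x) * (starRingEnd ℂ) (Complex.exp (-I * k * x)) = 1 := by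
      rw [← Complex.exp_conj, ← Complex.exp_add]
      simp
    simp only [Function.comp_apply, map_mul]
    linear_combination (f' x * (starRingEnd ℂ) (f x) - f x * (starRingEnd ℂ) (f' x)) * he
  have := tendsto_nhds_unique h2 tendsto_const_nhds
  rw [← this]
  simp
  ring

/-- `|W|² = 4k² + |W_b|²` -/
lemma plucker_real {v : ℝ → ℝ} {k : ℝ} {f f' f'' g g' g'' : ℝ → ℂ}
    (h1 : IsSchrodingerSolution v k f f' f'')
    (hj1 : IsJostAtPlusInfinity k f f') (h2 : IsSchrodingerSolution v k g g' g'')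
    (hj2 : IsJostAtMinusInfinity k g g') :
    ‖f' 0 * g 0 - f 0 * g' 0‖ ^ 2 = 4 * k ^ 2 +
      ‖f' 0 * (starRingEnd ℂ) (g 0) - f 0 * (starRingEnd ℂ) (g' 0)‖ ^ 2 := by
  have e1 := wronskian_self h1 hj1
  have e2 := wronskian_self (refl_sol h2) (refl_jost hj2)
  simp only [neg_zero, map_neg] at e2
  apply Complex.ofReal_injective
  push_cast
  rw [← Complex.mul_conj', ← Complex.mul_conj']
  simp only [map_sub, map_mul, Complex.conj_conj]
  linear_combination (-(2 * I * k)) * e2 - (g' 0 * (starRingEnd ℂ) (g 0) - g 0 * (starRingEnd ℂ) (g' 0)) * (-1) * e1 - 4 * k^2 * I_sq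


lemma wholeline_bound {k : ℂ} (hk : 0 ≤ k.im) (hk1 : 1 ≤ ‖k‖) {m m' m'' : ℝ → ℂ} {w : ℝ → ℝ} {A : ℝ}
    (hm : ∀ x, HasDerivAt m (m' x) x) (hm' : ∀ x, HasDerivAt m' (m'' x) x)
    (heq : ∀ x, m'' x = -2 * I * k * m' x + w x * m x)
    (hw : ∀ x, |w x| * (1 + |x|) ^ 2 ≤ A)
    (hμ : Tendsto m atTop (nhds 1)) (h0 : Tendsto m' atTop (nhds 0)) (x : ℝ) :
    ‖m x‖ ^ 2 ≤ 2 * Real.exp (2 * A * π) ∧ ‖m' x‖ ^ 2 ≤ 4 * ‖k‖ ^ 2 * Real.exp (2 * A * π) := by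
  have hA : 0 ≤ A := le_trans (by positivity) (hw 0)
  have hk0 : k ≠ 0 := by rintro rfl; simp at hk1; linarith
  have hI : (2 * I * k) ≠ 0 := by simp [hk0]
  set D : ℝ → ℂ := fun x => m' x / (2 * I * k) with hD
  set P : ℝ → ℂ := fun x => m x + D x with hP
  set E : ℝ → ℝ := fun x => normSq (P x) + normSq (D x) with hE
  have hw2 : ∀ x, |w x| ≤ A * (1 / (1 + x ^ 2)) := by
    intro x
    have h1 : 1 + x ^ 2 ≤ (1 + |x|) ^ 2 := by nlinarith [abs_nonneg x, sq_abs x]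
    have h2 : 0 < 1 + x ^ 2 := by positivity
    rw [mul_one_div, le_div_iff₀ h2]
    exact le_trans (by gcongr) (hw x)
  have hDd : ∀ x, HasDerivAt D (-2 * I * k * D x + w x * m x / (2 * I * k)) x := by
    intro x
    refine ((hm' x).div_const _).congr_deriv ?_
    rw [heq]; simp only [hD]; ring
  have hPd : ∀ x, HasDerivAt P (w x * m x / (2 * I * k)) x := by
    intro x
    refine ((hm x).fun_add (hDd x)).congr_deriv ?_
    simp only [hD]; field_simp; ring
  have hEd : ∀ x, HasDerivAt E (2 * ((starRingEnd ℂ) (P x) * (w x * m x / (2 * I * k))).re +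
      2 * ((starRingEnd ℂ) (D x) * (-2 * I * k * D x + w x * m x / (2 * I * k))).re) x := fun x =>
    (hasDerivAt_normSq_zf (hPd x)).fun_add (hasDerivAt_normSq_zf (hDd x))
  have hE0 : ∀ x, 0 ≤ E x := fun x => add_nonneg (normSq_nonneg _) (normSq_nonneg _)
  have hPE : ∀ x, ‖P x‖ ^ 2 + ‖D x‖ ^ 2 = E x := fun x => by
    simp only [hE, Complex.normSq_eq_norm_sq]
  have hmn : ∀ x, ‖m x‖ ≤ ‖P x‖ + ‖D x‖ := by
    intro x
    have : m x = P x - D x := by simp [hP]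
    rw [this]; exact norm_sub_le _ _
  have hEd2 : ∀ x, -(2 * A * (1 / (1 + x ^ 2))) * E x ≤
      2 * ((starRingEnd ℂ) (P x) * (w x * m x / (2 * I * k))).re +
      2 * ((starRingEnd ℂ) (D x) * (-2 * I * k * D x + w x * m x / (2 * I * k))).re := by
    intro x
    have hq : ‖(w x : ℂ) * m x / (2 * I * k)‖ ≤ |w x| * (‖P x‖ + ‖D x‖) / 2 := by
      rw [norm_div, norm_mul, norm_mul, norm_mul]
      simp only [Complex.norm_real, Real.norm_eq_abs, Complex.norm_I, mul_one, Complex.norm_ofNat]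
      have := hmn x
      gcongr
      linarith
    set q := (w x : ℂ) * m x / (2 * I * k) with hqd
    have h3 : -(‖P x‖ * ‖q‖) ≤ ((starRingEnd ℂ) (P x) * q).re := by
      have := Complex.abs_re_le_norm ((starRingEnd ℂ) (P x) * q)
      rw [norm_mul, RCLike.norm_conj] at this
      exact (abs_le.1 this).1
    have h4 : -(‖D x‖ * ‖q‖) ≤ ((starRingEnd ℂ) (D x) * q).re := by
      have := Complex.abs_re_le_norm ((starRingEnd ℂ) (D x) * q)
      rw [norm_mul, RCLike.norm_conj] at this
      exact (abs_le.1 this).1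
    have h5 : 0 ≤ ((starRingEnd ℂ) (D x) * (-2 * I * k * D x)).re := by
      have : (starRingEnd ℂ) (D x) * (-2 * I * k * D x) = ((normSq (D x) : ℝ) : ℂ) * (-2 * I * k) := by
        rw [← Complex.mul_conj]; ring
      rw [this, Complex.re_ofReal_mul]
      apply mul_nonneg (normSq_nonneg _)
      simp; linarith
    rw [mul_add ((starRingEnd ℂ) (D x)), Complex.add_re]
    have h6 : (‖P x‖ + ‖D x‖) * ‖q‖ ≤ |w x| * E x := by
      calc (‖P x‖ + ‖D x‖) * ‖q‖ ≤ (‖P x‖ + ‖D x‖) * (|w x| * (‖P x‖ + ‖D x‖) / 2) := by gcongr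
        _ = |w x| * ((‖P x‖ + ‖D x‖) ^ 2 / 2) := by ring
        _ ≤ |w x| * E x := by
          gcongr
          rw [← hPE]; nlinarith [sq_nonneg (‖P x‖ - ‖D x‖)]
    have h7 : |w x| * E x ≤ A * (1 / (1 + x ^ 2)) * E x :=
      mul_le_mul_of_nonneg_right (hw2 x) (hE0 x)
    nlinarith
  have hmono : Monotone (fun x => E x * Real.exp (2 * A * Real.arctan x)) := by
    have hd : ∀ x, HasDerivAt (fun x => E x * Real.exp (2 * A * Real.arctan x)) _ x := fun x =>
      (hEd x).fun_mul (((Real.hasDerivAt_arctan x).const_mul (2 * A)).exp)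
    refine monotone_of_hasDerivAt_nonneg hd (fun x => ?_)
    simp only [Pi.zero_apply]
    have := hEd2 x
    have h8 := Real.exp_pos (2 * A * Real.arctan x)
    nlinarith
  have hlim : Tendsto (fun x => E x * Real.exp (2 * A * Real.arctan x)) atTop
      (nhds (1 * Real.exp (2 * A * (π / 2)))) := by
    have hDl : Tendsto D atTop (nhds 0) := by simpa using h0.div_const (2 * I * k)
    have hPl : Tendsto P atTop (nhds 1) := by simpa using hμ.add hDl
    have hEl : Tendsto E atTop (nhds 1) := by
      have := ((Complex.continuous_normSq.tendsto _).comp hPl).add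
        ((Complex.continuous_normSq.tendsto _).comp hDl)
      simpa using this
    refine hEl.mul ((Real.continuous_exp.tendsto _).comp ?_)
    exact ((tendsto_nhds_of_tendsto_nhdsWithin Real.tendsto_arctan_atTop).const_mul (2 * A))
  have hfin : E x ≤ Real.exp (2 * A * π) := by
    have h1 := hmono.ge_of_tendsto hlim x
    have h2 := Real.neg_pi_div_two_lt_arctan x
    have h3 : Real.exp (2 * A * π) = Real.exp (2 * A * (π / 2)) / Real.exp (-(2 * A * (π / 2))) := by
      rw [← Real.exp_sub]; congr 1; ring
    rw [h3, le_div_iff₀ (Real.exp_pos _)]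
    rw [one_mul] at h1
    refine le_trans ?_ h1
    apply mul_le_mul_of_nonneg_left _ (hE0 x)
    apply Real.exp_le_exp.2
    nlinarith
  have hx := hPE x
  constructor
  · have := hmn x
    calc ‖m x‖ ^ 2 ≤ (‖P x‖ + ‖D x‖) ^ 2 := by gcongr
      _ ≤ 2 * E x := by rw [← hx]; nlinarith [sq_nonneg (‖P x‖ - ‖D x‖)]
      _ ≤ _ := by gcongr
  · have : m' x = 2 * I * k * D x := by simp only [hD]; field_simp
    rw [this]
    have e : ‖2 * I * k * D x‖ ^ 2 = 4 * ‖k‖ ^ 2 * ‖D x‖ ^ 2 := by simp; ring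
    rw [e]
    gcongr
    nlinarith [sq_nonneg ‖P x‖]

/-- Uniform bound on the second Jost solution. -/
lemma jost2_bound (v : SchwartzMap ℝ ℝ) : ∃ C : ℝ, 0 ≤ C ∧ ∀ (k : ℂ) (g g' g'' : ℝ → ℂ), 0 ≤ k.im → 1 ≤ ‖k‖ →
    IsSchrodingerSolution v k g g' g'' → IsJostAtMinusInfinity k g g' → ∀ x : ℝ,
    ‖Complex.exp (I * k * x) * g x‖ ≤ C ∧ ‖Complex.exp (I * k * x) * g' x‖ ≤ C * (3 * ‖k‖) := by
  obtain ⟨A, hA, hv⟩ := schwartz_decay_zf v 2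
  refine ⟨√(2 * Real.exp (2 * A * π)), Real.sqrt_nonneg _, fun k g g' g'' hk hk1 hs hj x => ?_⟩
  have hk0 : k ≠ 0 := by rintro rfl; simp at hk1; linarith
  have hs' : ∀ κ : ℂ, 0 ≤ κ.im → κ ≠ 0 → True := fun _ _ _ => trivial
  have hs2 := refl_sol hs
  have hj2 := refl_jost hj
  set G : ℝ → ℂ := fun x => g (-x)
  set G' : ℝ → ℂ := fun x => -g' (-x)
  set G'' : ℝ → ℂ := fun x => g'' (-x)
  have hb := wholeline_bound (w := fun x => v (-x)) hk hk1
    (m := fun x : ℝ => Complex.exp (-I * k * x) * G x)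
    (m' := fun x : ℝ => Complex.exp (-I * k * x) * (G' x - I * k * G x))
    (m'' := fun x : ℝ => -2 * I * k * (Complex.exp (-I * k * x) * (G' x - I * k * G x)) +
      v (-x) * (Complex.exp (-I * k * x) * G x)) (A := A)
    (fun x => by
      have := (hasDerivAt_cexp_lin (-I * k) x).fun_mul (hs2.1 x)
      refine this.congr_deriv ?_
      ring)
    (fun x => by
      have := (hasDerivAt_cexp_lin (-I * k) x).fun_mul ((hs2.2.1 x).fun_sub ((hs2.1 x).const_mul (I * k)))
      refine this.congr_deriv ?_
      have h2 := hs2.2.2.2 x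
      have h3 : G'' x = v (-x) * G x - k ^ 2 * G x := by linear_combination -h2
      rw [h3]
      linear_combination (-k ^ 2 * G x * Complex.exp (-I * k * x)) * I_sq)
    (fun x => rfl) (fun x => by simpa using hv (-x)) hj2.1
    (by
      have := hj2.2.sub (hj2.1.const_mul (I * k))
      have h2 : I * k - I * k * 1 = 0 := by ring
      rw [h2] at this
      refine this.congr fun x => ?_
      ring) (-x)
  set m := Complex.exp (-I * k * (-x : ℝ)) * G (-x) with hm
  set m' := Complex.exp (-I * k * (-x : ℝ)) * (G' (-x) - I * k * G (-x)) with hm'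
  have e1 : Complex.exp (I * k * x) * g x = m := by simp [hm, G]
  have e2 : Complex.exp (I * k * x) * g' x = -m' - I * k * m := by simp [hm, hm', G, G']; ring
  have b1 : ‖m‖ ≤ √(2 * Real.exp (2 * A * π)) := Real.le_sqrt_of_sq_le hb.1
  have b2 : ‖m'‖ ≤ 2 * ‖k‖ * √(2 * Real.exp (2 * A * π)) := by
    refine abs_le_of_sq_le_sq' ?_ (by positivity) |>.2
    rw [mul_pow, Real.sq_sqrt (by positivity)]
    have := Real.exp_pos (2 * A * π)
    nlinarith [hb.2, sq_nonneg ‖k‖, mul_nonneg (sq_nonneg ‖k‖) this.le]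
  refine ⟨by rw [e1]; exact b1, ?_⟩
  rw [e2]
  calc ‖-m' - I * k * m‖ ≤ ‖-m'‖ + ‖I * k * m‖ := norm_sub_le _ _
    _ = ‖m'‖ + ‖k‖ * ‖m‖ := by simp
    _ ≤ 2 * ‖k‖ * √(2 * Real.exp (2 * A * π)) + ‖k‖ * √(2 * Real.exp (2 * A * π)) := by gcongr
    _ = _ := by ring


lemma sigmaZF_succ_succ (v : ℝ → ℝ) (m : ℕ) (x : ℝ) : sigmaZF v (m + 2) x = -deriv (sigmaZF v (m + 1)) x -
    ∑ j ∈ Finset.Icc 1 (m + 1), sigmaZF v (m + 1 - j) x * sigmaZF v j x := by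
  rw [sigmaZF]
  refine congrArg (fun z => -deriv (sigmaZF v (m + 1)) x - z) ?_
  exact Finset.sum_attach (Finset.Icc 1 (m + 1)) (fun j => sigmaZF v (m + 1 - j) x * sigmaZF v j x)

lemma sigmaZF_zero (v : ℝ → ℝ) : sigmaZF v 0 = fun _ => 0 := by rw [sigmaZF]
lemma sigmaZF_one (v : ℝ → ℝ) : sigmaZF v 1 = v := by rw [sigmaZF]

lemma sigmaZF_schwartz (v : SchwartzMap ℝ ℝ) (l : ℕ) : ∃ s : SchwartzMap ℝ ℝ, sigmaZF v l = s := by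
  induction l using Nat.strong_induction_on with
  | _ l ih =>
    match l, ih with
    | 0, _ => exact ⟨0, by rw [sigmaZF_zero]; rfl⟩
    | 1, _ => exact ⟨v, by rw [sigmaZF_one]⟩
    | (m + 2), ih =>
      have : ∀ n, ∃ s : SchwartzMap ℝ ℝ, n < m + 2 → sigmaZF v n = s := by
        intro n
        by_cases hn : n < m + 2
        · obtain ⟨s, hs⟩ := ih n hn; exact ⟨s, fun _ => hs⟩
        · exact ⟨0, fun h => absurd h hn⟩
      choose S hS using this
      refine ⟨-SchwartzMap.derivCLM ℝ ℝ (S (m + 1)) -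
        ∑ j ∈ Finset.Icc 1 (m + 1), SchwartzMap.pairing (ContinuousLinearMap.mul ℝ ℝ) (S (m + 1 - j)) (S j), ?_⟩
      ext x
      rw [sigmaZF_succ_succ]
      simp only [sub_apply, neg_apply, SchwartzMap.derivCLM_apply,
        sum_apply, SchwartzMap.pairing_apply_apply, ContinuousLinearMap.mul_apply']
      rw [hS (m + 1) (by omega)]
      congr 1
      refine Finset.sum_congr rfl fun j hj => ?_
      rw [Finset.mem_Icc] at hj
      rw [hS (m + 1 - j) (by omega), hS j (by omega)]

lemma schwartz_primitive (s : SchwartzMap ℝ ℝ) : ∃ Θ : ℝ → ℝ, (∀ x, HasDerivAt Θ (s x) x) ∧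
    Tendsto Θ atBot (nhds 0) ∧ Tendsto Θ atTop (nhds (∫ x, s x)) ∧
    ∀ x, |Θ x - ∫ x, s x| ≤ 2 * ∫ x, ‖s x‖ := by
  have hi : Integrable s := s.integrable
  refine ⟨fun x => (∫ y in Iic (0 : ℝ), s y) + ∫ y in (0 : ℝ)..x, s y, fun x => ?_, ?_, ?_, fun x => ?_⟩
  · exact (intervalIntegral.integral_hasDerivAt_right hi.intervalIntegrable
      (s.continuous.stronglyMeasurableAtFilter _ _) s.continuous.continuousAt).const_add _
  · have := (intervalIntegral_tendsto_integral_Iic (0 : ℝ) hi.integrableOn tendsto_id).neg.const_add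
      (∫ y in Iic (0 : ℝ), s y)
    rw [add_neg_cancel] at this
    refine this.congr fun x => ?_
    rw [intervalIntegral.integral_symm x 0]; simp
  · have := (intervalIntegral_tendsto_integral_Ioi (0 : ℝ) hi.integrableOn tendsto_id).const_add
      (∫ y in Iic (0 : ℝ), s y)
    rwa [intervalIntegral.integral_Iic_add_Ioi hi.integrableOn hi.integrableOn] at this
  · have e : (∫ y in Iic (0 : ℝ), s y) + ∫ y in (0 : ℝ)..x, s y = ∫ y in Iic x, s y := by
      rw [← intervalIntegral.integral_Iic_sub_Iic hi.integrableOn hi.integrableOn]; ring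
    simp only [e]
    have h1 : |∫ y in Iic x, s y| ≤ ∫ y, ‖s y‖ :=
      (norm_integral_le_integral_norm _).trans (setIntegral_le_integral hi.norm
        (Eventually.of_forall fun _ => norm_nonneg _))
    have h2 : |∫ y, s y| ≤ ∫ y, ‖s y‖ := norm_integral_le_integral_norm (μ := volume) (fun y => s y)
    calc _ ≤ |∫ y in Iic x, s y| + |∫ y, s y| := abs_sub _ _
      _ ≤ _ := by linarith

lemma riccati_alg {M : ℕ} (hM : 1 ≤ M) {τ : ℂ} (hτ : τ ≠ 0) {s d : ℕ → ℂ} (hs0 : s 0 = 0) (hd0 : d 0 = 0)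
    (hrec : ∀ n, 1 ≤ n → s (n + 1) + d n + ∑ p ∈ Finset.HasAntidiagonal.antidiagonal n, s p.1 * s p.2 = 0) :
    (∑ n ∈ Finset.range (M + 1), d n * τ ^ n) + (∑ n ∈ Finset.range (M + 1), s n * τ ^ n) ^ 2 +
      τ⁻¹ * (∑ n ∈ Finset.range (M + 1), s n * τ ^ n) = s 1 + (d M * τ ^ M +
      ∑ p ∈ (Finset.range (M + 1) ×ˢ Finset.range (M + 1)).filter (fun p => M ≤ p.1 + p.2),
        s p.1 * s p.2 * τ ^ (p.1 + p.2)) := by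
  have h1 : (∑ n ∈ Finset.range (M + 1), s n * τ ^ n) ^ 2 =
      ∑ p ∈ (Finset.range (M + 1) ×ˢ Finset.range (M + 1)), s p.1 * s p.2 * τ ^ (p.1 + p.2) := by
    rw [sq, Finset.sum_mul_sum, Finset.sum_product]
    refine Finset.sum_congr rfl fun i _ => Finset.sum_congr rfl fun j _ => ?_
    rw [pow_add]; ring
  rw [← Finset.sum_filter_add_sum_filter_not _ (fun p : ℕ × ℕ => M ≤ p.1 + p.2)] at h1
  have h2 : ∑ p ∈ (Finset.range (M + 1) ×ˢ Finset.range (M + 1)).filter (fun p => ¬ M ≤ p.1 + p.2),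
        s p.1 * s p.2 * τ ^ (p.1 + p.2) =
      ∑ n ∈ Finset.range M, (∑ p ∈ Finset.HasAntidiagonal.antidiagonal n, s p.1 * s p.2) * τ ^ n := by
    rw [← Finset.sum_fiberwise_of_maps_to (t := Finset.range M) (g := fun p : ℕ × ℕ => p.1 + p.2)]
    · refine Finset.sum_congr rfl fun n hn => ?_
      rw [Finset.sum_mul]
      rw [Finset.mem_range] at hn
      refine Finset.sum_congr ?_ ?_
      · ext p
        simp only [Finset.mem_filter, Finset.mem_product, Finset.mem_range, Finset.HasAntidiagonal.mem_antidiagonal]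
        omega
      · intro p hp
        rw [Finset.HasAntidiagonal.mem_antidiagonal] at hp
        rw [hp]
    · intro p hp
      simp only [Finset.mem_filter, Finset.mem_product, Finset.mem_range] at hp ⊢
      omega
  have h3 : τ⁻¹ * (∑ n ∈ Finset.range (M + 1), s n * τ ^ n) = ∑ n ∈ Finset.range M, s (n + 1) * τ ^ n := by
    rw [Finset.sum_range_succ', hs0, zero_mul, add_zero, Finset.mul_sum]
    refine Finset.sum_congr rfl fun n _ => ?_
    rw [pow_succ]; field_simp
  rw [h1, h2, h3, Finset.sum_range_succ]
  have h4 : ∑ n ∈ Finset.range M, (s (n + 1) + d n + ∑ p ∈ Finset.HasAntidiagonal.antidiagonal n, s p.1 * s p.2) * τ ^ n =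
      s 1 := by
    obtain ⟨m, rfl⟩ : ∃ m, M = m + 1 := ⟨M - 1, by omega⟩
    have h00 : ∑ p ∈ Finset.HasAntidiagonal.antidiagonal 0, s p.1 * s p.2 = 0 := by simp [hs0]
    rw [Finset.sum_range_succ']
    simp only [h00, hd0, zero_add, pow_zero, mul_one, add_zero]
    rw [Finset.sum_eq_zero, zero_add]
    intro n _
    rw [hrec (n + 1) (by omega), zero_mul]
  rw [← h4]
  simp only [add_mul, Finset.sum_add_distrib]
  ring

lemma riccati_bound {M : ℕ} {τ : ℂ} (hτ : ‖τ‖ ≤ 1) {s : ℕ → ℂ} {dM : ℂ} :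
    ‖dM * τ ^ M + ∑ p ∈ (Finset.range (M + 1) ×ˢ Finset.range (M + 1)).filter (fun p => M ≤ p.1 + p.2),
        s p.1 * s p.2 * τ ^ (p.1 + p.2)‖ ≤ ‖τ‖ ^ M * (‖dM‖ +
      ∑ p ∈ (Finset.range (M + 1) ×ˢ Finset.range (M + 1)).filter (fun p => M ≤ p.1 + p.2),
        ‖s p.1‖ * ‖s p.2‖) := by
  rw [mul_add, Finset.mul_sum]
  refine (norm_add_le _ _).trans (add_le_add (by rw [norm_mul, norm_pow, mul_comm]) ?_)
  refine norm_sum_le_of_le _ fun p hp => ?_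
  rw [norm_mul, norm_mul, norm_pow, mul_comm]
  have := (Finset.mem_filter.1 hp).2
  exact mul_le_mul_of_nonneg_right (pow_le_pow_of_le_one (norm_nonneg _) hτ this) (by positivity)

lemma sigmaZF_rec (v : ℝ → ℝ) (n : ℕ) (hn : 1 ≤ n) (x : ℝ) :
    sigmaZF v (n + 1) x + deriv (sigmaZF v n) x +
      ∑ p ∈ Finset.HasAntidiagonal.antidiagonal n, sigmaZF v p.1 x * sigmaZF v p.2 x = 0 := by
  obtain ⟨m, rfl⟩ : ∃ m, n = m + 1 := ⟨n - 1, by omega⟩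
  rw [sigmaZF_succ_succ, ← Finset.Nat.sum_antidiagonal_swap, Finset.Nat.sum_antidiagonal_eq_sum_range_succ_mk,
    Finset.sum_range_succ']
  simp only [Prod.swap]
  rw [sigmaZF_zero]
  have : ∑ j ∈ Finset.Icc 1 (m + 1), sigmaZF v (m + 1 - j) x * sigmaZF v j x =
      ∑ k ∈ Finset.range (m + 1), sigmaZF v (m + 1 - (k + 1)) x * sigmaZF v (k + 1) x := by
    rw [Finset.range_eq_Ico, Finset.sum_Ico_add' (fun j => sigmaZF v (m + 1 - j) x * sigmaZF v j x) 0 (m + 1) 1]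
    rfl
  rw [this]
  ring


lemma asympt_core (v : SchwartzMap ℝ ℝ) {M : ℕ} (hM : 1 ≤ M) : ∃ C : ℝ, 0 ≤ C ∧
    ∀ (k : ℂ) (f f' f'' h h' h'' : ℝ → ℂ) (B B' : ℝ) (γ : ℂ), 1 ≤ ‖k‖ →
    IsSchrodingerSolution v k f f' f'' → IsJostAtPlusInfinity k f f' →
    IsSchrodingerSolution v k h h' h'' → (∀ x : ℝ, ‖Complex.exp (I * k * x) * h x‖ ≤ B) →
    (∀ x : ℝ, ‖Complex.exp (I * k * x) * h' x‖ ≤ B') →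
    Tendsto (fun x : ℝ => Complex.exp (I * k * x) * (I * k * h x - h' x)) atBot (nhds γ) →
    ‖f' 0 * h 0 - f 0 * h' 0 - Complex.exp (-∑ n ∈ Finset.range (M + 1),
      ((∫ x, sigmaZF v n x : ℝ) : ℂ) * ((2 * I * k)⁻¹) ^ n) * γ‖ ≤ C * B * ‖(2 * I * k)⁻¹‖ ^ M := by
  choose S hS using sigmaZF_schwartz v
  choose Θ hΘd hΘb hΘt hΘn using fun n => schwartz_primitive (S n)
  set D : ℕ → SchwartzMap ℝ ℝ := fun n => SchwartzMap.derivCLM ℝ ℝ (S n) with hD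
  have hDd : ∀ n x, HasDerivAt (S n) (D n x) x := fun n x => by
    rw [hD, SchwartzMap.derivCLM_apply]
    exact (S n).differentiableAt.hasDerivAt
  set s : ℕ → ℝ := fun n => ∫ x, S n x with hs
  set K : ℝ := ∑ n ∈ Finset.range (M + 1), 2 * ∫ x, ‖S n x‖ with hK
  set ρ : ℝ → ℝ := fun x => ‖D M x‖ +
      ∑ p ∈ (Finset.range (M + 1) ×ˢ Finset.range (M + 1)).filter (fun p => M ≤ p.1 + p.2),
        ‖S p.1 x‖ * ‖S p.2 x‖ with hρ
  have hρ0 : ∀ x, 0 ≤ ρ x := fun x => by positivity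
  have hρi : Integrable ρ := by
    refine (D M).integrable.norm.add (integrable_finsetSum _ fun p _ => ?_)
    refine (SchwartzMap.pairing (ContinuousLinearMap.mul ℝ ℝ) (S p.1) (S p.2)).integrable.norm.congr
      (Eventually.of_forall fun x => ?_)
    simp
  refine ⟨Real.exp K * ∫ x, ρ x, mul_nonneg (Real.exp_pos _).le (integral_nonneg hρ0), ?_⟩
  intro k f f' f'' h h' h'' B B' γ hk1 hf hj hh hB hB' hγ
  have hk0 : k ≠ 0 := by rintro rfl; simp at hk1; linarith
  simp only [hS]
  set τ : ℂ := (2 * I * k)⁻¹ with hτ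
  have hτ0 : τ ≠ 0 := by rw [hτ]; exact inv_ne_zero (by simp [hk0])
  have hτi : τ⁻¹ = 2 * I * k := by rw [hτ, inv_inv]
  have hτ1 : ‖τ‖ ≤ 1 := by
    rw [hτ, norm_inv]
    apply inv_le_one_of_one_le₀
    simp; linarith
  set φ : ℝ → ℂ := fun x => ∑ n ∈ Finset.range (M + 1), ((Θ n x : ℂ) - (s n : ℂ)) * τ ^ n with hφ
  set Sg : ℝ → ℂ := fun x => ∑ n ∈ Finset.range (M + 1), (S n x : ℂ) * τ ^ n with hSg
  set Sg' : ℝ → ℂ := fun x => ∑ n ∈ Finset.range (M + 1), (D n x : ℂ) * τ ^ n with hSg'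
  set r : ℝ → ℂ := fun x => (D M x : ℂ) * τ ^ M +
      ∑ p ∈ (Finset.range (M + 1) ×ˢ Finset.range (M + 1)).filter (fun p => M ≤ p.1 + p.2),
        (S p.1 x : ℂ) * S p.2 x * τ ^ (p.1 + p.2) with hr
  have hφd : ∀ x, HasDerivAt φ (Sg x) x := fun x =>
    HasDerivAt.fun_sum fun n _ => (((hΘd n x).ofReal_comp).sub_const _).mul_const _
  have hSd : ∀ x, HasDerivAt Sg (Sg' x) x := fun x =>
    HasDerivAt.fun_sum fun n _ => ((hDd n x).ofReal_comp).mul_const _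
  have hric : ∀ x, Sg' x + Sg x ^ 2 + 2 * I * k * Sg x = v x + r x := by
    intro x
    have hz : S 0 = 0 := by
      ext y; rw [← hS 0, sigmaZF_zero]; rfl
    have := riccati_alg hM hτ0 (s := fun n => (S n x : ℂ)) (d := fun n => (D n x : ℂ))
      (by simp [hz]) (by simp [hD, hz]) (fun n hn => by
        have := sigmaZF_rec v n hn x
        simp only [hS] at this
        rw [(hDd n x).deriv] at this
        exact_mod_cast this)
    rw [hτi] at this
    have h1 : (S 1 x : ℂ) = v x := by rw [← hS 1, sigmaZF_one]
    simp only [h1] at this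
    exact this
  have hrn : ∀ x, ‖r x‖ ≤ ‖τ‖ ^ M * ρ x := by
    intro x
    have := riccati_bound (M := M) hτ1 (s := fun n => (S n x : ℂ)) (dM := (D M x : ℂ))
    simpa only [Complex.norm_real] using this
  have hφn : ∀ x, ‖φ x‖ ≤ K := by
    intro x
    refine norm_sum_le_of_le _ fun n _ => ?_
    rw [norm_mul, norm_pow, ← Complex.ofReal_sub, Complex.norm_real]
    calc _ ≤ (2 * ∫ x, ‖S n x‖) * 1 := by
          gcongr
          · exact hΘn n x
          · exact pow_le_one₀ (norm_nonneg _) hτ1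
      _ = _ := mul_one _
  have hexpn : ∀ x, ‖Complex.exp (φ x)‖ ≤ Real.exp K := fun x => by
    rw [Complex.norm_exp]
    exact Real.exp_le_exp.2 ((Complex.re_le_norm _).trans (hφn x))
  set G : ℝ → ℂ := fun x => Complex.exp (φ x) * (Complex.exp (I * k * x) * ((I * k + Sg x) * h x - h' x)) with hG
  have hGd : ∀ x, HasDerivAt G (Complex.exp (φ x) * r x * (Complex.exp (I * k * x) * h x)) x := by
    intro x
    have := ((hφd x).cexp).fun_mul ((hasDerivAt_cexp_lin (I * k) x).fun_mul
      ((((hSd x).const_add (I * k)).fun_mul (hh.1 x)).fun_sub (hh.2.1 x)))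
    refine this.congr_deriv ?_
    linear_combination (Complex.exp (φ x) * Complex.exp (I * k * x) * h x) * hric x +
      Complex.exp (φ x) * Complex.exp (I * k * x) * hh.2.2.2 x +
      Complex.exp (φ x) * Complex.exp (I * k * x) * k ^ 2 * h x * I_sq
  have hcont : ∀ {g g' : ℝ → ℂ}, (∀ x, HasDerivAt g (g' x) x) → Continuous g := fun hg =>
    continuous_iff_continuousAt.2 fun x => (hg x).continuousAt
  have hrc : Continuous r := by
    have e : r = fun x => Sg' x + Sg x ^ 2 + 2 * I * k * Sg x - v x := by
      ext x; linear_combination -hric x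
    rw [e]
    have c1 : Continuous Sg := hcont hSd
    have c2 : Continuous Sg' := continuous_finsetSum _ fun n _ =>
      (Complex.continuous_ofReal.comp (D n).continuous).mul continuous_const
    have c3 : Continuous fun x => (v x : ℂ) := Complex.continuous_ofReal.comp v.continuous
    fun_prop
  have hbnd : ∀ x, ‖Complex.exp (φ x) * r x * (Complex.exp (I * k * x) * h x)‖ ≤
      (Real.exp K * ‖τ‖ ^ M * B) * ρ x := by
    intro x
    rw [norm_mul, norm_mul]
    calc _ ≤ Real.exp K * (‖τ‖ ^ M * ρ x) * B := by
          have := hρ0 x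
          gcongr
          · exact hexpn x
          · exact hrn x
          · exact hB x
      _ = _ := by ring
  have hintg : Integrable (fun x : ℝ => Complex.exp (φ x) * r x * (Complex.exp (I * k * x) * h x)) := by
    refine (hρi.const_mul (Real.exp K * ‖τ‖ ^ M * B)).mono' ?_ (Eventually.of_forall hbnd)
    have c1 : Continuous φ := hcont hφd
    have c2 : Continuous h := hcont hh.1
    apply Continuous.aestronglyMeasurable
    fun_prop
  have hSgz : ∀ l : Filter ℝ, l ≤ cocompact ℝ → Tendsto Sg l (nhds 0) := by
    intro l hl
    have : Tendsto Sg l (nhds (∑ n ∈ Finset.range (M + 1), ((0 : ℝ) : ℂ) * τ ^ n)) :=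
      tendsto_finsetSum _ fun n _ => (((Complex.continuous_ofReal.tendsto _).comp
        ((S n).tendsto_cocompact.mono_left hl)).mul_const _)
    simpa using this
  have hbot : Tendsto G atBot (nhds (Complex.exp (-∑ n ∈ Finset.range (M + 1), (s n : ℂ) * τ ^ n) * γ)) := by
    have t1 : Tendsto φ atBot (nhds (∑ n ∈ Finset.range (M + 1), (((0 : ℝ) : ℂ) - (s n : ℂ)) * τ ^ n)) :=
      tendsto_finsetSum _ fun n _ => ((((Complex.continuous_ofReal.tendsto _).comp (hΘb n)).sub_const _).mul_const _)
    have e : (∑ n ∈ Finset.range (M + 1), (((0 : ℝ) : ℂ) - (s n : ℂ)) * τ ^ n) =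
        -∑ n ∈ Finset.range (M + 1), (s n : ℂ) * τ ^ n := by
      rw [← Finset.sum_neg_distrib]; refine Finset.sum_congr rfl fun n _ => ?_; simp
    rw [e] at t1
    have t2 : Tendsto (fun x : ℝ => Sg x * (Complex.exp (I * k * x) * h x)) atBot (nhds 0) :=
      (hSgz _ atBot_le_cocompact).zero_mul_isBoundedUnder_le
        (isBoundedUnder_of ⟨B, fun x => hB x⟩)
    have t3 := ((Complex.continuous_exp.tendsto _).comp t1).mul (hγ.add t2)
    rw [add_zero] at t3
    refine t3.congr fun x => ?_
    simp only [hG, Function.comp_apply]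
    ring
  have htop : Tendsto G atTop (nhds (f' 0 * h 0 - f 0 * h' 0)) := by
    have t1 : Tendsto φ atTop (nhds (∑ n ∈ Finset.range (M + 1), (((s n : ℝ) : ℂ) - (s n : ℂ)) * τ ^ n)) :=
      tendsto_finsetSum _ fun n _ => ((((Complex.continuous_ofReal.tendsto _).comp (hΘt n)).sub_const _).mul_const _)
    have t1' : Tendsto (fun x => Complex.exp (φ x)) atTop (nhds 1) := by
      have := (Complex.continuous_exp.tendsto _).comp t1
      simp only [sub_self, zero_mul, Finset.sum_const_zero, Complex.exp_zero] at this
      exact this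
    have t2 : Tendsto (fun x : ℝ => Complex.exp (φ x) * (I * k + Sg x) - Complex.exp (-I * k * x) * f' x)
        atTop (nhds 0) := by
      have := (t1'.mul ((hSgz _ atTop_le_cocompact).const_add (I * k))).sub hj.2
      simpa using this
    have t3 : Tendsto (fun x : ℝ => Complex.exp (φ x) - Complex.exp (-I * k * x) * f x)
        atTop (nhds 0) := by
      have := t1'.sub hj.1
      simpa using this
    have t4 := (t2.zero_mul_isBoundedUnder_le (isBoundedUnder_of (r := (· ≤ ·)) ⟨B, fun x => hB x⟩)).sub
      (t3.zero_mul_isBoundedUnder_le (isBoundedUnder_of (r := (· ≤ ·)) ⟨B', fun x => hB' x⟩))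
    have t5 := t4.add_const (f' 0 * h 0 - f 0 * h' 0)
    simp only [sub_zero, zero_add] at t5
    refine t5.congr fun x => ?_
    rw [← wronskian_const hf hh x]
    have e : Complex.exp (-I * k * x) * Complex.exp (I * k * x) = 1 := by
      rw [← Complex.exp_add]; simp
    simp only [hG]
    linear_combination (-(f' x * h x - f x * h' x)) * e
  have hftc := integral_of_hasDerivAt_of_tendsto hGd hintg hbot htop
  rw [← hftc]
  refine (norm_integral_le_of_norm_le (hρi.const_mul _) (Eventually.of_forall hbnd)).trans ?_
  rw [integral_const_mul]
  apply le_of_eq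
  ring


/-- The bundle of hypotheses on the Jost solutions. -/
structure ZFData (v : SchwartzMap ℝ ℝ) (f₁ f₁' f₁'' f₂ f₂' f₂'' : ℂ → ℝ → ℂ) : Prop where
  h1 : ∀ κ : ℂ, 0 ≤ κ.im → κ ≠ 0 → IsSchrodingerSolution (⇑v) κ (f₁ κ) (f₁' κ) (f₁'' κ)
  hj1 : ∀ κ : ℂ, 0 ≤ κ.im → κ ≠ 0 → IsJostAtPlusInfinity κ (f₁ κ) (f₁' κ)
  h2 : ∀ κ : ℂ, 0 ≤ κ.im → κ ≠ 0 → IsSchrodingerSolution (⇑v) κ (f₂ κ) (f₂' κ) (f₂'' κ)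
  hj2 : ∀ κ : ℂ, 0 ≤ κ.im → κ ≠ 0 → IsJostAtMinusInfinity κ (f₂ κ) (f₂' κ)

lemma asympt_a {v : SchwartzMap ℝ ℝ} {f₁ f₁' f₁'' f₂ f₂' f₂'' : ℂ → ℝ → ℂ}
    (hd : ZFData v f₁ f₁' f₁'' f₂ f₂' f₂'') {M : ℕ} (hM : 1 ≤ M) :
    ∃ C : ℝ, 0 ≤ C ∧ ∀ k : ℂ, 0 ≤ k.im → 1 ≤ ‖k‖ →
      ‖(f₁' k 0 * f₂ k 0 - f₁ k 0 * f₂' k 0) / (2 * I * k) - Complex.exp (-∑ n ∈ Finset.range (M + 1),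
        ((∫ x, sigmaZF v n x : ℝ) : ℂ) * ((2 * I * k)⁻¹) ^ n)‖ ≤ C * (‖k‖⁻¹) ^ (M + 1) := by
  obtain ⟨C, hC, hcore⟩ := asympt_core v hM
  obtain ⟨B, hB, hb⟩ := jost2_bound v
  refine ⟨C * B, by positivity, fun k hk hk1 => ?_⟩
  have hk0 : k ≠ 0 := by rintro rfl; simp at hk1; linarith
  have hkn : 0 < ‖k‖ := by positivity
  have hbk := hb k _ _ _ hk hk1 (hd.h2 k hk hk0) (hd.hj2 k hk hk0)
  have := hcore k _ _ _ _ _ _ B _ (2 * I * k) hk1 (hd.h1 k hk hk0) (hd.hj1 k hk hk0) (hd.h2 k hk hk0)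
    (fun x => (hbk x).1) (fun x => (hbk x).2) (by
      have := ((hd.hj2 k hk hk0).1.const_mul (I * k)).sub (hd.hj2 k hk hk0).2
      have e : I * k * 1 - -I * k = 2 * I * k := by ring
      rw [e] at this
      refine this.congr fun x => ?_
      ring)
  set E := Complex.exp (-∑ n ∈ Finset.range (M + 1),
        ((∫ x, sigmaZF v n x : ℝ) : ℂ) * ((2 * I * k)⁻¹) ^ n)
  set W := f₁' k 0 * f₂ k 0 - f₁ k 0 * f₂' k 0
  have hI : (2 * I * k) ≠ 0 := by simp [hk0]
  have e : W / (2 * I * k) - E = (W - E * (2 * I * k)) * (2 * I * k)⁻¹ := by field_simp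
  rw [e, norm_mul]
  have hτ : ‖(2 * I * k)⁻¹‖ ≤ ‖k‖⁻¹ := by
    rw [norm_inv]
    apply inv_anti₀ hkn
    simp
    linarith
  calc _ ≤ C * B * ‖(2 * I * k)⁻¹‖ ^ M * ‖(2 * I * k)⁻¹‖ := by gcongr
    _ = C * B * ‖(2 * I * k)⁻¹‖ ^ (M + 1) := by ring
    _ ≤ _ := by gcongr

lemma one_le_a {v : SchwartzMap ℝ ℝ} {f₁ f₁' f₁'' f₂ f₂' f₂'' : ℂ → ℝ → ℂ}
    (hd : ZFData v f₁ f₁' f₁'' f₂ f₂' f₂'') (k : ℝ) (hk : k ≠ 0) :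
    1 ≤ ‖(f₁' k 0 * f₂ k 0 - f₁ k 0 * f₂' k 0) / (2 * I * k)‖ := by
  have hk0 : (k : ℂ) ≠ 0 := by exact_mod_cast hk
  have hki : 0 ≤ (k : ℂ).im := by simp
  have := plucker_real (hd.h1 k hki hk0) (hd.hj1 k hki hk0) (hd.h2 k hki hk0) (hd.hj2 k hki hk0)
  have hn : ‖2 * I * (k : ℂ)‖ = 2 * |k| := by simp
  rw [norm_div, hn, one_le_div (by positivity)]
  apply abs_le_of_sq_le_sq' _ (norm_nonneg _) |>.2
  rw [this, mul_pow, sq_abs]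
  nlinarith [sq_nonneg ‖f₁' k 0 * (starRingEnd ℂ) (f₂ k 0) - f₁ k 0 * (starRingEnd ℂ) (f₂' k 0)‖]

lemma asympt_real {v : SchwartzMap ℝ ℝ} {f₁ f₁' f₁'' f₂ f₂' f₂'' : ℂ → ℝ → ℂ}
    (hd : ZFData v f₁ f₁' f₁'' f₂ f₂' f₂'') {M : ℕ} (hM : 1 ≤ M) :
    ∃ C : ℝ, 0 ≤ C ∧ ∀ k : ℝ, 1 ≤ |k| →
      ‖(f₁' k 0 * f₂ k 0 - f₁ k 0 * f₂' k 0) / (2 * I * k)‖ ^ 2 ≤ 1 + C * (|k|⁻¹) ^ (2 * M + 2) := by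
  obtain ⟨C, hC, hcore⟩ := asympt_core v hM
  obtain ⟨B, hB, hb⟩ := jost2_bound v
  refine ⟨(C * B) ^ 2, by positivity, fun k hk1 => ?_⟩
  have hkn : 0 < |k| := by linarith
  have hk0 : (k : ℂ) ≠ 0 := by simpa using abs_pos.1 hkn
  have hki : 0 ≤ (k : ℂ).im := by simp
  have hk1' : 1 ≤ ‖(k : ℂ)‖ := by simpa using hk1
  have hbk := hb k _ _ _ hki hk1' (hd.h2 k hki hk0) (hd.hj2 k hki hk0)
  have hpl := plucker_real (hd.h1 k hki hk0) (hd.hj1 k hki hk0) (hd.h2 k hki hk0) (hd.hj2 k hki hk0)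
  have he1 : ∀ x : ℝ, ‖Complex.exp (I * k * x)‖ = 1 := fun x => by
    rw [Complex.norm_exp]; simp
  have hj := hd.hj2 k hki hk0
  have := hcore k _ _ _ _ _ _ B (B * (3 * ‖(k : ℂ)‖)) 0 hk1' (hd.h1 k hki hk0) (hd.hj1 k hki hk0)
    (conj_sol (hd.h2 k hki hk0))
    (fun x => by have := (hbk x).1; rw [norm_mul, he1] at this ⊢; rwa [RCLike.norm_conj])
    (fun x => by have := (hbk x).2; rw [norm_mul, he1] at this ⊢; rwa [RCLike.norm_conj]) (by
      have t1 : Tendsto (fun x : ℝ => Complex.exp (I * k * x) * (I * k * f₂ k x + f₂' k x)) atBot (nhds 0) := by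
        have := (hj.1.const_mul (I * k)).add hj.2
        have e : I * k * 1 + -I * k = 0 := by ring
        rw [e] at this
        refine this.congr fun x => ?_
        ring
      rw [tendsto_zero_iff_norm_tendsto_zero] at t1 ⊢
      refine t1.congr fun x => ?_
      rw [norm_mul, norm_mul, he1, one_mul, one_mul, ← RCLike.norm_conj, ← norm_neg]
      congr 1
      simp
      ring)
  rw [mul_zero, sub_zero] at this
  set Wb := f₁' k 0 * (starRingEnd ℂ) (f₂ k 0) - f₁ k 0 * (starRingEnd ℂ) (f₂' k 0)
  have hn : ‖2 * I * (k : ℂ)‖ = 2 * |k| := by simp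
  have hτ : ‖(2 * I * (k : ℂ))⁻¹‖ ≤ |k|⁻¹ := by
    rw [norm_inv, hn]
    apply inv_anti₀ hkn
    linarith
  rw [norm_div, div_pow, hpl, hn, div_le_iff₀ (by positivity)]
  have h2 : ‖Wb‖ ^ 2 ≤ (C * B * (|k|⁻¹) ^ M) ^ 2 := by
    gcongr
    exact this.trans (by gcongr)
  have e : (|k|⁻¹) ^ (2 * M + 2) * (2 * |k|) ^ 2 = 4 * ((|k|⁻¹) ^ M) ^ 2 := by
    rw [pow_add, pow_mul']; field_simp; norm_num
  have e2 : (2 * |k|) ^ 2 = 4 * k ^ 2 := by rw [mul_pow, sq_abs]; norm_num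
  have h3 : (1 + (C * B) ^ 2 * |k|⁻¹ ^ (2 * M + 2)) * (2 * |k|) ^ 2 =
    4 * k ^ 2 + 4 * (C * B * (|k|⁻¹) ^ M) ^ 2 := by
    rw [add_mul, mul_assoc, e, e2]; ring
  rw [h3]
  nlinarith [sq_nonneg (C * B * (|k|⁻¹) ^ M)]

lemma poly_vanish {M : ℕ} {q : ℕ → ℝ} {C : ℝ} {t₀ : ℝ} (ht₀ : 0 < t₀)
    (h : ∀ t, 0 < t → t < t₀ → |∑ n ∈ Finset.range (M + 1), q n * t ^ n| ≤ C * t ^ (M + 1)) :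
    ∀ n, n ≤ M → q n = 0 := by
  intro n
  induction n using Nat.strong_induction_on with
  | _ n ih =>
    intro hn
    have hsum : ∀ t : ℝ, ∑ j ∈ Finset.range (M + 1), q j * t ^ j =
        t ^ n * ∑ i ∈ Finset.range (M + 1 - n), q (n + i) * t ^ i := by
      intro t
      have : M + 1 = n + (M + 1 - n) := by omega
      rw [this, Finset.sum_range_add, Finset.sum_eq_zero, zero_add, Finset.mul_sum]
      · rw [← this]; refine Finset.sum_congr rfl fun i _ => ?_; rw [pow_add]; ring
      · intro j hj
        rw [Finset.mem_range] at hj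
        rw [ih j hj (by omega), zero_mul]
    have hb : ∀ t, 0 < t → t < t₀ → |∑ i ∈ Finset.range (M + 1 - n), q (n + i) * t ^ i| ≤ C * t ^ (M + 1 - n) := by
      intro t ht htt
      have := h t ht htt
      rw [hsum, abs_mul, abs_of_pos (by positivity)] at this
      have e : t ^ (M + 1) = t ^ n * t ^ (M + 1 - n) := by rw [← pow_add]; congr 1; omega
      rw [e] at this
      have hp : 0 < t ^ n := by positivity
      have h3 : t ^ n * |∑ i ∈ Finset.range (M + 1 - n), q (n + i) * t ^ i| ≤ t ^ n * (C * t ^ (M + 1 - n)) := by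
        linarith
      exact le_of_mul_le_mul_left h3 hp
    have hc : Continuous fun t : ℝ => ∑ i ∈ Finset.range (M + 1 - n), q (n + i) * t ^ i := by fun_prop
    have hc2 : Continuous fun t : ℝ => C * t ^ (M + 1 - n) := by fun_prop
    have l1 := (hc.abs.tendsto 0).mono_left (nhdsWithin_le_nhds (s := Ioi 0))
    have l2 := (hc2.tendsto 0).mono_left (nhdsWithin_le_nhds (s := Ioi 0))
    have hle := le_of_tendsto_of_tendsto l1 l2 (by
      filter_upwards [Ioo_mem_nhdsGT ht₀] with t ht using hb t ht.1 ht.2)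
    have e1 : M + 1 - n = (M - n) + 1 := by omega
    rw [e1, Finset.sum_range_succ'] at hle
    simp at hle
    exact hle

lemma even_vanish {v : SchwartzMap ℝ ℝ} {f₁ f₁' f₁'' f₂ f₂' f₂'' : ℂ → ℝ → ℂ}
    (hd : ZFData v f₁ f₁' f₁'' f₂ f₂' f₂'') (m : ℕ) : ∫ x, sigmaZF v (2 * m) x = 0 := by
  rcases Nat.eq_zero_or_pos m with rfl | hm
  · simp [sigmaZF_zero]
  obtain ⟨C1, hC1, h1⟩ := asympt_a hd (M := 2 * m) (by omega)
  obtain ⟨C2, hC2, h2⟩ := asympt_real hd (M := 2 * m) (by omega)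
  set M := 2 * m with hM
  have key := poly_vanish (M := M) (q := fun n => (∫ x, sigmaZF v n x) * (((2 * I)⁻¹ : ℂ) ^ n).re)
    (C := 2 * (C1 + C2)) (t₀ := (1 + 2 * (C1 + C2))⁻¹) (by positivity) (fun t ht htt => by
    have hK : (1 + 2 * (C1 + C2)) * t < 1 := by
      rwa [lt_inv_comm₀ ht (by positivity), ← one_div, lt_div_iff₀ ht] at htt
    have ht1 : t ≤ 1 := by nlinarith
    have hti : 1 ≤ t⁻¹ := (one_le_inv₀ ht).2 ht1
    have a1 := h1 ((t⁻¹ : ℝ) : ℂ) (by simp) (by simpa [abs_of_pos ht] using hti)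
    have a2 := h2 t⁻¹ (by rwa [abs_of_pos (by positivity)])
    have a3 := one_le_a hd t⁻¹ (by positivity)
    set α := (f₁' ((t⁻¹ : ℝ) : ℂ) 0 * f₂ ((t⁻¹ : ℝ) : ℂ) 0 - f₁ ((t⁻¹ : ℝ) : ℂ) 0 * f₂' ((t⁻¹ : ℝ) : ℂ) 0) /
      (2 * I * ((t⁻¹ : ℝ) : ℂ))
    set y := ∑ n ∈ Finset.range (M + 1), ((∫ x, sigmaZF v n x : ℝ) : ℂ) * ((2 * I * ((t⁻¹ : ℝ) : ℂ))⁻¹) ^ n with hy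
    have hyre : ∑ n ∈ Finset.range (M + 1), (∫ x, sigmaZF v n x) * (((2 * I)⁻¹ : ℂ) ^ n).re * t ^ n = y.re := by
      rw [hy, Complex.re_sum]
      refine Finset.sum_congr rfl fun n _ => ?_
      rw [Complex.re_ofReal_mul]
      have : ((2 * I * ((t⁻¹ : ℝ) : ℂ))⁻¹) ^ n = ((t ^ n : ℝ) : ℂ) * ((2 * I)⁻¹ : ℂ) ^ n := by
        push_cast
        rw [mul_inv, inv_inv, mul_pow, mul_comm]
      rw [this, Complex.re_ofReal_mul]; ring
    rw [hyre]
    have e1 : ‖((t⁻¹ : ℝ) : ℂ)‖⁻¹ = t := by simp [abs_of_pos ht]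
    have e2 : |t⁻¹|⁻¹ = t := by rw [abs_of_pos (by positivity), inv_inv]
    rw [e1] at a1
    rw [e2] at a2
    have a4 : |‖α‖ - Real.exp (-y.re)| ≤ C1 * t ^ (M + 1) := by
      have := (abs_norm_sub_norm_le α (Complex.exp (-y))).trans a1
      rwa [Complex.norm_exp, Complex.neg_re] at this
    have a5 : ‖α‖ ≤ 1 + C2 * t ^ (M + 1) := by
      have : t ^ (2 * M + 2) ≤ t ^ (M + 1) := pow_le_pow_of_le_one ht.le ht1 (by omega)
      nlinarith [mul_le_mul_of_nonneg_left this hC2]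
    have htM : t ^ (M + 1) ≤ t := by
      calc t ^ (M + 1) ≤ t ^ 1 := pow_le_pow_of_le_one ht.le ht1 (by omega)
        _ = t := pow_one t
    set δ := (C1 + C2) * t ^ (M + 1) with hδ
    have hδ2 : 2 * δ ≤ 1 := by
      have : (C1 + C2) * t ^ (M + 1) ≤ (C1 + C2) * t := by gcongr
      nlinarith
    have hp : 0 < t ^ (M + 1) := by positivity
    have a4' := abs_le.1 a4
    have b1 : 1 - δ ≤ Real.exp (-y.re) := by nlinarith
    have b2 : Real.exp (-y.re) ≤ 1 + δ := by nlinarith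
    have hδ0 : 0 ≤ δ := by positivity
    have goal' : 2 * (C1 + C2) * t ^ (M + 1) = 2 * δ := by rw [hδ]; ring
    rw [goal', abs_le]
    constructor
    · have := Real.add_one_le_exp (-y.re)
      linarith
    · have h3 := Real.add_one_le_exp (y.re)
      have h4 : Real.exp y.re * Real.exp (-y.re) = 1 := by rw [← Real.exp_add]; simp
      have h5 : Real.exp y.re * (1 - δ) ≤ 1 := by
        refine le_trans ?_ h4.le; gcongr
      nlinarith [Real.exp_pos y.re])
  have := key M le_rfl
  rcases mul_eq_zero.1 this with h | h
  · exact h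
  · exfalso
    have e : ((2 * I)⁻¹ : ℂ) ^ M = (((-4)⁻¹ : ℝ) ^ m : ℝ) := by
      rw [hM, pow_mul]
      push_cast
      congr 1
      rw [inv_pow, mul_pow, I_sq]; norm_num
    rw [e, Complex.ofReal_re] at h
    exact absurd h (by positivity)


lemma flux_lower {v : ℝ → ℝ} {f f' f'' : ℂ → ℝ → ℂ}
    (h1 : ∀ κ : ℂ, 0 ≤ κ.im → κ ≠ 0 → IsSchrodingerSolution v κ (f κ) (f' κ) (f'' κ))
    (hj1 : ∀ κ : ℂ, 0 ≤ κ.im → κ ≠ 0 → IsJostAtPlusInfinity κ (f κ) (f' κ))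
    {C : ℝ} (hC0 : 0 ≤ C)
    (hC : ∀ k k' : ℂ, 0 ≤ k.im → k ≠ 0 → 0 ≤ k'.im → k' ≠ 0 → ∀ x, 0 ≤ x →
        ‖mJ f k x - mJ f k' x‖ ≤ C * ‖k - k'‖) {κ : ℝ} (hκ : 0 < κ) :
    ∃ c : ℝ, 0 < c ∧ ∃ δ : ℝ, 0 < δ ∧ ∀ t : ℝ, 0 < t → t < δ →
      c * t ≤ (f' (I * κ + t) 0 * (starRingEnd ℂ) (f (I * κ + t) 0)).im := by
  have hik : 0 ≤ (I * (κ : ℂ)).im := by simp [hκ.le]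
  have hik0 : I * (κ : ℂ) ≠ 0 := by simp [hκ.ne']
  obtain ⟨X0, hX0⟩ : ∃ X0, ∀ x, X0 ≤ x → ‖mJ f (I * κ) x - 1‖ < 1 / 4 := by
    have := (mJ_tendsto hj1 hik hik0).eventually (Metric.ball_mem_nhds _ (show (0 : ℝ) < 1 / 4 by norm_num))
    obtain ⟨X0, h⟩ := eventually_atTop.1 this
    exact ⟨X0, fun x hx => by simpa [dist_eq_norm] using h x hx⟩
  set X := max X0 0 with hX
  refine ⟨2 * κ * (Real.exp (-κ * (X + 1)) / 2) ^ 2, by positivity, (4 * (C + 1))⁻¹, by positivity, fun t ht htδ => ?_⟩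
  set k : ℂ := I * κ + t with hk
  have hkim : k.im = κ := by simp [hk]
  have hkre : k.re = t := by simp [hk]
  have hki : 0 ≤ k.im := by rw [hkim]; exact hκ.le
  have hk0 : k ≠ 0 := fun h => by rw [h] at hkim; simp at hkim; linarith
  have hs := h1 k hki hk0
  have hj := hj1 k hki hk0
  set P : ℝ → ℝ := fun x => (f' k x * (starRingEnd ℂ) (f k x)).im with hP
  have hk2 : (k ^ 2).im = 2 * t * κ := by rw [sq, Complex.mul_im, hkim, hkre]; ring
  have hPd : ∀ x, HasDerivAt P (-(2 * t * κ) * normSq (f k x)) x := by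
    intro x
    have h2 := (hs.2.1 x).fun_mul (hasDerivAt_conj_zf (hs.1 x))
    have h3 := (Complex.imCLM.hasFDerivAt.comp_hasDerivAt x h2)
    refine h3.congr_deriv ?_
    have e : f'' k x * (starRingEnd ℂ) (f k x) + f' k x * (starRingEnd ℂ) (f' k x) =
        ((v x * normSq (f k x) + normSq (f' k x) : ℝ) : ℂ) - ((normSq (f k x) : ℝ) : ℂ) * k ^ 2 := by
      push_cast
      rw [← Complex.mul_conj, ← Complex.mul_conj]
      linear_combination (-(starRingEnd ℂ) (f k x)) * hs.2.2.2 x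
    rw [e]
    simp only [imCLM_apply, Complex.sub_im, Complex.ofReal_im, Complex.im_ofReal_mul, hk2]
    ring
  have hanti : Antitone P := antitone_of_hasDerivAt_nonpos hPd fun x => by
    have := normSq_nonneg (f k x)
    have h2 : 0 ≤ 2 * t * κ * normSq (f k x) := by positivity
    simp only [Pi.zero_apply]
    linarith
  have hlim : Tendsto P atTop (nhds 0) := by
    have he : Tendsto (fun x : ℝ => ((Real.exp (-(2 * κ) * x) : ℝ) : ℂ)) atTop (nhds 0) := by
      have h0 : Tendsto (fun x : ℝ => Real.exp (-(2 * κ) * x)) atTop (nhds 0) :=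
        Real.tendsto_exp_atBot.comp (tendsto_id.const_mul_atTop_of_neg (by linarith))
      have := (Complex.continuous_ofReal.tendsto 0).comp h0
      simpa [Function.comp_def] using this
    have h4 := he.mul (hj.2.mul ((Complex.continuous_conj.tendsto _).comp hj.1))
    rw [zero_mul] at h4
    have h5 := (Complex.continuous_im.tendsto _).comp h4
    rw [Complex.zero_im] at h5
    refine h5.congr fun x => ?_
    simp only [Function.comp_apply, hP]
    congr 1
    have e : ((Real.exp (-(2 * κ) * x) : ℝ) : ℂ) * (Complex.exp (-I * k * x) *
      (starRingEnd ℂ) (Complex.exp (-I * k * x))) = 1 := by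
      rw [← Complex.exp_conj, ← Complex.exp_add, Complex.ofReal_exp, ← Complex.exp_add,
        Complex.exp_eq_one_iff]
      refine ⟨0, ?_⟩
      simp [hk]
      linear_combination (-(2 * κ * x)) * I_sq
    simp only [map_mul]
    linear_combination (f' k x * (starRingEnd ℂ) (f k x)) * e
  have hpos : 0 ≤ P (X + 1) := hanti.le_of_tendsto hlim _
  have hP0 : P X ≤ P 0 := hanti (le_max_right _ _)
  obtain ⟨c, hc, hslope⟩ := exists_hasDerivAt_eq_slope P (fun x => -(2 * t * κ) * normSq (f k x))
    (show X < X + 1 by linarith) (fun x _ => (hPd x).continuousAt.continuousWithinAt) (fun x _ => hPd x)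
  have hcX : X ≤ c := hc.1.le
  have hc0 : 0 ≤ c := (le_max_right _ _).trans hcX
  have hm : 1 / 2 ≤ ‖mJ f k c‖ := by
    have a1 := hX0 c ((le_max_left _ _).trans hcX)
    have a2 := hC k (I * κ) hki hk0 hik hik0 c hc0
    have a3 : ‖k - I * κ‖ = t := by simp [hk, abs_of_pos ht]
    rw [a3] at a2
    have a4 : C * t ≤ 1 / 4 := by
      have : (4 * (C + 1)) * t < 1 := by
        rwa [lt_inv_comm₀ ht (by positivity), ← one_div, lt_div_iff₀ ht] at htδ
      nlinarith
    have a5 : (1 : ℂ) = mJ f k c - (mJ f k c - mJ f (I * κ) c) - (mJ f (I * κ) c - 1) := by ring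
    have a6 : (1 : ℝ) ≤ ‖mJ f k c‖ + ‖mJ f k c - mJ f (I * κ) c‖ + ‖mJ f (I * κ) c - 1‖ := by
      calc (1 : ℝ) = ‖(1 : ℂ)‖ := by simp
        _ = _ := congrArg norm a5
        _ ≤ ‖mJ f k c - (mJ f k c - mJ f (I * κ) c)‖ + ‖mJ f (I * κ) c - 1‖ := norm_sub_le _ _
        _ ≤ _ := by gcongr; exact norm_sub_le _ _
    linarith
  have hf : Real.exp (-κ * (X + 1)) / 2 ≤ ‖f k c‖ := by
    have e : ‖mJ f k c‖ = Real.exp (κ * c) * ‖f k c‖ := by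
      rw [mJ, norm_mul, Complex.norm_exp]
      congr 2
      simp [hkim]
    rw [e] at hm
    have : ‖f k c‖ = Real.exp (-κ * c) * (Real.exp (κ * c) * ‖f k c‖) := by
      rw [← mul_assoc, ← Real.exp_add]; simp
    rw [this]
    calc Real.exp (-κ * (X + 1)) / 2 ≤ Real.exp (-κ * c) / 2 := by
          gcongr ?_ / 2
          apply Real.exp_le_exp.2
          nlinarith [hc.2]
      _ = Real.exp (-κ * c) * (1 / 2) := by ring
      _ ≤ _ := by gcongr
  have hsl : P X = P (X + 1) + 2 * t * κ * normSq (f k c) := by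
    have : X + 1 - X = 1 := by ring
    rw [this, div_one] at hslope
    linarith
  have hn : (Real.exp (-κ * (X + 1)) / 2) ^ 2 ≤ normSq (f k c) := by
    rw [Complex.normSq_eq_norm_sq]; gcongr
  calc 2 * κ * (Real.exp (-κ * (X + 1)) / 2) ^ 2 * t = 2 * t * κ * (Real.exp (-κ * (X + 1)) / 2) ^ 2 := by ring
    _ ≤ 2 * t * κ * normSq (f k c) := by gcongr
    _ ≤ P 0 := by linarith

lemma wronskian_ineq {p p' q q' : ℂ} {c : ℝ} (hc : 0 < c) (hp : c ≤ (p' * (starRingEnd ℂ) p).im)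
    (hq : c ≤ -(q' * (starRingEnd ℂ) q).im) : 2 * c ≤ ‖p' * q - p * q'‖ := by
  have hp0 : p ≠ 0 := by rintro rfl; simp at hp; linarith
  have hq0 : q ≠ 0 := by rintro rfl; simp at hq; linarith
  have hpn : 0 < ‖p‖ := norm_pos_iff.2 hp0
  have hqn : 0 < ‖q‖ := norm_pos_iff.2 hq0
  have e : (p' * q - p * q') * ((starRingEnd ℂ) p * (starRingEnd ℂ) q) =
      ((normSq q : ℝ) : ℂ) * (p' * (starRingEnd ℂ) p) - ((normSq p : ℝ) : ℂ) * (q' * (starRingEnd ℂ) q) := by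
    rw [← Complex.mul_conj, ← Complex.mul_conj]; ring
  have e2 := congrArg Complex.im e
  rw [Complex.sub_im, Complex.im_ofReal_mul, Complex.im_ofReal_mul, Complex.normSq_eq_norm_sq,
    Complex.normSq_eq_norm_sq] at e2
  have h3 := Complex.im_le_norm ((p' * q - p * q') * ((starRingEnd ℂ) p * (starRingEnd ℂ) q))
  rw [e2, norm_mul, norm_mul, RCLike.norm_conj, RCLike.norm_conj] at h3
  have h4 : 2 * c * (‖p‖ * ‖q‖) ≤ ‖p' * q - p * q'‖ * (‖p‖ * ‖q‖) := by
    nlinarith [mul_le_mul_of_nonneg_left hp (sq_nonneg ‖q‖), mul_le_mul_of_nonneg_left hq (sq_nonneg ‖p‖),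
      mul_nonneg hc.le (sq_nonneg (‖p‖ - ‖q‖))]
  exact le_of_mul_le_mul_right h4 (by positivity)

lemma simple_zero {v : SchwartzMap ℝ ℝ} {f₁ f₁' f₁'' f₂ f₂' f₂'' : ℂ → ℝ → ℂ}
    (hd : ZFData v f₁ f₁' f₁'' f₂ f₂' f₂'') {W : ℂ → ℂ} (hW : DifferentiableOn ℂ W {z : ℂ | 0 ≤ z.im})
    (hWe : ∀ k : ℂ, 0 ≤ k.im → k ≠ 0 → W k = f₁' k 0 * f₂ k 0 - f₁ k 0 * f₂' k 0)
    {κ : ℝ} (hκ : 0 < κ) (hz : W (I * κ) = 0) : deriv W (I * κ) ≠ 0 := by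
  obtain ⟨A, hA, hv⟩ := schwartz_decay_zf v 8
  obtain ⟨C1, hC10, hC1, _⟩ := jost_half hd.h1 hd.hj1 (A := A)
    (fun x hx => by simpa [abs_of_nonneg hx] using hv x)
  have hr1 : ∀ k : ℂ, 0 ≤ k.im → k ≠ 0 → IsSchrodingerSolution (fun x => v (-x)) k
    ((fun k x => f₂ k (-x)) k) ((fun k x => -f₂' k (-x)) k) ((fun k x => f₂'' k (-x)) k) :=
    fun k hk hk0 => refl_sol (hd.h2 k hk hk0)
  have hr2 : ∀ k : ℂ, 0 ≤ k.im → k ≠ 0 → IsJostAtPlusInfinity k ((fun k x => f₂ k (-x)) k)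
    ((fun k x => -f₂' k (-x)) k) := fun k hk hk0 => refl_jost (hd.hj2 k hk hk0)
  obtain ⟨C2, hC20, hC2, _⟩ := jost_half hr1 hr2 (A := A)
    (fun x hx => by simpa [abs_of_nonneg hx] using hv (-x))
  obtain ⟨c1, hc1, δ1, hδ1, hl1⟩ := flux_lower hd.h1 hd.hj1 hC10 hC1 hκ
  obtain ⟨c2, hc2, δ2, hδ2, hl2⟩ := flux_lower hr1 hr2 hC20 hC2 hκ
  intro hd0
  have hdiff : HasDerivAt W 0 (I * κ) := by
    rw [← hd0]
    refine (hW.differentiableAt ?_).hasDerivAt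
    refine mem_of_superset ((isOpen_lt continuous_const Complex.continuous_im).mem_nhds
      (show (0 : ℝ) < (I * (κ : ℂ)).im by simpa using hκ)) fun z (hz : 0 < z.im) => hz.le
  have h3 := hdiff.isLittleO
  have hcpos : 0 < min c1 c2 := lt_min hc1 hc2
  have h4 := (h3.def hcpos)
  have ht : Tendsto (fun t : ℝ => I * κ + (t : ℂ)) (nhdsWithin 0 (Ioi 0)) (nhds (I * κ)) := by
    have : Continuous fun t : ℝ => I * κ + (t : ℂ) := by fun_prop
    have := this.tendsto 0
    simp only [Complex.ofReal_zero, add_zero] at this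
    exact this.mono_left nhdsWithin_le_nhds
  have h5 := (ht.eventually h4).and (Ioo_mem_nhdsGT (lt_min hδ1 hδ2))
  obtain ⟨t, h6, h7⟩ := h5.exists
  simp only [hz, sub_zero, smul_zero, add_sub_cancel_left, Complex.norm_real, Real.norm_eq_abs] at h6
  rw [abs_of_pos h7.1, hWe _ (by simp [hκ.le]) (fun h => by
    have := congrArg Complex.im h; simp at this; linarith)] at h6
  have b1 := hl1 t h7.1 (h7.2.trans_le (min_le_left _ _))
  have b2 := hl2 t h7.1 (h7.2.trans_le (min_le_right _ _))
  simp only [neg_zero, neg_mul, Complex.neg_im] at b2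
  have := wronskian_ineq (c := min c1 c2 * t) (mul_pos hcpos h7.1)
    ((mul_le_mul_of_nonneg_right (min_le_left _ _) h7.1.le).trans b1)
    ((mul_le_mul_of_nonneg_right (min_le_right _ _) h7.1.le).trans b2)
  have : 0 < min c1 c2 * t := mul_pos hcpos h7.1
  linarith


/-- integral of `e^{i m y}` over `[0,π]` for even integers `m`. -/
lemma integral_cexp_even (m : ℤ) (hm : m ≠ 0) :
    ∫ y in (0:ℝ)..π, Complex.exp ((2 * m : ℂ) * I * y) = 0 := by
  rw [integral_exp_mul_complex (by simp [hm])]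
  have : Complex.exp ((2 * m : ℂ) * I * (π : ℝ)) = 1 := by
    rw [Complex.exp_eq_one_iff]
    exact ⟨m, by ring⟩
  rw [this]; simp

lemma contour_core {h : ℂ → ℂ} {l : ℕ} {c : ℕ → ℂ} {C r C₂ r₂ : ℝ}
    (hc : ContinuousOn h {z | 0 ≤ z.im ∧ z.im ≤ π})
    (hd : DifferentiableOn ℂ h {z | 0 < z.im ∧ z.im < π})
    (hceven : ∀ n, c (2 * n) = 0)
    (hA : ∀ z : ℂ, 0 ≤ z.im → z.im ≤ π → r ≤ z.re →
      ‖h z + ∑ n ∈ Finset.range (2 * l + 2), c n * Complex.exp (-(n * z))‖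
        ≤ C * Real.exp (-((2 * l + 2) * z.re)))
    (hB : ∀ z : ℂ, 0 ≤ z.im → z.im ≤ π → z.re ≤ r₂ → |(h z).re| ≤ C₂ + |z.re|) :
    Tendsto (fun T : ℝ => ∫ t in (-T)..T, (Real.exp ((2 * l + 1) * t) -
      Real.exp (-(2 * l + 1) * (2 * T + t))) * ((h t).re + (h (t + π * I)).re)) atTop
      (nhds ((I * π * c (2 * l + 1)).re)) := by
  set p : ℝ := 2 * l + 1 with hp
  have hp1 : 1 ≤ p := by rw [hp]; have : (0:ℝ) ≤ l := by positivity
                         linarith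
  have hC : 0 ≤ C := by
    have := (norm_nonneg _).trans (hA (r : ℂ) (by simp) (by simp [pi_pos.le]) (by simp))
    exact nonneg_of_mul_nonneg_left this (Real.exp_pos _)
  have hC2 : 0 ≤ C₂ + |r₂| := (abs_nonneg _).trans (by simpa using hB (r₂ : ℂ) (by simp) (by simp [pi_pos.le]) (by simp))
  set K : ℝ → ℂ → ℂ := fun T z => Complex.exp (p * z) - Complex.exp (-p * (2 * T + z)) with hK
  have hKd : ∀ T, Differentiable ℂ (K T) := fun T => by simp only [hK]; fun_prop
  have hKc : ∀ T, Continuous (K T) := fun T => (hKd T).continuous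
  -- vertical integrals
  set Rt : ℝ → ℂ := fun T => ∫ y in (0:ℝ)..π, K T (T + y * I) * h (T + y * I) with hRt
  set Lt : ℝ → ℂ := fun T => ∫ y in (0:ℝ)..π, K T ((-T : ℝ) + y * I) * h ((-T : ℝ) + y * I) with hLt
  have hstrip : ∀ x y : ℝ, ((x:ℂ) + y * I).re = x ∧ ((x:ℂ) + y * I).im = y := fun x y => by simp
  have hvc : ∀ x : ℝ, ContinuousOn (fun y : ℝ => h (x + y * I)) (Icc 0 π) := fun x =>
    hc.comp (by fun_prop) (fun y hy => by simpa using hy)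
  have hhc : ∀ y : ℝ, 0 ≤ y → y ≤ π → Continuous (fun x : ℝ => h (x + y * I)) := fun y h0 h1 =>
    hc.comp_continuous (by fun_prop) (fun x => by simp [h0, h1])
  have hexpp : Complex.exp (p * (π * I)) = -1 := by
    have : (p : ℂ) * (π * I) = π * I + l * (2 * π * I) := by rw [hp]; push_cast; ring
    rw [this, Complex.exp_add, Complex.exp_nat_mul_two_pi_mul_I, Complex.exp_pi_mul_I]; simp
  have hexpm : Complex.exp (-p * (π * I)) = -1 := by
    rw [neg_mul, Complex.exp_neg, hexpp]; norm_num
  have hKb : ∀ T t : ℝ, K T t = ((Real.exp (p * t) - Real.exp (-p * (2 * T + t)) : ℝ) : ℂ) := fun T t => by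
    simp [hK]
  have hKt : ∀ T t : ℝ, K T (t + π * I) = -((Real.exp (p * t) - Real.exp (-p * (2 * T + t)) : ℝ) : ℂ) := fun T t => by
    simp only [hK]
    rw [show (p:ℂ) * (t + π * I) = p * t + p * (π * I) by ring,
      show -(p:ℂ) * (2 * T + (t + π * I)) = -p * (2 * T + t) + -p * (π * I) by ring,
      Complex.exp_add, Complex.exp_add, hexpp, hexpm]
    push_cast; ring
  have main : ∀ T : ℝ, 0 < T → ∫ t in (-T)..T, (Real.exp (p * t) -
      Real.exp (-p * (2 * T + t))) * ((h t).re + (h (t + π * I)).re) = (I * Lt T).re - (I * Rt T).re := by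
    intro T hT
    have := Complex.integral_boundary_rect_eq_zero_of_continuousOn_of_differentiableOn
      (fun z => K T z * h z) ((-T : ℝ) : ℂ) (T + π * I)
      ((hKc T).continuousOn.mul (hc.mono fun z hz => by
        have h2 := hz.2
        simp [uIcc_of_le pi_pos.le] at h2
        exact h2))
      ((hKd T).differentiableOn.mul (hd.mono fun z hz => by
        have h2 := hz.2
        simp [pi_pos.le] at h2
        exact h2))
    simp only [(hstrip T π).1, (hstrip T π).2, Complex.ofReal_re, Complex.ofReal_im] at this
    simp only [Complex.ofReal_zero, zero_mul, add_zero, hKb, hKt, smul_eq_mul] at this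
    have h0c : Continuous (fun t : ℝ => h t) := by simpa using hhc 0 le_rfl pi_pos.le
    have h1c := hhc π pi_pos.le le_rfl
    have e1 : ∀ g : ℝ → ℂ, Continuous g → (∫ t in (-T)..T, ((Real.exp (p * t) - Real.exp (-p * (2 * T + t)) : ℝ) : ℂ) * g t).re
        = ∫ t in (-T)..T, (Real.exp (p * t) - Real.exp (-p * (2 * T + t))) * (g t).re := by
      intro g hg
      have := intervalIntegral.intervalIntegral_re (a := -T) (b := T) (μ := volume) (𝕜 := ℂ) (f := fun t : ℝ => ((Real.exp (p * t) - Real.exp (-p * (2 * T + t)) : ℝ) : ℂ) * g t)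
        (by apply Continuous.intervalIntegrable; fun_prop)
      simp only [RCLike.re_eq_complex_re] at this
      rw [← this]
      refine intervalIntegral.integral_congr fun t _ => ?_
      simp only [Complex.re_ofReal_mul]
    have e2 := congrArg Complex.re this
    simp only [neg_mul, intervalIntegral.integral_neg, Complex.sub_re, Complex.add_re, Complex.neg_re] at e2
    simp only [← neg_mul] at e2
    rw [e1 _ h0c, e1 _ h1c] at e2
    have h0r : Continuous (fun t : ℝ => (h t).re) := Complex.continuous_re.comp h0c
    have h1r : Continuous (fun t : ℝ => (h (t + π * I)).re) := Complex.continuous_re.comp h1c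
    simp only [mul_add (Real.exp _ - Real.exp _)]
    rw [intervalIntegral.integral_add (by apply Continuous.intervalIntegrable; fun_prop)
      (by apply Continuous.intervalIntegrable; fun_prop)]
    simp only [Complex.zero_re] at e2
    simp only [hRt, hLt]
    linarith
  have hleft : Tendsto (fun T : ℝ => (I * Lt T).re) atTop (nhds 0) := by
    have hKL : ∀ T y : ℝ, K T ((-T : ℝ) + y * I) = ((2 * Real.exp (-p * T) * Real.sin (p * y) : ℝ) : ℂ) * I := by
      intro T y
      simp only [hK]
      rw [show (p:ℂ) * (((-T : ℝ) : ℂ) + y * I) = ((-p * T : ℝ) : ℂ) + ((p * y : ℝ) : ℂ) * I by push_cast; ring,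
        show -(p:ℂ) * (2 * T + (((-T : ℝ) : ℂ) + y * I)) = ((-p * T : ℝ) : ℂ) + (-(p * y : ℝ) : ℂ) * I by push_cast; ring,
        Complex.exp_add, Complex.exp_add, Complex.exp_mul_I, Complex.exp_mul_I, Complex.cos_neg, Complex.sin_neg]
      push_cast; ring
    have hre : ∀ T : ℝ, (I * Lt T).re = ∫ y in (0:ℝ)..π, -(2 * Real.exp (-p * T) * Real.sin (p * y)) * (h ((-T : ℝ) + y * I)).re := by
      intro T
      rw [hLt, ← intervalIntegral.integral_const_mul]
      have := intervalIntegral.intervalIntegral_re (a := 0) (b := π) (μ := volume) (𝕜 := ℂ)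
        (f := fun y : ℝ => I * (K T ((-T : ℝ) + y * I) * h ((-T : ℝ) + y * I)))
        (by
          apply ContinuousOn.intervalIntegrable
          rw [uIcc_of_le pi_pos.le]
          refine continuousOn_const.mul (ContinuousOn.mul ?_ (hvc (-T)))
          exact ((hKc T).comp (by fun_prop)).continuousOn)
      simp only [RCLike.re_eq_complex_re] at this
      rw [← this]
      refine intervalIntegral.integral_congr fun y _ => ?_
      simp only [hKL]
      rw [show I * (((2 * Real.exp (-p * T) * Real.sin (p * y) : ℝ) : ℂ) * I * h ((-T : ℝ) + y * I)) =
        ((-(2 * Real.exp (-p * T) * Real.sin (p * y)) : ℝ) : ℂ) * h ((-T : ℝ) + y * I) by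
          push_cast; linear_combination (2 * Complex.exp (-p * T) * Complex.sin (p * y) * h (-T + y * I)) * I_sq]
      rw [Complex.re_ofReal_mul]
    have hbd : ∀ T : ℝ, 0 ≤ T → -r₂ ≤ T → ‖(I * Lt T).re‖ ≤ 2 * π * ((C₂ + T) * Real.exp (-T)) := by
      intro T h0 h2
      rw [hre]
      have := intervalIntegral.norm_integral_le_of_norm_le_const (a := 0) (b := π) (C := 2 * Real.exp (-T) * (C₂ + T))
        (f := fun y : ℝ => -(2 * Real.exp (-p * T) * Real.sin (p * y)) * (h ((-T : ℝ) + y * I)).re) (by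
          intro y hy
          rw [uIoc_of_le pi_pos.le] at hy
          have hb := hB ((-T : ℝ) + y * I) (by simpa using hy.1.le) (by simpa using hy.2) (by simp; linarith)
          rw [(hstrip (-T) y).1, abs_neg, abs_of_nonneg h0] at hb
          rw [norm_mul, norm_neg, Real.norm_eq_abs, Real.norm_eq_abs, abs_mul, abs_of_pos (by positivity)]
          have hs := Real.abs_sin_le_one (p * y)
          have he : Real.exp (-p * T) ≤ Real.exp (-T) := Real.exp_le_exp.2 (by nlinarith)
          calc 2 * Real.exp (-p * T) * |Real.sin (p * y)| * |(h ((-T : ℝ) + y * I)).re|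
              ≤ 2 * Real.exp (-T) * 1 * (C₂ + T) := by gcongr
            _ = _ := by ring)
      rw [sub_zero, abs_of_pos pi_pos] at this
      linarith
    have hlim : Tendsto (fun T : ℝ => 2 * π * ((C₂ + T) * Real.exp (-T))) atTop (nhds 0) := by
      have h1 : Tendsto (fun T : ℝ => T * Real.exp (-T)) atTop (nhds 0) := by
        simpa using Real.tendsto_pow_mul_exp_neg_atTop_nhds_zero 1
      have h2 : Tendsto (fun T : ℝ => Real.exp (-T)) atTop (nhds 0) := by
        simpa using Real.tendsto_pow_mul_exp_neg_atTop_nhds_zero 0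
      have := ((h2.const_mul C₂).add h1).const_mul (2 * π)
      simpa [add_mul] using this
    refine squeeze_zero_norm' ?_ hlim
    filter_upwards [eventually_ge_atTop 0, eventually_ge_atTop (-r₂)] with T h0 h2 using hbd T h0 h2
  have hright : Tendsto (fun T : ℝ => Rt T) atTop (nhds (-(π * c (2 * l + 1)))) := by
    set S : ℂ → ℂ := fun z => ∑ n ∈ Finset.range (2 * l + 2), c n * Complex.exp (-(n * z)) with hS
    set D : ℝ := C + ∑ n ∈ Finset.range (2 * l + 2), ‖c n‖ with hD
    have hSint : ∀ T : ℝ, ∫ y in (0:ℝ)..π, Complex.exp (p * (T + y * I)) * S (T + y * I) = π * c (2 * l + 1) := by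
      intro T
      simp only [hS, Finset.mul_sum]
      rw [intervalIntegral.integral_finsetSum (fun n _ => by apply Continuous.intervalIntegrable; fun_prop)]
      rw [Finset.sum_eq_single (2 * l + 1)]
      · have : ∀ y : ℝ, Complex.exp (p * (T + y * I)) * (c (2 * l + 1) * Complex.exp (-((2 * l + 1 : ℕ) * (T + y * I)))) = c (2 * l + 1) := by
          intro y
          rw [mul_left_comm, ← Complex.exp_add, hp]
          push_cast
          rw [add_neg_cancel, Complex.exp_zero, mul_one]
        simp only [this]
        simp
      · intro n hn hne
        rcases Nat.even_or_odd' n with ⟨m, rfl | rfl⟩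
        · simp [hceven]
        · have : ∀ y : ℝ, Complex.exp (p * (T + y * I)) * (c (2 * m + 1) * Complex.exp (-((2 * m + 1 : ℕ) * (T + y * I)))) =
              c (2 * m + 1) * Complex.exp ((2 * l - 2 * m) * T) * Complex.exp ((2 * ((l - m : ℤ) : ℂ)) * I * y) := by
            intro y
            rw [mul_left_comm, ← Complex.exp_add, mul_assoc, ← Complex.exp_add, hp]
            congr 2
            push_cast
            ring
          simp only [this]
          rw [intervalIntegral.integral_const_mul, integral_cexp_even _ (by omega), mul_zero]
      · intro hn; simp at hn
    have hbd : ∀ T : ℝ, 0 ≤ T → r ≤ T → ‖Rt T - (-(π * c (2 * l + 1)))‖ ≤ (C + D) * π * Real.exp (-T) := by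
      intro T h0 hr
      have e1 : Rt T - (-(π * c (2 * l + 1))) = ∫ y in (0:ℝ)..π, (K T (T + y * I) * h (T + y * I) +
          Complex.exp (p * (T + y * I)) * S (T + y * I)) := by
        rw [intervalIntegral.integral_add, hSint]
        · simp only [hRt]; ring
        · apply ContinuousOn.intervalIntegrable
          rw [uIcc_of_le pi_pos.le]
          exact ContinuousOn.mul ((hKc T).comp (by fun_prop)).continuousOn (hvc T)
        · apply Continuous.intervalIntegrable
          simp only [hS]
          fun_prop
      rw [e1]
      have := intervalIntegral.norm_integral_le_of_norm_le_const (a := 0) (b := π) (C := (C + D) * Real.exp (-T))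
        (f := fun y : ℝ => K T (T + y * I) * h (T + y * I) + Complex.exp (p * (T + y * I)) * S (T + y * I)) (by
          intro y hy
          rw [uIoc_of_le pi_pos.le] at hy
          have ha := hA (T + y * I) (by simpa using hy.1.le) (by simpa using hy.2) (by simpa using hr)
          rw [(hstrip T y).1] at ha
          have hSb : ‖S (T + y * I)‖ ≤ ∑ n ∈ Finset.range (2 * l + 2), ‖c n‖ := by
            refine norm_sum_le_of_le _ fun n _ => ?_
            rw [norm_mul, Complex.norm_exp]
            refine mul_le_of_le_one_right (norm_nonneg _) (Real.exp_le_one_iff.2 ?_)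
            simp; positivity
          have hhb : ‖h (T + y * I)‖ ≤ D := by
            have e : h (T + y * I) = (h (T + y * I) + S (T + y * I)) - S (T + y * I) := by ring
            rw [e]
            refine (norm_sub_le _ _).trans (add_le_add (ha.trans (mul_le_of_le_one_right hC (Real.exp_le_one_iff.2 ?_))) hSb)
            have : (0:ℝ) ≤ (2 * l + 2) * T := by positivity
            linarith
          have e2 : K T (T + y * I) * h (T + y * I) + Complex.exp (p * (T + y * I)) * S (T + y * I) =
            Complex.exp (p * (T + y * I)) * (h (T + y * I) + S (T + y * I)) -
              Complex.exp (-p * (2 * T + (T + y * I))) * h (T + y * I) := by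
            simp only [hK]; ring
          rw [e2]
          have n1 : ‖Complex.exp (p * (T + y * I))‖ = Real.exp (p * T) := by
            rw [Complex.norm_exp]; simp
          have n2 : ‖Complex.exp (-p * (2 * T + (T + y * I)))‖ = Real.exp (-p * (3 * T)) := by
            rw [Complex.norm_exp]; congr 1; simp; left; ring
          have n3 : Real.exp (-p * (3 * T)) ≤ Real.exp (-T) := Real.exp_le_exp.2 (by nlinarith)
          have n4 : Real.exp (p * T) * Real.exp (-((2 * l + 2) * T)) = Real.exp (-T) := by
            rw [← Real.exp_add, hp]; congr 1; ring
          refine (norm_sub_le _ _).trans ?_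
          rw [norm_mul, norm_mul, n1, n2, add_mul C D]
          refine add_le_add ?_ ?_
          · calc _ ≤ Real.exp (p * T) * (C * Real.exp (-((2 * l + 2) * T))) := by gcongr
              _ = C * (Real.exp (p * T) * Real.exp (-((2 * l + 2) * T))) := by ring
              _ = _ := by rw [n4]
          · rw [mul_comm D]; gcongr)
      rw [sub_zero, abs_of_pos pi_pos] at this
      linarith
    rw [tendsto_iff_norm_sub_tendsto_zero]
    have hlim : Tendsto (fun T : ℝ => (C + D) * π * Real.exp (-T)) atTop (nhds 0) := by
      have h2 : Tendsto (fun T : ℝ => Real.exp (-T)) atTop (nhds 0) := by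
        simpa using Real.tendsto_pow_mul_exp_neg_atTop_nhds_zero 0
      simpa using h2.const_mul ((C + D) * π)
    refine squeeze_zero' (Eventually.of_forall fun _ => norm_nonneg _) ?_ hlim
    filter_upwards [eventually_ge_atTop 0, eventually_ge_atTop r] with T h0 h2 using hbd T h0 h2
  have hr2 := (Complex.continuous_re.tendsto _).comp (hright.const_mul I)
  have := hleft.sub hr2
  have e : (0:ℝ) - (I * -(π * c (2 * l + 1))).re = (I * π * c (2 * l + 1)).re := by
    rw [mul_neg, Complex.neg_re, ← mul_assoc]; ring
  rw [e] at this
  refine this.congr' ?_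
  filter_upwards [eventually_gt_atTop 0] with T hT
  rw [main T hT]
  rfl


lemma exp_strip_im {z : ℂ} (h0 : 0 ≤ z.im) (h1 : z.im ≤ π) : 0 ≤ (Complex.exp z).im := by
  rw [Complex.exp_im]
  exact mul_nonneg (Real.exp_pos _).le (Real.sin_nonneg_of_nonneg_of_le_pi h0 h1)

lemma exp_strip_im_pos {z : ℂ} (h0 : 0 < z.im) (h1 : z.im < π) : 0 < (Complex.exp z).im := by
  rw [Complex.exp_im]
  exact mul_pos (Real.exp_pos _) (Real.sin_pos_of_pos_of_lt_pi h0 h1)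

lemma log_strip {Q : ℂ → ℂ} (hQc : ContinuousOn Q {k | 0 ≤ k.im ∧ k ≠ 0})
    (hQd : DifferentiableOn ℂ Q {k | 0 < k.im}) (hQ0 : ∀ k : ℂ, 0 ≤ k.im → k ≠ 0 → Q k ≠ 0) :
    ∃ h : ℂ → ℂ, ContinuousOn h {z | 0 ≤ z.im ∧ z.im ≤ π} ∧
      DifferentiableOn ℂ h {z | 0 < z.im ∧ z.im < π} ∧
      ∀ z : ℂ, 0 ≤ z.im → z.im ≤ π → Complex.exp (h z) = Q (Complex.exp z) := by
  set cl : ℂ → ℂ := fun z => (z.re : ℂ) + ((max 0 (min z.im π) : ℝ) : ℂ) * I with hcl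
  have hclc : Continuous cl := by simp only [hcl]; fun_prop
  have hcl0 : ∀ z, 0 ≤ (cl z).im := fun z => by simp [hcl]
  have hcl1 : ∀ z, (cl z).im ≤ π := fun z => by simp [hcl, pi_pos.le]
  have hcle : ∀ z : ℂ, 0 ≤ z.im → z.im ≤ π → cl z = z := fun z h0 h1 => by
    simp [hcl, h0, h1]
  have hg : Continuous (fun z => Q (Complex.exp (cl z))) :=
    hQc.comp_continuous (by fun_prop) (fun z => ⟨exp_strip_im (hcl0 z) (hcl1 z), Complex.exp_ne_zero _⟩)
  have hg0 : ∀ z, Q (Complex.exp (cl z)) ≠ 0 := fun z =>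
    hQ0 _ (exp_strip_im (hcl0 z) (hcl1 z)) (Complex.exp_ne_zero _)
  have hsc : IsSimplyConnected (univ : Set ℂ) := by
    have : ContractibleSpace (univ : Set ℂ) :=
      convex_univ.contractibleSpace univ_nonempty
    exact (inferInstance : SimplyConnectedSpace (univ : Set ℂ))
  obtain ⟨h, hh, he⟩ := Complex.exists_continuousOn_eqOn_exp_comp hsc isOpen_univ hg.continuousOn
    (by rintro ⟨z, -, hz⟩; exact hg0 z hz)
  have hh' : Continuous h := by simpa using hh
  have he' : ∀ z, Complex.exp (h z) = Q (Complex.exp (cl z)) := fun z => he (mem_univ z)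
  have he2 : ∀ z : ℂ, 0 ≤ z.im → z.im ≤ π → Complex.exp (h z) = Q (Complex.exp z) := fun z h0 h1 => by
    rw [he', hcle z h0 h1]
  refine ⟨h, hh'.continuousOn, ?_, he2⟩
  intro z hz
  apply DifferentiableAt.differentiableWithinAt
  have hd1 : DifferentiableAt ℂ (fun w => Q (Complex.exp w)) z := by
    have : DifferentiableAt ℂ Q (Complex.exp z) := hQd.differentiableAt
      ((isOpen_lt continuous_const Complex.continuous_im).mem_nhds (exp_strip_im_pos hz.1 hz.2))
    exact this.comp z Complex.differentiable_exp.differentiableAt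
  have hQz : Q (Complex.exp z) ≠ 0 := by rw [← he2 z hz.1.le hz.2.le]; exact Complex.exp_ne_zero _
  have hd2 : DifferentiableAt ℂ (fun w => h z + Complex.log (Q (Complex.exp w) / Q (Complex.exp z))) z := by
    refine (differentiableAt_const _).add (DifferentiableAt.clog (hd1.div_const _) ?_)
    rw [div_self hQz]; exact Complex.one_mem_slitPlane
  refine hd2.congr_of_eventuallyEq ?_
  have hopen : ∀ᶠ w in nhds z, 0 < w.im ∧ w.im < π :=
    ((isOpen_lt continuous_const Complex.continuous_im).inter
      (isOpen_lt Complex.continuous_im continuous_const)).mem_nhds hz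
  have hball : ∀ᶠ w in nhds z, ‖h w - h z‖ < 1 := by
    have : Tendsto (fun w => ‖h w - h z‖) (nhds z) (nhds 0) := by
      have := (hh'.sub (continuous_const (y := h z))).norm.tendsto z
      simpa using this
    exact this.eventually_lt_const one_pos
  filter_upwards [hopen, hball] with w hw hb
  rw [← he2 w hw.1.le hw.2.le, ← he2 z hz.1.le hz.2.le, ← Complex.exp_sub]
  have him := (Complex.abs_im_le_norm (h w - h z)).trans_lt hb
  have hpi := Real.pi_gt_three
  rw [abs_lt] at him
  rw [Complex.log_exp (by linarith) (by linarith)]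
  ring

/-- a logarithm with prescribed asymptotic behaviour -/
lemma log_strip_asympt {Q : ℂ → ℂ} (hQc : ContinuousOn Q {k | 0 ≤ k.im ∧ k ≠ 0})
    (hQd : DifferentiableOn ℂ Q {k | 0 < k.im}) (hQ0 : ∀ k : ℂ, 0 ≤ k.im → k ≠ 0 → Q k ≠ 0)
    {l : ℕ} {c : ℕ → ℂ} {C R : ℝ} (hR : 1 ≤ R)
    (hA : ∀ k : ℂ, 0 ≤ k.im → R ≤ ‖k‖ →
      ‖Q k * Complex.exp (∑ n ∈ Finset.range (2 * l + 2), c n * k⁻¹ ^ n) - 1‖ ≤ C * ‖k‖⁻¹ ^ (2 * l + 2)) :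
    ∃ h : ℂ → ℂ, ∃ r C' : ℝ, ContinuousOn h {z | 0 ≤ z.im ∧ z.im ≤ π} ∧
      DifferentiableOn ℂ h {z | 0 < z.im ∧ z.im < π} ∧
      (∀ z : ℂ, 0 ≤ z.im → z.im ≤ π → Complex.exp (h z) = Q (Complex.exp z)) ∧
      ∀ z : ℂ, 0 ≤ z.im → z.im ≤ π → r ≤ z.re →
      ‖h z + ∑ n ∈ Finset.range (2 * l + 2), c n * Complex.exp (-(n * z))‖
        ≤ C' * Real.exp (-((2 * l + 2) * z.re)) := by
  obtain ⟨h, hc, hd, he⟩ := log_strip hQc hQd hQ0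
  set S : ℂ → ℂ := fun z => ∑ n ∈ Finset.range (2 * l + 2), c n * Complex.exp (-(n * z)) with hS
  set ε : ℂ → ℂ := fun z => Complex.exp (h z + S z) - 1 with hε
  have hε1 : ∀ z : ℂ, 0 ≤ z.im → z.im ≤ π → R ≤ Real.exp z.re → ‖ε z‖ ≤ C * Real.exp (-((2 * l + 2) * z.re)) := by
    intro z h0 h1 hr
    have := hA (Complex.exp z) (exp_strip_im h0 h1) (by rwa [Complex.norm_exp])
    rw [Complex.norm_exp, ← Real.exp_neg, ← Real.exp_nat_mul] at this
    simp only [← Complex.exp_neg, ← Complex.exp_nat_mul] at this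
    rw [← he z h0 h1, ← Complex.exp_add] at this
    simp only [hε, hS]
    convert this using 3
    · simp
    · push_cast; ring_nf
  have hC : 0 ≤ C := by
    have := (norm_nonneg _).trans (hε1 (Real.log R : ℂ) (by simp) (by simp [pi_pos.le])
      (by simp [Real.exp_log (by linarith : 0 < R)]))
    exact nonneg_of_mul_nonneg_left this (Real.exp_pos _)
  set r := max (Real.log R) (2 * C) with hr
  have hr0 : 0 ≤ r := le_max_of_le_left (Real.log_nonneg hR)
  have hε2 : ∀ z : ℂ, 0 ≤ z.im → z.im ≤ π → r ≤ z.re → ‖ε z‖ ≤ C * Real.exp (-((2 * l + 2) * z.re)) ∧ ‖ε z‖ ≤ 1 / 2 := by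
    intro z h0 h1 hz
    have hRz : R ≤ Real.exp z.re := by
      rw [← Real.log_le_iff_le_exp (by linarith)]; exact (le_max_left _ _).trans hz
    refine ⟨hε1 z h0 h1 hRz, (hε1 z h0 h1 hRz).trans ?_⟩
    have h2C : 2 * C ≤ z.re := (le_max_right _ _).trans hz
    have h3 : Real.exp (-((2 * l + 2) * z.re)) ≤ Real.exp (-z.re) := by
      apply Real.exp_le_exp.2
      have : (0:ℝ) ≤ (2 * l + 1) * z.re := by have := hr0.trans hz; positivity
      linarith
    have h4 : 2 * C ≤ Real.exp z.re := by linarith [Real.add_one_le_exp z.re]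
    have h5 : Real.exp z.re * Real.exp (-z.re) = 1 := by rw [← Real.exp_add]; simp
    have h6 := Real.exp_pos (-z.re)
    nlinarith
  set D : Set ℂ := {z | (0 ≤ z.im ∧ z.im ≤ π) ∧ r ≤ z.re} with hD
  have hDc : IsPreconnected D := by
    have h1 : Convex ℝ D := by
      have h2 : D = Complex.reLm ⁻¹' (Ici r) ∩ Complex.imLm ⁻¹' (Icc 0 π) := by
        ext z; simp [hD]; tauto
      rw [h2]
      exact ((convex_Ici (𝕜 := ℝ) r).linear_preimage _).inter ((convex_Icc (𝕜 := ℝ) 0 π).linear_preimage _)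
    exact h1.isPreconnected
  set u : ℂ → ℂ := fun z => h z + S z - Complex.log (1 + ε z) with hu
  have hScont : Continuous S := by simp only [hS]; fun_prop
  have hsl : ∀ z ∈ D, 1 + ε z ∈ slitPlane := fun z hz =>
    Complex.mem_slitPlane_of_norm_lt_one (by linarith [(hε2 z hz.1.1 hz.1.2 hz.2).2])
  have hcD : ContinuousOn h D := hc.mono fun z hz => hz.1
  have hucont : ContinuousOn u D := by
    refine (hcD.add hScont.continuousOn).sub (ContinuousOn.clog ?_ hsl)
    refine continuousOn_const.add (ContinuousOn.sub ?_ continuousOn_const)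
    exact (hcD.add hScont.continuousOn).cexp
  have hu1 : ∀ z ∈ D, ∃ n : ℤ, u z = n * (2 * π * I) := by
    intro z hz
    rw [← Complex.exp_eq_one_iff]
    simp only [hu]
    rw [Complex.exp_sub, Complex.exp_log (Complex.slitPlane_ne_zero (hsl z hz))]
    simp only [hε]
    rw [add_sub_cancel, div_self (Complex.exp_ne_zero _)]
  have hsub : (u '' D).Subsingleton := by
    have hcount : (range fun n : ℤ => (n * (2 * π * I) : ℂ)).Countable := countable_range _
    refine hcount.isTotallyDisconnected _ ?_ (hDc.image u hucont)
    rintro _ ⟨z, hz, rfl⟩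
    obtain ⟨n, hn⟩ := hu1 z hz
    exact ⟨n, hn.symm⟩
  have hrD : (r : ℂ) ∈ D := by simp [hD, pi_pos.le]
  obtain ⟨n, hn⟩ := hu1 r hrD
  have hconst : ∀ z ∈ D, u z = n * (2 * π * I) := fun z hz => by
    rw [← hn]; exact hsub (mem_image_of_mem u hz) (mem_image_of_mem u hrD)
  refine ⟨fun z => h z - n * (2 * π * I), r, 3 / 2 * C, hc.sub continuousOn_const, hd.sub (differentiableOn_const _), ?_, ?_⟩
  · intro z h0 h1
    rw [Complex.exp_sub, Complex.exp_int_mul_two_pi_mul_I, div_one, he z h0 h1]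
  · intro z h0 h1 hz
    have e1 := hconst z ⟨⟨h0, h1⟩, hz⟩
    have e2 := hε2 z h0 h1 hz
    have e3 : h z - n * (2 * π * I) + S z = Complex.log (1 + ε z) := by
      rw [← e1]; simp only [hu]; ring
    change ‖h z - n * (2 * π * I) + S z‖ ≤ _
    rw [e3]
    have := Complex.norm_log_one_add_half_le_self e2.2
    linarith [e2.1]


lemma near_zero_bounds {Y : ℂ → ℂ} (hY : DifferentiableOn ℂ Y {z | 0 ≤ z.im})
    (hlow : ∀ t : ℝ, t ≠ 0 → 2 * |t| ≤ ‖Y t‖) :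
    ∃ ρ c C : ℝ, 0 < ρ ∧ 0 < c ∧ 0 < C ∧ ∀ k : ℂ, 0 ≤ k.im → ‖k‖ < ρ → c * ‖k‖ ≤ ‖Y k‖ ∧ ‖Y k‖ ≤ C := by
  have h0mem : (0:ℂ) ∈ {z : ℂ | 0 ≤ z.im} := by simp
  have hd := hY 0 h0mem
  have hcont := hd.continuousWithinAt.norm
  have hup : ∀ᶠ k in nhdsWithin 0 {z : ℂ | 0 ≤ z.im}, ‖Y k‖ < ‖Y 0‖ + 1 :=
    hcont.eventually_lt_const (by linarith)
  have hlo : ∃ c : ℝ, 0 < c ∧ ∀ᶠ k in nhdsWithin 0 {z : ℂ | 0 ≤ z.im}, c * ‖k‖ ≤ ‖Y k‖ := by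
    by_cases h0 : Y 0 = 0
    · refine ⟨1, one_pos, ?_⟩
      have hF := hd.hasDerivWithinAt
      set F := derivWithin Y {z : ℂ | 0 ≤ z.im} 0
      have hb := hF.isLittleO.def (show (0:ℝ) < 1 / 2 by norm_num)
      simp only [h0, sub_zero, smul_eq_mul] at hb
      have hF1 : 3 / 2 ≤ ‖F‖ := by
        rw [eventually_nhdsWithin_iff, Metric.eventually_nhds_iff] at hb
        obtain ⟨ε, hε, hb⟩ := hb
        have := hb (y := ((ε / 2 : ℝ) : ℂ)) (by
          rw [dist_zero_right, Complex.norm_real, Real.norm_eq_abs, abs_of_pos (by positivity)]; linarith) (by simp)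
        have h2 := hlow (ε / 2) (by positivity)
        set t := ε / 2 with ht
        have ht0 : 0 < t := by positivity
        rw [abs_of_pos ht0] at h2
        have hn : ‖(t : ℂ)‖ = t := by rw [Complex.norm_real, Real.norm_eq_abs, abs_of_pos ht0]
        have h3 : ‖Y t‖ ≤ ‖Y t - t * F‖ + ‖(t : ℂ) * F‖ := by
          have := norm_add_le (Y t - t * F) (t * F); simpa using this
        rw [norm_mul, hn] at h3
        rw [hn] at this
        have : t * (3 / 2) ≤ t * ‖F‖ := by linarith
        exact le_of_mul_le_mul_left this ht0
      filter_upwards [hb] with k hk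
      have h3 : ‖k * F‖ ≤ ‖Y k‖ + ‖Y k - k * F‖ := by
        have := norm_sub_le (Y k) (Y k - k * F); simpa using this
      rw [norm_mul] at h3
      nlinarith [norm_nonneg k]
    · have hpos : 0 < ‖Y 0‖ := norm_pos_iff.2 h0
      refine ⟨‖Y 0‖ / 2, by positivity, ?_⟩
      have h1 : ∀ᶠ k in nhdsWithin 0 {z : ℂ | 0 ≤ z.im}, ‖Y 0‖ / 2 < ‖Y k‖ :=
        hcont.eventually_const_lt (by linarith)
      have h2 : ∀ᶠ k : ℂ in nhdsWithin 0 {z : ℂ | 0 ≤ z.im}, ‖k‖ < 1 :=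
        (continuous_norm.continuousWithinAt (s := {z : ℂ | 0 ≤ z.im}) (x := (0:ℂ))).eventually_lt_const (by simp)
      filter_upwards [h1, h2] with k a b
      nlinarith
  obtain ⟨c, hc, hlo⟩ := hlo
  have := hlo.and hup
  rw [eventually_nhdsWithin_iff, Metric.eventually_nhds_iff] at this
  obtain ⟨ρ, hρ, h⟩ := this
  refine ⟨ρ, c, ‖Y 0‖ + 1, hρ, hc, by positivity, fun k hk hkρ => ?_⟩
  have := h (y := k) (by simpa using hkρ) hk
  exact ⟨this.1, this.2.le⟩

lemma factor_zeros {W : ℂ → ℂ} (hW : DifferentiableOn ℂ W {z | 0 ≤ z.im}) {N : ℕ} {κ : Fin N → ℝ}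
    (hκ : ∀ j, 0 < κ j) (hinj : Function.Injective κ) (hz : ∀ j, W (I * κ j) = 0) (s : Finset (Fin N)) :
    ∃ G : ℂ → ℂ, DifferentiableOn ℂ G {z | 0 ≤ z.im} ∧ ∀ k, W k = (∏ j ∈ s, (k - I * κ j)) * G k := by
  classical
  induction s using Finset.induction_on with
  | empty => exact ⟨W, hW, by simp⟩
  | insert i s hi ih =>
    obtain ⟨G, hG, hGe⟩ := ih
    have hnhds : {z : ℂ | 0 ≤ z.im} ∈ nhds (I * κ i) := by
      have hp : (0:ℝ) < (I * (κ i : ℂ)).im := by simp [hκ i]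
      have ho : {z : ℂ | 0 < z.im} ∈ nhds (I * (κ i : ℂ)) :=
        (isOpen_lt continuous_const Complex.continuous_im).mem_nhds hp
      exact mem_of_superset ho (fun z (hz : 0 < z.im) => hz.le)
    have hG0 : G (I * κ i) = 0 := by
      have := hGe (I * κ i)
      rw [hz i, eq_comm, mul_eq_zero] at this
      refine this.resolve_left (Finset.prod_ne_zero_iff.2 fun j hj => ?_)
      rw [← mul_sub]
      refine mul_ne_zero I_ne_zero (sub_ne_zero.2 ?_)
      intro h
      have := hinj (Complex.ofReal_injective h)
      exact hi (this ▸ hj)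
    refine ⟨dslope G (I * κ i), (Complex.differentiableOn_dslope hnhds).2 hG, fun k => ?_⟩
    have := sub_smul_dslope G (I * κ i) k
    rw [hG0, sub_zero, smul_eq_mul] at this
    rw [Finset.prod_insert hi, hGe k, ← this]
    ring

/-- coefficients for the Blaschke factor -/
noncomputable def blaschkeCoeff (n : ℕ) : ℂ := (-1) ^ (n + 1) * (1 - (-1) ^ n) / n

lemma blaschkeCoeff_even (n : ℕ) : blaschkeCoeff (2 * n) = 0 := by simp [blaschkeCoeff]

lemma blaschkeCoeff_odd (n : ℕ) : blaschkeCoeff (2 * n + 1) = 2 / (2 * n + 1) := by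
  simp [blaschkeCoeff, pow_succ]; norm_num

lemma blaschke_asympt {N : ℕ} (κ : Fin N → ℝ) (m : ℕ) :
    ∃ C R : ℝ, 0 ≤ C ∧ 1 ≤ R ∧ ∀ k : ℂ, R ≤ ‖k‖ →
      ‖(∏ j, (k + I * κ j) / (k - I * κ j)) *
        Complex.exp (-∑ n ∈ Finset.range (m + 1), blaschkeCoeff n * (∑ j, (I * κ j) ^ n) * k⁻¹ ^ n) - 1‖
        ≤ C * ‖k‖⁻¹ ^ (m + 1) := by
  set D : ℝ := ∑ j, 4 * |κ j| ^ (m + 1) with hD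
  have hD0 : 0 ≤ D := Finset.sum_nonneg fun j _ => by positivity
  set R : ℝ := 1 + ∑ j, 2 * |κ j| + D with hR
  have hs0 : 0 ≤ ∑ j, 2 * |κ j| := Finset.sum_nonneg fun j _ => by positivity
  refine ⟨2 * D, R, by positivity, by linarith, fun k hk => ?_⟩
  have hk1 : 1 ≤ ‖k‖ := by linarith
  have hkpos : 0 < ‖k‖ := by linarith
  have hk0 : k ≠ 0 := norm_pos_iff.1 hkpos
  set w : Fin N → ℂ := fun j => I * κ j * k⁻¹ with hw
  have hwn : ∀ j, ‖w j‖ = |κ j| * ‖k‖⁻¹ := fun j => by simp [hw]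
  have hw2 : ∀ j, ‖w j‖ ≤ 1 / 2 := fun j => by
    rw [hwn, ← div_eq_mul_inv, div_le_iff₀ hkpos]
    have := Finset.single_le_sum (f := fun j => 2 * |κ j|) (fun j _ => by positivity) (Finset.mem_univ j)
    linarith
  set E : Fin N → ℂ := fun j => (Complex.log (1 + w j) - logTaylor (m + 1) (w j)) -
    (Complex.log (1 + -w j) - logTaylor (m + 1) (-w j)) with hE
  have hEb : ∀ j, ‖E j‖ ≤ 4 * |κ j| ^ (m + 1) * ‖k‖⁻¹ ^ (m + 1) := by
    intro j
    have hlt : ‖w j‖ < 1 := by linarith [hw2 j]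
    have b1 := Complex.norm_log_sub_logTaylor_le m hlt
    have b2 := Complex.norm_log_sub_logTaylor_le m (z := -w j) (by simpa using hlt)
    rw [norm_neg] at b2
    have b3 : ‖w j‖ ^ (m + 1) * (1 - ‖w j‖)⁻¹ / (m + 1) ≤ 2 * ‖w j‖ ^ (m + 1) := by
      have : (1 - ‖w j‖)⁻¹ ≤ 2 := by
        rw [inv_le_comm₀ (by linarith) (by norm_num)]; linarith [hw2 j]
      have hm : (1:ℝ) ≤ m + 1 := by linarith [show (0:ℝ) ≤ m by positivity]
      calc _ ≤ ‖w j‖ ^ (m + 1) * (1 - ‖w j‖)⁻¹ := div_le_self (mul_nonneg (by positivity) (by rw [inv_nonneg]; linarith)) hm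
        _ ≤ ‖w j‖ ^ (m + 1) * 2 := by gcongr
        _ = _ := by ring
    calc ‖E j‖ ≤ _ := norm_sub_le _ _
      _ ≤ 2 * ‖w j‖ ^ (m + 1) + 2 * ‖w j‖ ^ (m + 1) := add_le_add (b1.trans b3) (b2.trans b3)
      _ = _ := by rw [hwn, mul_pow]; ring
  have hsum : ‖∑ j, E j‖ ≤ D * ‖k‖⁻¹ ^ (m + 1) := by
    rw [hD, Finset.sum_mul]
    exact norm_sum_le_of_le _ fun j _ => hEb j
  have hsum1 : ‖∑ j, E j‖ ≤ 1 := by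
    refine hsum.trans ?_
    have h1 : ‖k‖⁻¹ ^ (m + 1) ≤ ‖k‖⁻¹ := by
      apply pow_le_of_le_one (by positivity) (inv_le_one_of_one_le₀ hk1) (by omega)
    calc D * ‖k‖⁻¹ ^ (m + 1) ≤ ‖k‖ * ‖k‖⁻¹ := by
          apply mul_le_mul (by linarith) h1 (by positivity) (by positivity)
      _ = 1 := mul_inv_cancel₀ hkpos.ne'
  have hprod : (∏ j, (k + I * κ j) / (k - I * κ j)) *
        Complex.exp (-∑ n ∈ Finset.range (m + 1), blaschkeCoeff n * (∑ j, (I * κ j) ^ n) * k⁻¹ ^ n) =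
        Complex.exp (∑ j, E j) := by
    have e1 : ∀ j, (k + I * κ j) / (k - I * κ j) = Complex.exp (Complex.log (1 + w j) - Complex.log (1 + -w j)) := by
      intro j
      have n1 : 1 + w j ≠ 0 := Complex.slitPlane_ne_zero (Complex.mem_slitPlane_of_norm_lt_one (by linarith [hw2 j]))
      have n2 : 1 + -w j ≠ 0 := Complex.slitPlane_ne_zero (Complex.mem_slitPlane_of_norm_lt_one (by rw [norm_neg]; linarith [hw2 j]))
      rw [Complex.exp_sub, Complex.exp_log n1, Complex.exp_log n2]
      have a1 : k + I * κ j = k * (1 + w j) := by simp only [hw]; field_simp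
      have a2 : k - I * κ j = k * (1 + -w j) := by simp only [hw]; field_simp; ring
      rw [a1, a2, mul_div_mul_left _ _ hk0]
    have e2 : ∑ n ∈ Finset.range (m + 1), blaschkeCoeff n * (∑ j, (I * κ j) ^ n) * k⁻¹ ^ n =
        ∑ j, (logTaylor (m + 1) (w j) - logTaylor (m + 1) (-w j)) := by
      simp only [logTaylor, ← Finset.sum_sub_distrib, Finset.mul_sum, Finset.sum_mul]
      rw [Finset.sum_comm]
      refine Finset.sum_congr rfl fun j _ => Finset.sum_congr rfl fun n _ => ?_
      simp only [hw, blaschkeCoeff]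
      rw [neg_pow (I * κ j * k⁻¹), mul_pow (I * (κ j : ℂ)) k⁻¹]
      ring
    rw [Finset.prod_congr rfl fun j _ => e1 j, ← Complex.exp_sum, ← Complex.exp_add, e2, ← sub_eq_add_neg,
      ← Finset.sum_sub_distrib]
    congr 1
    refine Finset.sum_congr rfl fun j _ => ?_
    simp only [hE]; ring
  rw [hprod]
  have := Complex.norm_exp_sub_one_le hsum1
  calc _ ≤ 2 * ‖∑ j, E j‖ := this
    _ ≤ 2 * (D * ‖k‖⁻¹ ^ (m + 1)) := by gcongr
    _ = _ := by ring


/-- Change of variables `k = ± e^t` together with the limit of the truncated integrals. -/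
lemma integral_limit {u : ℝ → ℝ} {l : ℕ} {A B ρ : ℝ} (hρ : 0 < ρ)
    (hu0 : ∀ k, k ≠ 0 → 0 ≤ u k) (hc : ContinuousOn u {k | k ≠ 0})
    (hinf : ∀ k, 1 ≤ |k| → u k ≤ A * |k|⁻¹ ^ (2 * l + 2))
    (hzero : ∀ k, k ≠ 0 → |k| < ρ → u k ≤ B + abs (Real.log |k|)) :
    Tendsto (fun T : ℝ => ∫ t in (-T)..T, (Real.exp ((2 * l + 1) * t) -
      Real.exp (-(2 * l + 1) * (2 * T + t))) * (u (Real.exp t) + u (-Real.exp t))) atTop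
      (nhds (∫ k : ℝ, k ^ (2 * l) * u k)) := by
  set p : ℝ := 2 * l + 1 with hp
  have hp1 : 1 ≤ p := by rw [hp]; have : (0:ℝ) ≤ l := by positivity
                         linarith
  -- continuity of the two branches
  have hcp : Continuous (fun t : ℝ => u (Real.exp t)) :=
    hc.comp_continuous Real.continuous_exp (fun t => (Real.exp_pos t).ne')
  have hcm : Continuous (fun t : ℝ => u (-Real.exp t)) :=
    hc.comp_continuous Real.continuous_exp.neg (fun t => (neg_neg_of_pos (Real.exp_pos t)).ne)
  -- integrability of one branch
  have hintg : ∀ g : ℝ → ℝ, Continuous g → (∀ t, 0 ≤ g t) → (∀ t, 0 ≤ t → g t ≤ A * Real.exp (-t) ^ (2 * l + 2)) →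
      (∀ t, t < Real.log ρ → g t ≤ B + |t|) → Integrable (fun t => Real.exp (p * t) * g t) := by
    intro g hg hg0 hg1 hg2
    have hF : Continuous (fun t => Real.exp (p * t) * g t) := by fun_prop
    have h1 : IntegrableOn (fun t => Real.exp (p * t) * g t) (Ioi 0) := by
      have hb : IntegrableOn (fun t : ℝ => A * Real.exp (-1 * t)) (Ioi 0) :=
        (integrableOn_exp_mul_Ioi (by norm_num) 0).const_mul A
      refine Integrable.mono' hb hF.aestronglyMeasurable.restrict ?_
      filter_upwards [ae_restrict_mem measurableSet_Ioi] with t ht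
      rw [Real.norm_of_nonneg (mul_nonneg (Real.exp_pos _).le (hg0 t))]
      calc Real.exp (p * t) * g t ≤ Real.exp (p * t) * (A * Real.exp (-t) ^ (2 * l + 2)) := by
            gcongr; exact hg1 t (le_of_lt ht)
        _ = A * (Real.exp (p * t) * Real.exp (-t) ^ (2 * l + 2)) := by ring
        _ = A * Real.exp (-1 * t) := by
            rw [← Real.exp_nat_mul, ← Real.exp_add, hp]; congr 2; push_cast; ring
    set s := min 0 (Real.log ρ - 1) with hs
    have hs0 : s ≤ 0 := min_le_left _ _
    have h2 : IntegrableOn (fun t => Real.exp (p * t) * g t) (Icc s 0) := hF.continuousOn.integrableOn_Icc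
    have h3 : IntegrableOn (fun t => Real.exp (p * t) * g t) (Iic s) := by
      have hb : IntegrableOn (fun t : ℝ => (|B| + 2) * Real.exp (1 / 2 * t)) (Iic s) :=
        (integrableOn_exp_mul_Iic (by norm_num) s).const_mul _
      refine Integrable.mono' hb hF.aestronglyMeasurable.restrict ?_
      filter_upwards [ae_restrict_mem measurableSet_Iic] with t ht
      have ht' : t ≤ s := ht
      have ht0 : t ≤ 0 := ht'.trans hs0
      rw [Real.norm_of_nonneg (mul_nonneg (Real.exp_pos _).le (hg0 t))]
      have b1 := hg2 t (by have := ht'.trans (min_le_right _ _); linarith)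
      rw [abs_of_nonpos ht0] at b1
      have b2 : Real.exp (p * t) ≤ Real.exp t := Real.exp_le_exp.2 (by nlinarith)
      have b3 : Real.exp t = Real.exp (1 / 2 * t) * Real.exp (1 / 2 * t) := by rw [← Real.exp_add]; congr 1; ring
      have b4 : Real.exp (1 / 2 * t) ≤ 1 := Real.exp_le_one_iff.2 (by linarith)
      have b5 : -(1 / 2 * t) + 1 ≤ Real.exp (-(1 / 2 * t)) := Real.add_one_le_exp _
      have b6 : Real.exp (1 / 2 * t) * Real.exp (-(1 / 2 * t)) = 1 := by rw [← Real.exp_add]; simp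
      have b7 := Real.exp_pos (1 / 2 * t)
      have b8 : Real.exp (1 / 2 * t) * (-t) ≤ 2 := by nlinarith
      calc Real.exp (p * t) * g t ≤ Real.exp t * (|B| + -t) := by
            apply mul_le_mul b2 _ (hg0 t) (Real.exp_pos _).le
            linarith [le_abs_self B]
        _ = Real.exp (1 / 2 * t) * (|B| * Real.exp (1 / 2 * t) + Real.exp (1 / 2 * t) * (-t)) := by rw [b3]; ring
        _ ≤ Real.exp (1 / 2 * t) * (|B| * 1 + 2) := by gcongr
        _ = _ := by ring
    have : (univ : Set ℝ) = Iic s ∪ Icc s 0 ∪ Ioi 0 := by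
      ext t; simp; rcases le_total t s with h | h
      · left; left; exact h
      · rcases le_or_gt t 0 with h' | h'
        · left; right; exact ⟨h, h'⟩
        · right; exact h'
    rw [← integrableOn_univ, this]
    exact (h3.union h2).union h1
  have hip := hintg _ hcp (fun t => hu0 _ (Real.exp_pos t).ne')
    (fun t ht => by
      have := hinf (Real.exp t) (by rw [abs_of_pos (Real.exp_pos t)]; exact Real.one_le_exp ht)
      rwa [abs_of_pos (Real.exp_pos t), ← Real.exp_neg] at this)
    (fun t ht => by
      have := hzero (Real.exp t) (Real.exp_pos t).ne' (by
        rw [abs_of_pos (Real.exp_pos t)]; exact (Real.lt_log_iff_exp_lt hρ).1 ht)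
      rwa [abs_of_pos (Real.exp_pos t), Real.log_exp] at this)
  have him := hintg _ hcm (fun t => hu0 _ (neg_neg_of_pos (Real.exp_pos t)).ne)
    (fun t ht => by
      have := hinf (-Real.exp t) (by rw [abs_neg, abs_of_pos (Real.exp_pos t)]; exact Real.one_le_exp ht)
      rwa [abs_neg, abs_of_pos (Real.exp_pos t), ← Real.exp_neg] at this)
    (fun t ht => by
      have := hzero (-Real.exp t) (neg_neg_of_pos (Real.exp_pos t)).ne (by
        rw [abs_neg, abs_of_pos (Real.exp_pos t)]; exact (Real.lt_log_iff_exp_lt hρ).1 ht)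
      rwa [abs_neg, abs_of_pos (Real.exp_pos t), Real.log_exp] at this)
  -- change of variables
  have hcv : ∀ g : ℝ → ℝ, Integrable (fun t => Real.exp (p * t) * g (Real.exp t)) →
      IntegrableOn (fun k => k ^ (2 * l) * g k) (Ioi 0) ∧
      ∫ k in Ioi 0, k ^ (2 * l) * g k = ∫ t, Real.exp (p * t) * g (Real.exp t) := by
    intro g hg
    have hfun : (fun t : ℝ => |Real.exp t| • ((Real.exp t) ^ (2 * l) * g (Real.exp t))) =
        fun t => Real.exp (p * t) * g (Real.exp t) := by
      ext t
      rw [abs_of_pos (Real.exp_pos t), smul_eq_mul, ← mul_assoc, ← Real.exp_nat_mul, ← Real.exp_add, hp]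
      congr 2; push_cast; ring
    have him : Real.exp '' univ = Ioi 0 := by rw [image_univ, Real.range_exp]
    constructor
    · rw [← him, integrableOn_image_iff_integrableOn_abs_deriv_smul MeasurableSet.univ
        (fun t _ => (Real.hasDerivAt_exp t).hasDerivWithinAt) Real.exp_injective.injOn, hfun]
      exact hg.integrableOn
    · rw [← him, integral_image_eq_integral_abs_deriv_smul MeasurableSet.univ
        (fun t _ => (Real.hasDerivAt_exp t).hasDerivWithinAt) Real.exp_injective.injOn, hfun, setIntegral_univ]
  obtain ⟨ip, ep⟩ := hcv u hip
  obtain ⟨im, em⟩ := hcv (fun k => u (-k)) him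
  have htot : ∫ k : ℝ, k ^ (2 * l) * u k = ∫ t, Real.exp (p * t) * (u (Real.exp t) + u (-Real.exp t)) := by
    have h1 : ∫ k in Iic (0:ℝ), k ^ (2 * l) * u k = ∫ k in Ioi 0, k ^ (2 * l) * u (-k) := by
      have := integral_comp_neg_Ioi (0:ℝ) (fun k : ℝ => k ^ (2 * l) * u k)
      simpa [Even.neg_pow] using this.symm
    have h2 : IntegrableOn (fun k : ℝ => k ^ (2 * l) * u k) (Iic 0) := by
      rw [integrableOn_Iic_iff_integrableOn_Iio]
      have := IntegrableOn.comp_neg_Iio (c := (0:ℝ)) (f := fun k => k ^ (2 * l) * u (-k)) (by simpa using im)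
      simpa [Even.neg_pow] using this
    rw [← integral_add_compl (measurableSet_Iic (a := (0:ℝ))), compl_Iic, h1, ep, em, ← integral_add him hip]
    · congr 1; ext t; ring
    · rw [← integrableOn_univ, ← Iic_union_Ioi (a := (0:ℝ))]; exact h2.union ip
  rw [htot]
  -- dominated convergence
  set φ : ℝ → ℝ := fun t => u (Real.exp t) + u (-Real.exp t) with hφ
  have hφc : Continuous φ := hcp.add hcm
  have hφ0 : ∀ t, 0 ≤ φ t := fun t =>
    add_nonneg (hu0 _ (Real.exp_pos t).ne') (hu0 _ (neg_neg_of_pos (Real.exp_pos t)).ne)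
  have hφi : Integrable (fun t => Real.exp (p * t) * φ t) := by
    have := hip.add him
    refine this.congr (Eventually.of_forall fun t => ?_)
    simp only [Pi.add_apply, hφ]; ring
  have hDC := tendsto_integral_filter_of_dominated_convergence (μ := volume) (l := (atTop : Filter ℝ))
    (F := fun T => (Ioc (-T) T).indicator (fun t => (Real.exp (p * t) - Real.exp (-p * (2 * T + t))) * φ t))
    (f := fun t => Real.exp (p * t) * φ t) (fun t => Real.exp (p * t) * φ t)
    (Eventually.of_forall fun T => (Continuous.aestronglyMeasurable (by fun_prop)).indicator measurableSet_Ioc)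
    (Eventually.of_forall fun T => Eventually.of_forall fun t => by
      by_cases ht : t ∈ Ioc (-T) T
      · rw [indicator_of_mem ht]
        have e1 : Real.exp (-p * (2 * T + t)) ≤ Real.exp (p * t) := Real.exp_le_exp.2 (by nlinarith [ht.1])
        rw [Real.norm_of_nonneg (mul_nonneg (by linarith) (hφ0 t))]
        exact mul_le_mul_of_nonneg_right (by linarith [Real.exp_pos (-p * (2 * T + t))]) (hφ0 t)
      · rw [indicator_of_notMem ht, norm_zero]
        exact mul_nonneg (Real.exp_pos _).le (hφ0 t))
    hφi
    (Eventually.of_forall fun t => by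
      have h1 : Tendsto (fun T : ℝ => (Real.exp (p * t) - Real.exp (-p * (2 * T + t))) * φ t) atTop
          (nhds ((Real.exp (p * t) - 0) * φ t)) := by
        refine (tendsto_const_nhds.sub ?_).mul_const _
        refine Real.tendsto_exp_atBot.comp ?_
        refine Tendsto.const_mul_atTop_of_neg (by linarith) ?_
        exact tendsto_atTop_add_const_right _ _ (tendsto_id.const_mul_atTop (by norm_num))
      rw [sub_zero] at h1
      refine h1.congr' ?_
      filter_upwards [eventually_ge_atTop |t|, eventually_gt_atTop (-t)] with T hT hT2
      rw [indicator_of_mem]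
      exact ⟨by linarith, (le_abs_self t).trans hT⟩)
  refine hDC.congr' ?_
  filter_upwards [eventually_ge_atTop 0] with T hT
  rw [integral_indicator measurableSet_Ioc, intervalIntegral.integral_of_le (by linarith)]


lemma zf_main
    {v : SchwartzMap ℝ ℝ} {f₁ f₁' f₁'' f₂ f₂' f₂'' : ℂ → ℝ → ℂ}
    (hd : ZFData v f₁ f₁' f₁'' f₂ f₂' f₂'')
    {a : ℂ → ℂ}
    (ha : ∀ κ : ℂ, 0 ≤ κ.im → κ ≠ 0 →
      a κ = (f₁' κ 0 * f₂ κ 0 - f₁ κ 0 * f₂' κ 0) / (2 * Complex.I * κ))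
    {N : ℕ} {κ : Fin N → ℝ} (hκpos : ∀ j, 0 < κ j) (hκinj : Function.Injective κ)
    (hzero : ∀ j, a (Complex.I * κ j) = 0)
    (hall : ∀ z : ℂ, 0 < z.im → a z = 0 → ∃ j, z = Complex.I * κ j) (l : ℕ) :
    ∫ k : ℝ, k ^ (2 * l) * Real.log ‖a k‖ = (I * π * (((∫ x : ℝ, sigmaZF (⇑v) (2 * l + 1) x : ℝ) : ℂ) * (2 * I)⁻¹ ^ (2 * l + 1)
      - blaschkeCoeff (2 * l + 1) * ∑ j, (I * κ j) ^ (2 * l + 1))).re := by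
  obtain ⟨W, hW, hWe⟩ := exists_wronskian v f₁ f₁' f₁'' f₂ f₂' f₂'' hd.h1 hd.hj1 hd.h2 hd.hj2
  have haW : ∀ k : ℂ, 0 ≤ k.im → k ≠ 0 → a k = W k / (2 * I * k) := fun k h0 h1 => by
    rw [ha k h0 h1, hWe k h0 h1]
  have hden : ∀ k : ℂ, k ≠ 0 → 2 * I * k ≠ 0 := fun k hk => by simp [hk]
  have ha1 : ∀ t : ℝ, t ≠ 0 → 1 ≤ ‖a t‖ := fun t ht => by
    rw [ha t (by simp) (by exact_mod_cast ht)]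
    exact one_le_a hd t ht
  have hWlow : ∀ t : ℝ, t ≠ 0 → 2 * |t| ≤ ‖W t‖ := fun t ht => by
    have := ha1 t ht
    rw [haW t (by simp) (by exact_mod_cast ht), norm_div, one_le_div (norm_pos_iff.2 (hden _ (by exact_mod_cast ht)))] at this
    simpa using this
  have hκim : ∀ j, (I * (κ j : ℂ)).im = κ j := fun j => by simp
  have hκ0 : ∀ j, I * (κ j : ℂ) ≠ 0 := fun j => by simp [(hκpos j).ne']
  have hWz : ∀ j, W (I * κ j) = 0 := fun j => by
    have := hzero j
    rw [haW _ (by rw [hκim]; exact (hκpos j).le) (hκ0 j), div_eq_zero_iff] at this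
    exact this.resolve_right (hden _ (hκ0 j))
  obtain ⟨G, hG, hGe⟩ := factor_zeros hW hκpos hκinj hWz Finset.univ
  have hG0 : ∀ k : ℂ, 0 ≤ k.im → k ≠ 0 → G k ≠ 0 := by
    intro k hk hk0 hGk
    have hWk : W k = 0 := by rw [hGe k, hGk, mul_zero]
    have hak : a k = 0 := by rw [haW k hk hk0, hWk, zero_div]
    rcases hk.eq_or_lt with hk' | hk'
    · have hkr : k = (k.re : ℂ) := by apply Complex.ext <;> simp [← hk']
      have := ha1 k.re (by intro h; rw [h] at hkr; simp at hkr; exact hk0 hkr)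
      rw [← hkr, hak, norm_zero] at this
      linarith
    · obtain ⟨i, hi⟩ := hall k hk' hak
      have hs := simple_zero hd hW hWe (hκpos i) (hWz i)
      apply hs
      rw [← hi]
      have hGd : DifferentiableAt ℂ G k := hG.differentiableAt (mem_of_superset
        ((isOpen_lt continuous_const Complex.continuous_im).mem_nhds hk') (fun z (hz : 0 < z.im) => hz.le))
      have hPd : DifferentiableAt ℂ (fun k : ℂ => ∏ j, (k - I * κ j)) k := by fun_prop
      have hWf : W = fun k => (∏ j, (k - I * κ j)) * G k := funext hGe
      rw [hWf, (hPd.hasDerivAt.fun_mul hGd.hasDerivAt).deriv, hGk,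
        Finset.prod_eq_zero (Finset.mem_univ i) (by rw [hi, sub_self])]
      simp
  set Y : ℂ → ℂ := fun k => (∏ j, (k + I * κ j)) * G k with hY
  have hYd : DifferentiableOn ℂ Y {z | 0 ≤ z.im} := by
    refine DifferentiableOn.fun_mul ?_ hG
    fun_prop
  have hY0 : ∀ k : ℂ, 0 ≤ k.im → k ≠ 0 → Y k ≠ 0 := fun k hk hk0 => by
    refine mul_ne_zero (Finset.prod_ne_zero_iff.2 fun j _ h => ?_) (hG0 k hk hk0)
    have := congrArg Complex.im h
    rw [Complex.add_im, hκim, Complex.zero_im] at this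
    linarith [hκpos j]
  have hYW : ∀ t : ℝ, ‖Y t‖ = ‖W t‖ := fun t => by
    simp only [hY]
    rw [hGe t, norm_mul, norm_mul, norm_prod, norm_prod]
    congr 1
    refine Finset.prod_congr rfl fun j _ => ?_
    rw [← Complex.norm_conj]
    congr 1
    simp [sub_eq_add_neg]
  set Q : ℂ → ℂ := fun k => Y k / (2 * I * k) with hQ
  have hQc : ContinuousOn Q {k | 0 ≤ k.im ∧ k ≠ 0} := by
    refine ContinuousOn.div (hYd.continuousOn.mono fun k hk => hk.1) (by fun_prop) (fun k hk => hden k hk.2)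
  have hQd : DifferentiableOn ℂ Q {k | 0 < k.im} := by
    refine DifferentiableOn.fun_div (hYd.mono fun k (hk : 0 < k.im) => hk.le) (by fun_prop) (fun k hk => hden k ?_)
    rintro rfl; simp at hk
  have hQ0 : ∀ k : ℂ, 0 ≤ k.im → k ≠ 0 → Q k ≠ 0 := fun k h0 h1 => div_ne_zero (hY0 k h0 h1) (hden k h1)
  have hQa : ∀ t : ℝ, t ≠ 0 → ‖a t‖ = ‖Q t‖ := fun t ht => by
    rw [haW t (by simp) (by exact_mod_cast ht)]
    simp only [hQ]
    rw [norm_div, norm_div, hYW]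
  -- asymptotics
  set s : ℕ → ℂ := fun n => ((∫ x : ℝ, sigmaZF (⇑v) n x : ℝ) : ℂ) with hs
  set c : ℕ → ℂ := fun n => s n * (2 * I)⁻¹ ^ n - blaschkeCoeff n * ∑ j, (I * κ j) ^ n with hc
  have hceven : ∀ n, c (2 * n) = 0 := fun n => by
    simp only [hc, hs]
    rw [even_vanish hd n, blaschkeCoeff_even]; simp
  obtain ⟨C1, hC1, hA1⟩ := asympt_a hd (M := 2 * l + 1) (by omega)
  obtain ⟨C2, R, hC2, hR, hA2⟩ := blaschke_asympt κ (2 * l + 1)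
  have hA : ∃ C R' : ℝ, 1 ≤ R' ∧ ∀ k : ℂ, 0 ≤ k.im → R' ≤ ‖k‖ →
      ‖Q k * Complex.exp (∑ n ∈ Finset.range (2 * l + 2), c n * k⁻¹ ^ n) - 1‖ ≤ C * ‖k‖⁻¹ ^ (2 * l + 2) := by
    set E : ℝ := ∑ n ∈ Finset.range (2 * l + 2), ‖s n‖ * ‖(2 * I)⁻¹‖ ^ n with hE
    refine ⟨C1 * Real.exp E * (1 + C2) + C2, R + ∑ j, κ j, ?_, ?_⟩
    · have : 0 ≤ ∑ j, κ j := Finset.sum_nonneg fun j _ => (hκpos j).le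
      linarith
    intro k hk hkR
    have hsn : 0 ≤ ∑ j, κ j := Finset.sum_nonneg fun j _ => (hκpos j).le
    have hk1 : 1 ≤ ‖k‖ := by linarith
    have hkp : 0 < ‖k‖ := by linarith
    have hk0 : k ≠ 0 := norm_pos_iff.1 hkp
    have a1 := hA1 k hk hk1
    have a2 := hA2 k (by linarith)
    rw [← ha k hk hk0] at a1
    simp only [show 2 * l + 1 + 1 = 2 * l + 2 by ring] at a1 a2
    set B := ∏ j, (k + I * κ j) / (k - I * κ j) with hB
    set S := ∑ n ∈ Finset.range (2 * l + 2), ((∫ x : ℝ, sigmaZF (⇑v) n x : ℝ) : ℂ) * ((2 * I * k)⁻¹) ^ n with hS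
    set T := ∑ n ∈ Finset.range (2 * l + 2), blaschkeCoeff n * (∑ j, (I * κ j) ^ n) * k⁻¹ ^ n with hT
    have hQB : Q k = a k * B := by
      have hne : ∀ j, k - I * κ j ≠ 0 := fun j h => by
        have h1 := sub_eq_zero.1 h
        have h2 : ‖k‖ = κ j := by rw [h1]; simp [abs_of_pos (hκpos j)]
        have := Finset.single_le_sum (f := κ) (fun j _ => (hκpos j).le) (Finset.mem_univ j)
        linarith
      rw [haW k hk hk0, hGe k, hB, Finset.prod_div_distrib]
      simp only [hQ, hY]
      have : ∏ j, (k - I * κ j) ≠ 0 := Finset.prod_ne_zero_iff.2 fun j _ => hne j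
      field_simp
    have hST : ∑ n ∈ Finset.range (2 * l + 2), c n * k⁻¹ ^ n = S - T := by
      rw [hS, hT, ← Finset.sum_sub_distrib]
      refine Finset.sum_congr rfl fun n _ => ?_
      simp only [hc, hs]
      rw [mul_inv (2 * I) k, mul_pow]; ring
    have hSE : ‖S‖ ≤ E := by
      refine norm_sum_le_of_le _ fun n _ => ?_
      rw [mul_inv (2 * I) k, mul_pow, norm_mul, norm_mul, norm_pow, norm_pow, norm_inv k]
      refine mul_le_mul_of_nonneg_left (mul_le_of_le_one_right (by positivity) ?_) (norm_nonneg _)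
      exact pow_le_one₀ (by positivity) (inv_le_one_of_one_le₀ hk1)
    have hx : ‖a k * Complex.exp S - 1‖ ≤ C1 * Real.exp E * ‖k‖⁻¹ ^ (2 * l + 2) := by
      have e : a k * Complex.exp S - 1 = (a k - Complex.exp (-S)) * Complex.exp S := by
        rw [sub_mul, ← Complex.exp_add]; simp
      rw [e, norm_mul]
      have : ‖Complex.exp S‖ ≤ Real.exp E := by
        rw [Complex.norm_exp]
        exact Real.exp_le_exp.2 ((Complex.re_le_norm S).trans hSE)
      calc _ ≤ (C1 * ‖k‖⁻¹ ^ (2 * l + 2)) * Real.exp E := by gcongr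
        _ = _ := by ring
    have hbB : ‖B * Complex.exp (-T)‖ ≤ 1 + C2 := by
      have h1 : ‖k‖⁻¹ ^ (2 * l + 2) ≤ 1 := pow_le_one₀ (by positivity) (inv_le_one_of_one_le₀ hk1)
      have h2 := norm_add_le (B * Complex.exp (-T) - 1) 1
      rw [sub_add_cancel, norm_one] at h2
      nlinarith
    have e : Q k * Complex.exp (S - T) - 1 = (a k * Complex.exp S - 1) * (B * Complex.exp (-T)) + (B * Complex.exp (-T) - 1) := by
      rw [hQB, sub_eq_add_neg S T, Complex.exp_add]; ring
    rw [hST, e]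
    calc _ ≤ ‖a k * Complex.exp S - 1‖ * ‖B * Complex.exp (-T)‖ + ‖B * Complex.exp (-T) - 1‖ := by
          refine (norm_add_le _ _).trans ?_; rw [norm_mul]
      _ ≤ (C1 * Real.exp E * ‖k‖⁻¹ ^ (2 * l + 2)) * (1 + C2) + C2 * ‖k‖⁻¹ ^ (2 * l + 2) := by gcongr
      _ = _ := by ring
  obtain ⟨C, R', hR', hA⟩ := hA
  obtain ⟨h, r, C', hhc, hhd, hhe, hhA⟩ := log_strip_asympt hQc hQd hQ0 hR' hA
  have hhre : ∀ z : ℂ, 0 ≤ z.im → z.im ≤ π → (h z).re = Real.log ‖Q (Complex.exp z)‖ := fun z h0 h1 => by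
    rw [← hhe z h0 h1, Complex.norm_exp, Real.log_exp]
  -- near zero
  obtain ⟨ρ, c0, C0, hρ, hc0, hC0, hnear⟩ := near_zero_bounds hYd (fun t ht => by rw [hYW]; exact hWlow t ht)
  have hlogQ : ∀ k : ℂ, 0 ≤ k.im → k ≠ 0 → ‖k‖ < ρ →
      abs (Real.log ‖Q k‖) ≤ (|Real.log c0| + |Real.log C0| + Real.log 2) + abs (Real.log ‖k‖) := by
    intro k hk hk0 hkρ
    obtain ⟨b1, b2⟩ := hnear k hk hkρ
    have hkp : 0 < ‖k‖ := norm_pos_iff.2 hk0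
    have hYp : 0 < ‖Y k‖ := norm_pos_iff.2 (hY0 k hk hk0)
    have l1 : Real.log c0 + Real.log ‖k‖ ≤ Real.log ‖Y k‖ := by
      rw [← Real.log_mul hc0.ne' hkp.ne']; exact Real.log_le_log (by positivity) b1
    have l2 : Real.log ‖Y k‖ ≤ Real.log C0 := Real.log_le_log hYp b2
    have l3 : Real.log ‖Q k‖ = Real.log ‖Y k‖ - (Real.log 2 + Real.log ‖k‖) := by
      simp only [hQ]
      have hn : ‖2 * I * k‖ = 2 * ‖k‖ := by simp
      rw [norm_div, Real.log_div hYp.ne' (norm_pos_iff.2 (hden k hk0)).ne', hn,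
        Real.log_mul (by norm_num) hkp.ne']
    have l4 : 0 ≤ Real.log 2 := Real.log_nonneg (by norm_num)
    rw [l3, abs_le]
    have := neg_abs_le (Real.log c0)
    have := le_abs_self (Real.log C0)
    have := neg_abs_le (Real.log ‖k‖)
    have := abs_nonneg (Real.log c0)
    have := abs_nonneg (Real.log C0)
    have := abs_nonneg (Real.log ‖k‖)
    constructor <;> linarith
  set B0 := |Real.log c0| + |Real.log C0| + Real.log 2 with hB0
  have lim1 := contour_core (l := l) (c := c) (C := C') (r := r) (C₂ := B0) (r₂ := Real.log ρ - 1) hhc hhd hceven hhA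
    (fun z h0 h1 hz => by
      rw [hhre z h0 h1]
      have := hlogQ (Complex.exp z) (exp_strip_im h0 h1) (Complex.exp_ne_zero _) (by
        rw [Complex.norm_exp, ← Real.lt_log_iff_exp_lt hρ]; linarith)
      rwa [Complex.norm_exp, Real.log_exp] at this)
  obtain ⟨C3, hC3, hA3⟩ := asympt_real hd (M := l + 1) (by omega)
  have lim2 := integral_limit (u := fun k : ℝ => Real.log ‖a k‖) (l := l) (A := C3) (B := B0) (ρ := ρ) hρ
    (fun k hk => Real.log_nonneg (ha1 k hk))
    (by
      have h1 : ContinuousOn (fun k : ℝ => Real.log ‖Q k‖) {k | k ≠ 0} := by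
        refine ContinuousOn.log (ContinuousOn.norm ?_) (fun k hk => ?_)
        · exact hQc.comp (by fun_prop) (fun k (hk : k ≠ 0) => ⟨by simp, by exact_mod_cast hk⟩)
        · exact (norm_pos_iff.2 (hQ0 k (by simp) (by exact_mod_cast hk))).ne'
      refine h1.congr fun k hk => ?_
      simp only
      rw [hQa k hk])
    (fun k hk => by
      have hk0 : k ≠ 0 := by rintro rfl; simp at hk; linarith
      have hkp : 0 < |k| := by linarith
      have b := hA3 k hk
      rw [← ha k (by simp) (by exact_mod_cast hk0)] at b
      have b1 := ha1 k hk0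
      have b2 := Real.log_le_sub_one_of_pos (x := ‖a k‖) (by linarith)
      have b3 : |k|⁻¹ ^ (2 * (l + 1) + 2) ≤ |k|⁻¹ ^ (2 * l + 2) :=
        pow_le_pow_of_le_one (by positivity) (inv_le_one_of_one_le₀ hk) (by omega)
      have b4 := mul_le_mul_of_nonneg_left b3 hC3
      nlinarith)
    (fun k hk hkρ => by
      rw [hQa k hk]
      have := hlogQ k (by simp) (by exact_mod_cast hk) (by simpa using hkρ)
      rw [Complex.norm_real, Real.norm_eq_abs] at this
      exact (le_abs_self _).trans this)
  have heq : ∀ t : ℝ, (h t).re + (h (t + π * I)).re = Real.log ‖a (Real.exp t : ℝ)‖ + Real.log ‖a ((-Real.exp t : ℝ) : ℂ)‖ := by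
    intro t
    rw [hhre _ (by simp) (by simp [pi_pos.le]), hhre _ (by simp [pi_pos.le]) (by simp),
      hQa _ (Real.exp_pos t).ne', hQa _ (neg_neg_of_pos (Real.exp_pos t)).ne, Complex.exp_add, Complex.exp_pi_mul_I]
    simp
  simp only [heq] at lim1
  exact tendsto_nhds_unique lim2 lim1

theorem zakharov_faddeev_trace_identities
    (v : SchwartzMap ℝ ℝ)
    (f₁ f₁' f₁'' f₂ f₂' f₂'' : ℂ → ℝ → ℂ)
    (h1 : ∀ κ : ℂ, 0 ≤ κ.im → κ ≠ 0 → IsSchrodingerSolution (⇑v) κ (f₁ κ) (f₁' κ) (f₁'' κ))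
    (hj1 : ∀ κ : ℂ, 0 ≤ κ.im → κ ≠ 0 → IsJostAtPlusInfinity κ (f₁ κ) (f₁' κ))
    (h2 : ∀ κ : ℂ, 0 ≤ κ.im → κ ≠ 0 → IsSchrodingerSolution (⇑v) κ (f₂ κ) (f₂' κ) (f₂'' κ))
    (hj2 : ∀ κ : ℂ, 0 ≤ κ.im → κ ≠ 0 → IsJostAtMinusInfinity κ (f₂ κ) (f₂' κ))
    (a : ℂ → ℂ)
    (ha : ∀ κ : ℂ, 0 ≤ κ.im → κ ≠ 0 →
      a κ = (f₁' κ 0 * f₂ κ 0 - f₁ κ 0 * f₂' κ 0) / (2 * Complex.I * κ))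
    (N : ℕ) (κ : Fin N → ℝ) (hκpos : ∀ j, 0 < κ j) (hκinj : Function.Injective κ)
    (hzero : ∀ j, a (Complex.I * κ j) = 0)
    (hall : ∀ z : ℂ, 0 < z.im → a z = 0 → ∃ j, z = Complex.I * κ j) :
    ∀ l : ℕ,
      (1 / (↑π * Complex.I)) * ((∫ k : ℝ, k ^ (2 * l) * Real.log ‖a k‖ : ℝ) : ℂ) +
          (2 / (2 * (l : ℂ) + 1)) * ∑ j, (Complex.I * κ j) ^ (2 * l + 1) =
        (1 / (2 * Complex.I)) ^ (2 * l + 1) * ((∫ x : ℝ, sigmaZF (⇑v) (2 * l + 1) x : ℝ) : ℂ) := by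
  intro l
  have hm := zf_main ⟨h1, hj1, h2, hj2⟩ ha hκpos hκinj hzero hall l
  rw [hm]
  set s : ℝ := ∫ x : ℝ, sigmaZF (⇑v) (2 * l + 1) x
  rw [blaschkeCoeff_odd]
  set Sg := ∑ j, (I * (κ j : ℂ)) ^ (2 * l + 1) with hSg
  have hodd : Odd (2 * l + 1) := ⟨l, rfl⟩
  have hSgc : (starRingEnd ℂ) Sg = -Sg := by
    rw [hSg, map_sum, ← Finset.sum_neg_distrib]
    refine Finset.sum_congr rfl fun j _ => ?_
    rw [map_pow, map_mul, Complex.conj_I, Complex.conj_ofReal, neg_mul, hodd.neg_pow]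
  have hc2 : (starRingEnd ℂ) (2 : ℂ) = 2 := Complex.conj_ofReal 2
  have h2c : (starRingEnd ℂ) ((2 * I)⁻¹ ^ (2 * l + 1)) = -(2 * I)⁻¹ ^ (2 * l + 1) := by
    rw [map_pow, map_inv₀, map_mul, Complex.conj_I, ← hodd.neg_pow]
    congr 1
    rw [mul_neg, inv_neg, hc2]
  have hreal : (starRingEnd ℂ) (I * π * ((s : ℂ) * (2 * I)⁻¹ ^ (2 * l + 1) - 2 / (2 * l + 1) * Sg)) =
      I * π * ((s : ℂ) * (2 * I)⁻¹ ^ (2 * l + 1) - 2 / (2 * l + 1) * Sg) := by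
    rw [map_mul, map_mul, map_sub, map_mul, map_mul, hSgc, h2c, Complex.conj_I, Complex.conj_ofReal, Complex.conj_ofReal]
    have : (starRingEnd ℂ) (2 / (2 * (l : ℂ) + 1)) = 2 / (2 * l + 1) := by
      simp [hc2]
    rw [this]; ring
  rw [Complex.conj_eq_iff_re.1 hreal]
  have hpi : (π : ℂ) ≠ 0 := by exact_mod_cast pi_ne_zero
  have : (1 / (↑π * I)) * (I * π * ((s : ℂ) * (2 * I)⁻¹ ^ (2 * l + 1) - 2 / (2 * l + 1) * Sg)) =
      (s : ℂ) * (2 * I)⁻¹ ^ (2 * l + 1) - 2 / (2 * l + 1) * Sg := by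
    rw [← mul_assoc, mul_comm I (π : ℂ), one_div, inv_mul_cancel₀ (mul_ne_zero hpi I_ne_zero), one_mul]
  rw [this, one_div]
  ring
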